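/- If the Riemann Hypothesis is true, then for all real x ≥ 11, |ψ(x) - x| ≤ √x · log x · ( (log x)/(8π) - (1/(2π) + 1.465/log x) · log log x + 1.2325 ). -/

import Mathlib

open Real Finset

noncomputable def chebyshevPsi (x : ℝ) : ℝ :=
  ∑ n ∈ Finset.range (⌊x⌋₊ + 1), ArithmeticFunction.vonMangoldt n

namespace PsiRH

open Complex Filter Topology MeasureTheory

local notation "conj" => starRingEnd ℂ

noncomputable def xi (s : ℂ) : ℂ := s * (s - 1) * completedRiemannZeta₀ s + 1

lemma xi_differentiable : Differentiable ℂ xi := by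
  unfold xi
  have := differentiable_completedZeta₀
  fun_prop

lemma xi_one_sub (s : ℂ) : xi (1 - s) = xi s := by
  unfold xi
  rw [completedRiemannZeta₀_one_sub]; ring

lemma xi_one : xi 1 = 1 := by simp [xi]

lemma xi_eq_completed {s : ℂ} (h0 : s ≠ 0) (h1 : s ≠ 1) :
    xi s = s * (s - 1) * completedRiemannZeta s := by
  rw [completedRiemannZeta_eq, xi]
  have : 1 - s ≠ 0 := sub_ne_zero.mpr (Ne.symm h1)
  field_simp
  ring

lemma xi_eq {s : ℂ} (h0 : 0 < s.re) (h1 : s ≠ 1) :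
    xi s = s * (s - 1) * (Gammaℝ s * riemannZeta s) := by
  have hs : s ≠ 0 := by rintro rfl; simp at h0
  rw [xi_eq_completed hs h1, riemannZeta_def_of_ne_zero hs,
    mul_div_cancel₀ _ (Gammaℝ_ne_zero_of_re_pos h0)]

lemma Gammaℝ_conj (s : ℂ) : Gammaℝ (conj s) = conj (Gammaℝ s) := by
  rw [Gammaℝ_def, Gammaℝ_def, map_mul, ← Complex.Gamma_conj]
  have h2 : conj 2 = 2 := conj_ofNat 2
  congr 1
  · have := cpow_conj (π : ℂ) (-s / 2)
      (by rw [arg_ofReal_of_nonneg Real.pi_pos.le]; exact Real.pi_pos.ne)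
    rw [conj_ofReal] at this
    rw [← this, map_div₀, map_neg, h2]
  · rw [map_div₀, h2]

lemma xi_conj (s : ℂ) : xi (conj s) = conj (xi s) := by
  have hg_an : AnalyticOnNhd ℂ (fun z ↦ conj (xi (conj z))) Set.univ :=
    DifferentiableOn.analyticOnNhd
        (fun z hz ↦ (differentiableAt_conj_conj_iff.mpr
          (xi_differentiable _)).differentiableWithinAt) isOpen_univ
  have hx : AnalyticOnNhd ℂ xi Set.univ :=
    xi_differentiable.differentiableOn.analyticOnNhd isOpen_univ
  have := hg_an.eqOn_of_preconnected_of_eventuallyEq hx isPreconnected_univ (Set.mem_univ (2:ℂ))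
    (eventuallyEq_of_mem
      ((isOpen_lt continuous_const continuous_re).mem_nhds (by norm_num : (1:ℝ) < (2:ℂ).re)) ?_)
  · have h := congrArg conj (this (Set.mem_univ s))
    simpa using h
  · intro z (hz : 1 < z.re)
    have h1 : z ≠ 1 := by rintro rfl; simp at hz
    have h1' : conj z ≠ 1 := by
      intro h; apply h1; have := congrArg conj h; simpa using this
    simp only
    rw [xi_eq (by simp; linarith) h1', xi_eq (by linarith) h1, Gammaℝ_conj, riemannZeta_conj]
    simp

lemma xi_ne_zero (hRH : RiemannHypothesis) {s : ℂ} (hs : 1 / 2 < s.re) : xi s ≠ 0 := by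
  by_cases h1 : s = 1
  · rw [h1, xi_one]; exact one_ne_zero
  rw [xi_eq (by linarith) h1]
  have h0 : s ≠ 0 := by rintro rfl; norm_num at hs
  refine mul_ne_zero (mul_ne_zero h0 (sub_ne_zero.mpr h1))
    (mul_ne_zero (Gammaℝ_ne_zero_of_re_pos (by linarith)) ?_)
  intro hz
  have := hRH s hz ?_ h1
  · linarith
  · rintro ⟨n, hn⟩
    have : s.re = -2 * (n + 1) := by rw [hn]; simp
    rw [this] at hs
    have : (0:ℝ) ≤ n := n.cast_nonneg
    linarith

lemma xi_strip_bound : ∃ C : ℝ, 0 < C ∧ ∀ s : ℂ, -1 ≤ s.re → s.re ≤ 4 →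
    ‖xi s‖ ≤ C * (1 + ‖s‖) ^ 2 := by
  set P := HurwitzZeta.hurwitzEvenFEPair 0
  have hconv : ∀ s : ℂ, MellinConvergent P.f_modif s := fun s =>
    (P.isStrongFEPair_toStrongFEPair.hasMellin s).1
  have hint : ∀ a : ℝ, IntegrableOn (fun t : ℝ => t ^ (a - 1) * ‖P.f_modif t‖) (Set.Ioi 0) := by
    intro a
    have : IntegrableOn _ _ _ := (hconv a).norm
    refine this.congr_fun (fun t ht => ?_) measurableSet_Ioi
    simp only [norm_smul]
    rw [norm_cpow_eq_rpow_re_of_pos ht]; simp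
  set K : ℝ := (∫ t in Set.Ioi 0, t ^ ((-1/2 : ℝ) - 1) * ‖P.f_modif t‖) +
    ∫ t in Set.Ioi 0, t ^ ((2 : ℝ) - 1) * ‖P.f_modif t‖
  have hK0 : 0 ≤ K := by
    refine add_nonneg ?_ ?_ <;>
    · refine setIntegral_nonneg measurableSet_Ioi (fun t (ht : 0 < t) => ?_)
      positivity
  have hL : ∀ s : ℂ, -1 ≤ s.re → s.re ≤ 4 → ‖completedRiemannZeta₀ s‖ ≤ K := by
    intro s h1 h2
    have e : completedRiemannZeta₀ s = mellin P.f_modif (s / 2) / 2 := rfl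
    rw [e, norm_div]
    have : ‖mellin P.f_modif (s / 2)‖ ≤ K := by
      rw [mellin]
      refine (norm_integral_le_integral_norm _).trans ?_
      simp only [K]
      rw [← integral_add (hint _) (hint _)]
      refine setIntegral_mono_on (hconv _).norm ((hint _).add (hint _)) measurableSet_Ioi ?_
      intro t (ht : 0 < t)
      rw [norm_smul, norm_cpow_eq_rpow_re_of_pos ht, ← add_mul]
      gcongr
      have hre : (s / 2 - 1).re = s.re / 2 - 1 := by simp
      rw [hre]
      rcases le_total t 1 with h | h
      · have := Real.rpow_le_rpow_of_exponent_ge ht h (by linarith : (-1/2:ℝ) - 1 ≤ s.re / 2 - 1)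
        exact this.trans (le_add_of_nonneg_right (Real.rpow_pos_of_pos ht ((2:ℝ) - 1)).le)
      · have := Real.rpow_le_rpow_of_exponent_le h (by linarith : s.re / 2 - 1 ≤ (2:ℝ) - 1)
        exact this.trans (le_add_of_nonneg_left (Real.rpow_pos_of_pos ht ((-1/2:ℝ) - 1)).le)
    norm_num
    linarith
  refine ⟨K + 1, by linarith, fun s h1 h2 => ?_⟩
  rw [xi]
  refine (norm_add_le _ _).trans ?_
  rw [norm_mul, norm_mul, norm_one]
  have hs1 : ‖s - 1‖ ≤ ‖s‖ + 1 := by simpa using norm_sub_le s 1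
  have := hL s h1 h2
  have hn := norm_nonneg s
  calc ‖s‖ * ‖s - 1‖ * ‖completedRiemannZeta₀ s‖ + 1
      ≤ (1 + ‖s‖) * (1 + ‖s‖) * K + 1 := by gcongr <;> linarith
    _ ≤ _ := by nlinarith

end PsiRH


namespace PsiRH
open Complex Filter Topology MeasureTheory

local notation "conj" => starRingEnd ℂ

noncomputable def dg (x : ℝ) : ℝ := deriv (Real.log ∘ Real.Gamma) x

lemma hasDerivAt_logGamma {x : ℝ} (hx : 0 < x) :
    HasDerivAt (Real.log ∘ Real.Gamma) (dg x) x := by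
  apply DifferentiableAt.hasDerivAt
  have h1 : DifferentiableAt ℝ Real.Gamma x := Real.differentiableAt_Gamma (fun m => by
    have : (0:ℝ) ≤ m := m.cast_nonneg
    linarith)
  exact (Real.differentiableAt_log (Real.Gamma_pos_of_pos hx).ne').comp x h1

lemma slope_logGamma {x : ℝ} (hx : 0 < x) :
    slope (Real.log ∘ Real.Gamma) x (x + 1) = Real.log x := by
  rw [slope_def_field]
  simp only [Function.comp]
  rw [Real.Gamma_add_one hx.ne', Real.log_mul hx.ne' (Real.Gamma_pos_of_pos hx).ne']
  simp

lemma dg_le {x : ℝ} (hx : 0 < x) : dg x ≤ Real.log x := by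
  rw [← slope_logGamma hx]
  exact Real.convexOn_log_Gamma.le_slope_of_hasDerivAt (Set.mem_Ioi.mpr hx)
    (Set.mem_Ioi.mpr (by linarith)) (by linarith) (hasDerivAt_logGamma hx)

lemma le_dg {x : ℝ} (hx : 0 < x) : Real.log x ≤ dg (x + 1) := by
  rw [← slope_logGamma hx]
  exact Real.convexOn_log_Gamma.slope_le_of_hasDerivAt (Set.mem_Ioi.mpr hx)
    (Set.mem_Ioi.mpr (by linarith)) (by linarith) (hasDerivAt_logGamma (by linarith))

lemma digamma_ofReal {x : ℝ} (hx : 0 < x) : digamma (x : ℂ) = (dg x : ℂ) := by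
  have hne : ∀ m : ℕ, (x : ℂ) ≠ -m := fun m h => by
    have := congrArg re h
    simp at this
    have : (0:ℝ) ≤ m := m.cast_nonneg
    linarith
  have h1 := (Complex.differentiableAt_Gamma (x:ℂ) hne).hasDerivAt.comp_ofReal
  have hx' : DifferentiableAt ℝ Real.Gamma x := Real.differentiableAt_Gamma (fun m => by
    have : (0:ℝ) ≤ m := m.cast_nonneg
    linarith)
  have h2 := hx'.hasDerivAt.ofReal_comp
  simp only [Complex.Gamma_ofReal] at h1
  have h3 := h1.unique h2
  rw [digamma_def, logDeriv_apply, h3, Complex.Gamma_ofReal]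
  have h4 := (hx'.hasDerivAt.log (Real.Gamma_pos_of_pos hx).ne').deriv
  have h5 : dg x = deriv Real.Gamma x / Real.Gamma x := h4
  rw [h5]; push_cast; rfl

lemma dg_add_one {x : ℝ} (hx : 0 < x) : dg (x + 1) = dg x + 1 / x := by
  have h := digamma_apply_add_one (x : ℂ) (fun m h => by
    have := congrArg re h
    simp at this
    have : (0:ℝ) ≤ m := m.cast_nonneg
    linarith)
  rw [digamma_ofReal hx, show ((x:ℂ) + 1) = ((x + 1 : ℝ) : ℂ) by push_cast; rfl,
    digamma_ofReal (by linarith)] at h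
  rw [one_div]
  exact_mod_cast h

/-- terms of the digamma series -/
noncomputable def dgt (s : ℂ) (n : ℕ) : ℂ := 1 / ((n : ℂ) + 1) - 1 / ((n : ℂ) + 1 + s)

lemma norm_add_ge {s : ℂ} (hs : 0 ≤ s.re) {a : ℝ} (ha : 0 < a) :
    Real.sqrt (‖s‖ * a) ≤ ‖(a : ℂ) + s‖ := by
  apply Real.sqrt_le_iff.mpr
  refine ⟨norm_nonneg _, ?_⟩
  have h1 : ‖s‖ ^ 2 = s.re ^ 2 + s.im ^ 2 := by
    rw [Complex.sq_norm, normSq_apply]; ring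
  have h2 : ‖(a:ℂ) + s‖ ^ 2 = (a + s.re) ^ 2 + s.im ^ 2 := by
    rw [Complex.sq_norm, normSq_apply]; simp; ring
  rw [h2]
  nlinarith [sq_nonneg (‖s‖ - a), mul_nonneg ha.le hs, norm_nonneg s, mul_pos ha ha]

lemma norm_dgt_le {s : ℂ} (hs : 0 ≤ s.re) (n : ℕ) :
    ‖dgt s n‖ ≤ Real.sqrt ‖s‖ * (((n : ℝ) + 1) ^ (3 / 2 : ℝ))⁻¹ := by
  by_cases h0 : s = 0
  · simp [dgt, h0]
  have hn : (0:ℝ) < (n:ℝ) + 1 := by positivity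
  have hns : 0 < ‖s‖ := norm_pos_iff.mpr h0
  have key := norm_add_ge hs hn
  have hpos : 0 < Real.sqrt (‖s‖ * ((n:ℝ)+1)) := Real.sqrt_pos.mpr (by positivity)
  have hne : ((n:ℂ) + 1 + s) ≠ 0 := by
    have : 0 < ‖(((n:ℝ)+1 : ℝ) : ℂ) + s‖ := lt_of_lt_of_le hpos key
    push_cast at this
    exact norm_pos_iff.mp this
  have hne1 : ((n:ℂ) + 1) ≠ 0 := by exact_mod_cast hn.ne'
  have e : dgt s n = s / (((n:ℂ) + 1) * ((n:ℂ) + 1 + s)) := by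
    rw [dgt]; field_simp; ring
  rw [e, norm_div, norm_mul]
  have e1 : ‖((n:ℂ) + 1)‖ = (n:ℝ) + 1 := by
    rw [show ((n:ℂ)+1) = (((n:ℝ)+1 : ℝ) : ℂ) by push_cast; rfl, norm_real,
      Real.norm_of_nonneg hn.le]
  have key' : Real.sqrt (‖s‖ * ((n:ℝ)+1)) ≤ ‖(n:ℂ) + 1 + s‖ := by
    push_cast at key; exact key
  rw [e1]
  have e3 : ((n : ℝ) + 1) ^ (3 / 2 : ℝ) = ((n:ℝ) + 1) * Real.sqrt ((n:ℝ)+1) := by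
    rw [show (3/2:ℝ) = 1 + 1/2 by norm_num, Real.rpow_add hn, Real.rpow_one, Real.sqrt_eq_rpow]
  rw [e3]
  rw [Real.sqrt_mul hns.le] at key'
  have hs1 : 0 < Real.sqrt ‖s‖ := Real.sqrt_pos.mpr hns
  have hs2 : 0 < Real.sqrt ((n:ℝ)+1) := Real.sqrt_pos.mpr hn
  calc ‖s‖ / (((n:ℝ)+1) * ‖(n:ℂ) + 1 + s‖)
      ≤ ‖s‖ / (((n:ℝ)+1) * (Real.sqrt ‖s‖ * Real.sqrt ((n:ℝ)+1))) := by gcongr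
    _ = _ := by
      have : ‖s‖ = Real.sqrt ‖s‖ * Real.sqrt ‖s‖ := (Real.mul_self_sqrt hns.le).symm
      rw [div_eq_iff (by positivity)]
      field_simp
      rw [pow_two]; exact this

lemma summable_dgb : Summable (fun n : ℕ => (((n : ℝ) + 1) ^ (3 / 2 : ℝ))⁻¹) := by
  have := (summable_nat_add_iff 1).mpr (Real.summable_nat_rpow_inv.mpr (by norm_num : (1:ℝ) < 3/2))
  simpa using this

lemma summable_dgt {s : ℂ} (hs : 0 ≤ s.re) : Summable (dgt s) :=
  Summable.of_norm_bounded (summable_dgb.mul_left _) (norm_dgt_le hs)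

noncomputable def dgS (s : ℂ) : ℂ := -Real.eulerMascheroniConstant + ∑' n, dgt s n

lemma dgS_ofReal {x : ℝ} (hx : 0 < x) : (dg (x + 1) : ℂ) = dgS x := by
  have hN : ∀ N : ℕ, dg (x + 1 + N) = dg (x + 1) + ∑ n ∈ Finset.range N, 1 / ((n:ℝ) + 1 + x) := by
    intro N
    induction N with
    | zero => simp
    | succ k ih =>
      have hk : (0:ℝ) ≤ k := k.cast_nonneg
      rw [Finset.sum_range_succ, ← add_assoc, ← ih]
      push_cast
      rw [← add_assoc, dg_add_one (by positivity)]
      congr 2; ring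
  have hlim : Tendsto (fun N : ℕ => dg (x + 1 + N) - Real.log N) atTop (𝓝 0) := by
    have hl : ∀ c : ℝ, Tendsto (fun N : ℕ => Real.log (c + N) - Real.log N) atTop (𝓝 0) := by
      intro c
      have h1 : Tendsto (fun N : ℕ => Real.log (c / N + 1)) atTop (𝓝 0) := by
        have : Tendsto (fun N : ℕ => c / (N:ℝ) + 1) atTop (𝓝 (0 + 1)) :=
          (tendsto_const_div_atTop_nhds_zero_nat c).add_const 1
        rw [zero_add] at this
        have h := (Real.continuousAt_log one_ne_zero).tendsto.comp this
        simpa [Function.comp_def] using h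
      refine h1.congr' ?_
      filter_upwards [eventually_gt_atTop ⌈|c|⌉₊] with N hN
      have hN' : |c| < N := Nat.lt_of_ceil_lt hN
      have hN0 : (0:ℝ) < N := lt_of_le_of_lt (abs_nonneg c) hN'
      have : 0 < c + N := by linarith [neg_abs_le c]
      rw [← Real.log_div this.ne' hN0.ne']
      congr 1; field_simp
    refine tendsto_of_tendsto_of_tendsto_of_le_of_le (hl x) (hl (x+1)) (fun N => ?_) (fun N => ?_)
    · have := le_dg (x := x + N) (by positivity)
      simp only
      have e : x + N + 1 = x + 1 + N := by ring
      rw [e] at this; linarith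
    · have := dg_le (x := x + 1 + N) (by positivity)
      simp only
      linarith
  have hS : Tendsto (fun N : ℕ => ∑ n ∈ Finset.range N, (1 / ((n:ℝ) + 1) - 1 / ((n:ℝ) + 1 + x)))
      atTop (𝓝 (Real.eulerMascheroniConstant + dg (x + 1))) := by
    have h := (Real.tendsto_harmonic_sub_log.sub hlim).add_const (dg (x+1))
    rw [sub_zero] at h
    refine h.congr (fun N => ?_)
    rw [hN N, Finset.sum_sub_distrib]
    have : ((harmonic N : ℚ) : ℝ) = ∑ n ∈ Finset.range N, 1 / ((n:ℝ) + 1) := by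
      simp [harmonic]
    rw [this]; ring
  have hS2 := (summable_dgt (s := (x:ℂ)) (by simpa using hx.le)).hasSum.tendsto_sum_nat
  have hS3 : Tendsto (fun N : ℕ => ∑ n ∈ Finset.range N, dgt x n) atTop
      (𝓝 ((Real.eulerMascheroniConstant + dg (x + 1) : ℝ) : ℂ)) := by
    have := (continuous_ofReal.tendsto _).comp hS
    refine this.congr (fun N => ?_)
    simp [dgt]
  have := tendsto_nhds_unique hS2 hS3
  rw [dgS, this]
  push_cast; ring

lemma dgS_differentiableAt {s : ℂ} (hs : 0 < s.re) : DifferentiableAt ℂ dgS s := by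
  have hU : IsOpen ({z : ℂ | 0 < z.re} ∩ Metric.ball 0 (‖s‖ + 1)) :=
    (isOpen_lt continuous_const continuous_re).inter Metric.isOpen_ball
  have := differentiableOn_tsum_of_summable_norm (F := fun n z => dgt z n)
    (U := {z : ℂ | 0 < z.re} ∩ Metric.ball 0 (‖s‖ + 1))
    (summable_dgb.mul_left (Real.sqrt (‖s‖ + 1))) (fun n => ?_) hU (fun n w hw => ?_)
  · have h := this.differentiableAt (hU.mem_nhds (x := s) ⟨hs, by simp⟩)
    unfold dgS
    fun_prop
  · intro z hz
    have : ((n:ℂ) + 1 + z) ≠ 0 := by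
      intro h
      have := congrArg re h
      simp at this
      have hz1 : 0 < z.re := hz.1
      have : (0:ℝ) ≤ n := n.cast_nonneg
      linarith
    unfold dgt
    apply DifferentiableAt.differentiableWithinAt
    fun_prop (disch := assumption)
  · refine (norm_dgt_le (le_of_lt hw.1) n).trans ?_
    have : ‖w‖ < ‖s‖ + 1 := by simpa using hw.2
    gcongr

lemma Gamma_ne_pole {s : ℂ} (hs : 0 < s.re) (m : ℕ) : s ≠ -m := by
  intro h
  have := congrArg re h
  simp at this
  have : (0:ℝ) ≤ m := m.cast_nonneg
  linarith

lemma digamma_eq {s : ℂ} (hs : 0 < s.re) : digamma (s + 1) = dgS s := by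
  have hUo : IsOpen {z : ℂ | 0 < z.re} := isOpen_lt continuous_const continuous_re
  have h1 : AnalyticOnNhd ℂ (fun z => digamma (z + 1)) {z : ℂ | 0 < z.re} := by
    apply DifferentiableOn.analyticOnNhd _ hUo
    have hG : DifferentiableOn ℂ Complex.Gamma {z : ℂ | 0 < z.re} := fun z hz =>
      (Complex.differentiableAt_Gamma z (Gamma_ne_pole hz)).differentiableWithinAt
    have hd : DifferentiableOn ℂ digamma {z : ℂ | 0 < z.re} := by
      refine (hG.deriv hUo).div hG (fun z hz => Complex.Gamma_ne_zero (Gamma_ne_pole hz))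
    refine hd.comp (by fun_prop) (fun z hz => ?_)
    simp at hz ⊢; linarith
  have h2 : AnalyticOnNhd ℂ dgS {z : ℂ | 0 < z.re} := by
    apply DifferentiableOn.analyticOnNhd _ hUo
    exact fun z hz => (dgS_differentiableAt hz).differentiableWithinAt
  have hconn : IsPreconnected {z : ℂ | 0 < z.re} := (convex_halfSpace_re_gt 0).isPreconnected
  refine h1.eqOn_of_preconnected_of_frequently_eq h2 hconn (z₀ := 1) (by simp) ?_ hs
  have ht : Tendsto (fun n : ℕ => (((1 + 1 / ((n:ℝ) + 1) : ℝ)) : ℂ)) atTop (𝓝[≠] 1) := by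
    apply tendsto_nhdsWithin_of_tendsto_nhds_of_eventually_within
    · have := (continuous_ofReal.tendsto (1 + 0)).comp
        ((tendsto_one_div_add_atTop_nhds_zero_nat (𝕜 := ℝ)).const_add 1)
      simpa [Function.comp_def] using this
    · filter_upwards with n
      have : (0:ℝ) < 1 / ((n:ℝ) + 1) := by positivity
      intro h
      have h2 := Set.mem_singleton_iff.mp h
      have h' : (1 + 1 / ((n:ℝ) + 1) : ℝ) = 1 := Complex.ofReal_eq_one.mp h2
      linarith
  refine ht.frequently (Frequently.of_forall fun n => ?_)
  have hp : (0:ℝ) < 1 + 1 / ((n:ℝ) + 1) := by positivity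
  rw [← dgS_ofReal hp, ← digamma_ofReal (by linarith)]
  push_cast; rfl

lemma dgS_bound : ∃ C : ℝ, 0 < C ∧ ∀ s : ℂ, 0 ≤ s.re → ‖dgS s‖ ≤ C * (1 + Real.sqrt ‖s‖) := by
  refine ⟨|Real.eulerMascheroniConstant| + 1 + ∑' n : ℕ, (((n : ℝ) + 1) ^ (3 / 2 : ℝ))⁻¹, ?_,
    fun s hs => ?_⟩
  · have : 0 ≤ ∑' n : ℕ, (((n : ℝ) + 1) ^ (3 / 2 : ℝ))⁻¹ := tsum_nonneg (fun n => by positivity)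
    positivity
  · have h := tsum_of_norm_bounded (summable_dgb.mul_left (Real.sqrt ‖s‖)).hasSum (norm_dgt_le hs)
    rw [tsum_mul_left] at h
    have : 0 ≤ ∑' n : ℕ, (((n : ℝ) + 1) ^ (3 / 2 : ℝ))⁻¹ := tsum_nonneg (fun n => by positivity)
    rw [dgS]
    refine (norm_add_le _ _).trans ?_
    rw [norm_neg, norm_real, Real.norm_eq_abs]
    have := abs_nonneg Real.eulerMascheroniConstant
    have := Real.sqrt_nonneg ‖s‖
    nlinarith [mul_nonneg ‹0 ≤ |Real.eulerMascheroniConstant|› this]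

end PsiRH


namespace PsiRH
open Complex Filter Topology MeasureTheory

local notation "conj" => starRingEnd ℂ

noncomputable def xf (s : ℂ) : ℂ := deriv xi s / xi s

noncomputable abbrev Lam : ℕ → ℂ := fun n => (ArithmeticFunction.vonMangoldt n : ℂ)

lemma xi_half_open : IsOpen {s : ℂ | 1 / 2 < s.re} := isOpen_lt continuous_const continuous_re

lemma xf_differentiableAt (hRH : RiemannHypothesis) {s : ℂ} (hs : 1 / 2 < s.re) :
    DifferentiableAt ℂ xf s := by
  have h1 : DifferentiableAt ℂ (deriv xi) s :=
    ((xi_differentiable.analyticAt s).deriv).differentiableAt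
  exact h1.div (xi_differentiable s) (xi_ne_zero hRH hs)

lemma xf_conj (s : ℂ) : xf (conj s) = conj (xf s) := by
  have h : HasDerivAt xi (conj (deriv xi s)) (conj s) := by
    have := ((xi_differentiable s).hasDerivAt).conj_conj
    refine this.congr_of_eventuallyEq (Eventually.of_forall fun z => ?_)
    simp [xi_conj]
  rw [xf, h.deriv, xi_conj, xf, map_div₀]

lemma xf_ofReal (x : ℝ) : xf x = ((xf x).re : ℂ) := by
  have h := xf_conj (x : ℂ)
  rw [conj_ofReal] at h
  exact (conj_eq_iff_re.mp h.symm).symm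

lemma xf_one : xf 1 = (Real.eulerMascheroniConstant - Real.log (4 * π)) / 2 + 1 := by
  have h : HasDerivAt xi (completedRiemannZeta₀ 1) 1 := by
    have h1 := (differentiable_completedZeta₀ 1).hasDerivAt
    have h2 := ((((hasDerivAt_id (1:ℂ)).mul ((hasDerivAt_id (1:ℂ)).sub_const 1)).mul h1).add_const 1)
    refine (h2.congr_deriv (by simp)).congr_of_eventuallyEq (Eventually.of_forall fun z => ?_)
    simp [xi]
  rw [xf, h.deriv, xi_one, div_one, completedRiemannZeta₀_one]
  push_cast
  rw [Complex.ofReal_log (by positivity)]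
  push_cast; rfl

lemma xf_formula {s : ℂ} (hs : 1 < s.re) :
    xf s = 1 / (s - 1) - Real.log π / 2 + dgS (s / 2) / 2 - LSeries Lam s := by
  have hs0 : 0 < s.re := by linarith
  have hev : xi =ᶠ[𝓝 s] fun z => (((2 * (z - 1)) * (π : ℂ) ^ (-z / 2)) * Complex.Gamma (z / 2 + 1))
      * riemannZeta z := by
    have : ∀ᶠ z in 𝓝 s, 1 < z.re := (isOpen_lt continuous_const continuous_re).mem_nhds hs
    filter_upwards [this] with z hz
    have hz1 : z ≠ 1 := by rintro rfl; simp at hz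
    have hz0 : z ≠ 0 := by rintro rfl; norm_num at hz
    rw [xi_eq (by linarith) hz1, Gammaℝ_def, Complex.Gamma_add_one _ (by simpa using hz0)]
    ring
  have hd : xf s = logDeriv xi s := rfl
  rw [hd, (logDeriv_congr_nhds hev).eq_of_nhds]
  have hs1 : s ≠ 1 := by rintro rfl; simp at hs
  have hs1' : s - 1 ≠ 0 := sub_ne_zero.mpr hs1
  have hpi : (π : ℂ) ≠ 0 := by exact_mod_cast Real.pi_ne_zero
  have hz : riemannZeta s ≠ 0 := riemannZeta_ne_zero_of_one_le_re hs.le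
  have hg : Complex.Gamma (s / 2 + 1) ≠ 0 := Complex.Gamma_ne_zero_of_re_pos (by
    simp; linarith)
  have hgd : DifferentiableAt ℂ Complex.Gamma (s / 2 + 1) :=
    Complex.differentiableAt_Gamma _ (Gamma_ne_pole (by simp; linarith))
  have hgd' : DifferentiableAt ℂ (fun z => Complex.Gamma (z / 2 + 1)) s :=
    DifferentiableAt.comp s (f := fun z : ℂ => z / 2 + 1) hgd (by fun_prop)
  have hp0 : (π : ℂ) ^ (-s / 2) ≠ 0 := by simp [Complex.cpow_eq_zero_iff, hpi]
  have hpd : HasDerivAt (fun z : ℂ => (π : ℂ) ^ (-z / 2))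
      ((π : ℂ) ^ (-s / 2) * Complex.log π * (-1 / 2)) s :=
    HasDerivAt.const_cpow ((hasDerivAt_id s).neg.div_const 2) (Or.inl hpi)
  have hld : DifferentiableAt ℂ (fun z : ℂ => 2 * (z - 1)) s := by fun_prop
  have h2 : (2 * (s - 1)) ≠ 0 := mul_ne_zero two_ne_zero hs1'
  rw [logDeriv_mul (f := fun z : ℂ => ((2 * (z - 1)) * (π : ℂ) ^ (-z / 2)) * Complex.Gamma (z / 2 + 1))
      (g := riemannZeta) s (mul_ne_zero (mul_ne_zero h2 hp0) hg) hz
      ((hld.mul hpd.differentiableAt).mul hgd') (differentiableAt_riemannZeta hs1),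
    logDeriv_mul (f := fun z : ℂ => ((2 * (z - 1)) * (π : ℂ) ^ (-z / 2)))
      (g := fun z : ℂ => Complex.Gamma (z / 2 + 1)) s (mul_ne_zero h2 hp0) hg
      (hld.mul hpd.differentiableAt) hgd',
    logDeriv_mul (f := fun z : ℂ => (2 * (z - 1))) (g := fun z : ℂ => (π : ℂ) ^ (-z / 2))
      s h2 hp0 hld hpd.differentiableAt]
  have e1 : logDeriv (fun z : ℂ => 2 * (z - 1)) s = 1 / (s - 1) := by
    have : HasDerivAt (fun z : ℂ => 2 * (z - 1)) 2 s := by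
      simpa using ((hasDerivAt_id s).sub_const 1).const_mul 2
    rw [logDeriv_apply, this.deriv]; field_simp
  have e2 : logDeriv (fun z : ℂ => (π : ℂ) ^ (-z / 2)) s = - Real.log π / 2 := by
    rw [logDeriv_apply, hpd.deriv, Complex.ofReal_log Real.pi_pos.le]; field_simp
  have e3 : logDeriv (fun z : ℂ => Complex.Gamma (z / 2 + 1)) s = dgS (s / 2) / 2 := by
    have hh : HasDerivAt (fun z : ℂ => z / 2 + 1) (1 / 2) s :=
      ((hasDerivAt_id s).div_const 2).add_const 1
    rw [← digamma_eq (s := s / 2) (by simp; linarith), digamma_def, logDeriv_apply, logDeriv_apply]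
    have := (hgd.hasDerivAt (x := s / 2 + 1)).comp s hh
    have h3 : deriv (fun z : ℂ => Complex.Gamma (z / 2 + 1)) s = _ := this.deriv
    rw [h3]; ring
  have e4 : logDeriv riemannZeta s = - LSeries Lam s := by
    rw [logDeriv_apply, ArithmeticFunction.LSeries_vonMangoldt_eq_deriv_riemannZeta_div hs]; ring
  rw [e1, e2, e3, e4]; ring

lemma lseries_bound {s : ℂ} (hs : 2 ≤ s.re) :
    ‖LSeries Lam s‖ ≤ ∑' n, ‖LSeries.term Lam 2 n‖ := by
  have h2 : Summable fun n => ‖LSeries.term Lam 2 n‖ :=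
    (ArithmeticFunction.LSeriesSummable_vonMangoldt (s := 2) (by norm_num)).norm
  have h1 : Summable fun n => ‖LSeries.term Lam s n‖ :=
    (ArithmeticFunction.LSeriesSummable_vonMangoldt (s := s) (by linarith)).norm
  refine (norm_tsum_le_tsum_norm h1).trans (h1.tsum_le_tsum (fun n => ?_) h2)
  exact LSeries.norm_term_le_of_re_le_re _ (by simpa using hs) n

lemma xf_bound_right : ∃ C : ℝ, 0 < C ∧ ∀ s : ℂ, 2 ≤ s.re → ‖xf s‖ ≤ C * (1 + Real.sqrt ‖s‖) := by
  obtain ⟨C, hC, h⟩ := dgS_bound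
  set B := ∑' n, ‖LSeries.term Lam 2 n‖
  have hB : 0 ≤ B := tsum_nonneg fun n => norm_nonneg _
  refine ⟨1 + |Real.log π| + C + B, by positivity, fun s hs => ?_⟩
  rw [xf_formula (by linarith)]
  have h1 : ‖1 / (s - 1)‖ ≤ 1 := by
    rw [norm_div, norm_one]
    have : 1 ≤ ‖s - 1‖ := by
      have := re_le_norm (s - 1)
      simp at this; linarith
    rw [div_le_one (by linarith)]; exact this
  have h2 : ‖(Real.log π : ℂ) / 2‖ ≤ |Real.log π| := by
    rw [norm_div, Complex.norm_real, Real.norm_eq_abs]; norm_num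
  have h3 : ‖dgS (s / 2) / 2‖ ≤ C * (1 + Real.sqrt ‖s‖) := by
    have := h (s / 2) (by simp; linarith)
    have h4 : Real.sqrt ‖s / 2‖ ≤ Real.sqrt ‖s‖ := by
      apply Real.sqrt_le_sqrt; rw [norm_div]; norm_num
    rw [norm_div]; norm_num
    have h5 : ‖dgS (s / 2)‖ ≤ C * (1 + Real.sqrt ‖s‖) := this.trans (by gcongr)
    linarith [norm_nonneg (dgS (s / 2))]
  have h4 := lseries_bound hs
  have h5 : 0 ≤ Real.sqrt ‖s‖ := Real.sqrt_nonneg _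
  calc _ ≤ ‖1 / (s - 1)‖ + ‖(Real.log π : ℂ) / 2‖ + ‖dgS (s / 2) / 2‖ + ‖LSeries Lam s‖ :=
        (norm_sub_le _ _).trans (add_le_add_left ((norm_add_le _ _).trans
          (add_le_add_left (norm_sub_le _ _) _)) _)
    _ ≤ 1 + |Real.log π| + C * (1 + Real.sqrt ‖s‖) + B := by gcongr
    _ ≤ _ := by nlinarith [abs_nonneg (Real.log π), mul_nonneg (add_nonneg (add_nonneg zero_le_one (abs_nonneg (Real.log π))) hB) h5]

lemma lseries_re_nonneg {x : ℝ} : 0 ≤ (LSeries Lam x).re := by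
  by_cases h : LSeriesSummable Lam x
  · rw [LSeries, Complex.re_tsum h]
    refine tsum_nonneg fun n => ?_
    rw [LSeries.term_def]
    split_ifs with hn
    · simp
    · have : (Lam n / (n:ℂ) ^ (x:ℂ)) = ((ArithmeticFunction.vonMangoldt n / (n:ℝ) ^ x : ℝ) : ℂ) := by
        rw [Complex.ofReal_div, Complex.ofReal_cpow (by positivity)]; simp
      rw [this, ofReal_re]
      exact div_nonneg ArithmeticFunction.vonMangoldt_nonneg (by positivity)
  · rw [LSeries, tsum_eq_zero_of_not_summable h]; simp

lemma xf_real_le {x : ℝ} (hx : 1 < x) :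
    (xf x).re ≤ Real.log (x / (2 * π)) / 2 + 1 / x + 1 / (x - 1) := by
  rw [xf_formula (by simpa using hx)]
  have h1 : ((1:ℂ) / ((x:ℂ) - 1)).re = 1 / (x - 1) := by
    have : ((1:ℂ) / ((x:ℂ) - 1)) = ((1 / (x - 1) : ℝ) : ℂ) := by push_cast; rfl
    rw [this, ofReal_re]
  have h2 : dgS ((x:ℂ) / 2) = ((dg (x / 2) + 2 / x : ℝ) : ℂ) := by
    have := dgS_ofReal (x := x / 2) (by linarith)
    push_cast at this
    rw [← this, dg_add_one (by linarith)]
    push_cast; congr 1; field_simp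
  have h3 : (((Real.log π : ℝ) : ℂ) / 2).re = Real.log π / 2 := by
    have : (((Real.log π : ℝ) : ℂ) / 2) = ((Real.log π / 2 : ℝ) : ℂ) := by push_cast; rfl
    rw [this, ofReal_re]
  have h4 : (dgS ((x:ℂ) / 2) / 2).re = (dg (x / 2) + 2 / x) / 2 := by
    rw [h2, ← Complex.ofReal_ofNat, ← Complex.ofReal_div, ofReal_re]
  rw [sub_re, add_re, sub_re, h1, h3, h4]
  have h5 := dg_le (x := x / 2) (by linarith)
  have h6 := lseries_re_nonneg (x := x)
  have h7 : Real.log (x / (2 * π)) = Real.log (x / 2) - Real.log π := by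
    rw [← Real.log_div (by linarith) Real.pi_ne_zero]; congr 1; field_simp
  rw [h7]
  have : (dg (x / 2) + 2 / x) / 2 = dg (x/2) / 2 + 1 / x := by field_simp
  rw [this]; linarith

lemma xf_one_le : (xf 1).re ≤ 0.069 := by
  rw [xf_one]
  have h : ((((Real.eulerMascheroniConstant : ℝ) : ℂ) - (Real.log (4 * π) : ℝ)) / 2 + 1 : ℂ) =
    (((Real.eulerMascheroniConstant - Real.log (4 * π)) / 2 + 1 : ℝ) : ℂ) := by push_cast; rfl
  rw [h, ofReal_re]
  have h1 := Real.eulerMascheroniConstant_lt_two_thirds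
  have h2 : (2.529 : ℝ) ≤ Real.log (4 * π) := by
    rw [Real.le_log_iff_exp_le (by positivity)]
    have := Real.pi_gt_d4
    have e : (2.529:ℝ) = 1 + 1 + 0.529 := by norm_num
    rw [e, Real.exp_add, Real.exp_add]
    have h3 := Real.exp_bound' (x := 0.529) (by norm_num) (by norm_num) (n := 5) (by norm_num)
    have h4 : Real.exp 0.529 ≤ 1.6975 := by
      refine h3.trans ?_
      simp only [Finset.sum_range_succ, Finset.sum_range_zero, Nat.factorial]
      norm_num
    have h5 := Real.exp_one_lt_d9
    have h6 : Real.exp 1 * Real.exp 1 ≤ 7.3891 := by nlinarith [Real.exp_pos 1]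
    have h7 : Real.exp 1 * Real.exp 1 * Real.exp 0.529 ≤ 7.3891 * 1.6975 := by
      apply mul_le_mul h6 h4 (Real.exp_pos _).le (by norm_num)
    linarith
  linarith

end PsiRH


namespace PsiRH
open Complex Filter Topology MeasureTheory

local notation "conj" => starRingEnd ℂ

lemma deriv_xi (hRH : RiemannHypothesis) {s : ℂ} (hs : 1 / 2 < s.re) :
    HasDerivAt xi (xf s * xi s) s := by
  have := (xi_differentiable s).hasDerivAt
  rwa [xf, div_mul_cancel₀ _ (xi_ne_zero hRH hs)]

lemma xi_grow (hRH : RiemannHypothesis) : ∃ C : ℝ, 0 < C ∧ ∀ (a b : ℂ) (R : ℝ), 2 ≤ a.re → 2 ≤ b.re →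
    ‖a‖ ≤ R → ‖b‖ ≤ R → ‖xi b‖ ≤ ‖xi a‖ * Real.exp (‖b - a‖ * (C * (1 + Real.sqrt R))) := by
  obtain ⟨C, hC, h⟩ := xf_bound_right
  refine ⟨C, hC, fun a b R ha hb hRa hRb => ?_⟩
  have hseg : ∀ t ∈ Set.Icc (0:ℝ) 1, 2 ≤ (a + t * (b - a)).re ∧ ‖a + t * (b - a)‖ ≤ R := by
    intro t ht
    constructor
    · simp; nlinarith [ht.1, ht.2]
    · have e : a + t * (b - a) = ((1 - t : ℝ) : ℂ) * a + (t : ℂ) * b := by push_cast; ring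
      rw [e]
      refine (norm_add_le _ _).trans ?_
      rw [norm_mul, norm_mul, Complex.norm_real, Complex.norm_real, Real.norm_eq_abs,
        Real.norm_eq_abs, abs_of_nonneg ht.1, abs_of_nonneg (by linarith [ht.2] : (0:ℝ) ≤ 1 - t)]
      nlinarith [ht.1, ht.2]
  have hderiv : ∀ t ∈ Set.Icc (0:ℝ) 1, HasDerivAt (fun t : ℝ => xi (a + t * (b - a)))
      ((xf (a + t * (b - a)) * xi (a + t * (b - a))) * (b - a)) t := by
    intro t ht
    have h1 := deriv_xi hRH (s := a + t * (b - a)) (by linarith [(hseg t ht).1])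
    have h2 : HasDerivAt (fun t : ℝ => a + (t:ℂ) * (b - a)) (b - a) t := by
      simpa using ((hasDerivAt_id t).ofReal_comp.mul_const (b - a)).const_add a
    exact h1.comp t h2
  have key := norm_le_gronwallBound_of_norm_deriv_right_le (f := fun t : ℝ => xi (a + t * (b - a)))
    (f' := fun t : ℝ => (xf (a + t * (b - a)) * xi (a + t * (b - a))) * (b - a))
    (δ := ‖xi a‖) (K := ‖b - a‖ * (C * (1 + Real.sqrt R))) (ε := 0) (a := 0) (b := 1)
    (fun t ht => (hderiv t ht).continuousAt.continuousWithinAt)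
    (fun t ht => (hderiv t ⟨ht.1, ht.2.le⟩).hasDerivWithinAt)
    (by simp) (fun t ht => by
      have ht' : t ∈ Set.Icc (0:ℝ) 1 := ⟨ht.1, ht.2.le⟩
      have h3 := h _ (hseg t ht').1
      have h4 : ‖xf (a + t * (b - a))‖ ≤ C * (1 + Real.sqrt R) :=
        h3.trans (by gcongr; exact (hseg t ht').2)
      rw [norm_mul, norm_mul, add_zero]
      calc _ ≤ (C * (1 + Real.sqrt R)) * ‖xi (a + t * (b - a))‖ * ‖b - a‖ := by gcongr
        _ = _ := by ring) 1 (by simp)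
  rw [gronwallBound_ε0] at key
  simpa using key

noncomputable def W (n : ℝ) : ℝ := (1 + n) * Real.sqrt (1 + n)

lemma W_mono {a b : ℝ} (ha : 0 ≤ a) (h : a ≤ b) : W a ≤ W b := by
  unfold W
  have : 0 ≤ 1 + b := by linarith
  gcongr

lemma one_le_sqrt' {n : ℝ} (hn : 0 ≤ n) : 1 ≤ Real.sqrt (1 + n) := by
  rw [Real.one_le_sqrt]; linarith

lemma le_W {n : ℝ} (hn : 0 ≤ n) : 1 + n ≤ W n := by
  have := one_le_sqrt' hn
  unfold W; nlinarith

lemma W_add {n : ℝ} (hn : 0 ≤ n) : W (n + 6) ≤ 21 * W n := by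
  unfold W
  have : Real.sqrt (1 + (n + 6)) ≤ 3 * Real.sqrt (1 + n) := by
    rw [Real.sqrt_le_left (by positivity), mul_pow, Real.sq_sqrt (by linarith)]; linarith
  have h0 := Real.sqrt_nonneg (1 + n)
  calc (1 + (n + 6)) * Real.sqrt (1 + (n + 6)) ≤ (7 * (1 + n)) * (3 * Real.sqrt (1 + n)) := by
        apply mul_le_mul _ this (Real.sqrt_nonneg _) (by linarith); linarith
    _ = _ := by ring

lemma xi_right (hRH : RiemannHypothesis) : ∃ C : ℝ, 0 < C ∧ ∀ s : ℂ, 2 ≤ s.re →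
    ‖xi s‖ ≤ Real.exp (C * W ‖s‖) ∧ Real.exp (-(C * W ‖s‖)) ≤ ‖xi s‖ := by
  obtain ⟨C, hC, h⟩ := xi_grow hRH
  have h2 : 0 < ‖xi 2‖ := norm_pos_iff.mpr (xi_ne_zero hRH (by norm_num))
  set l := Real.log ‖xi 2‖ with hl
  refine ⟨6 * C + |l|, by positivity, fun s hs => ?_⟩
  have hn := norm_nonneg s
  have hW := le_W hn
  have h3 : ‖s - 2‖ ≤ ‖s‖ + 2 := by
    refine (norm_sub_le _ _).trans ?_; norm_num
  have hK : ‖s - 2‖ * (C * (1 + Real.sqrt (‖s‖ + 2))) ≤ 6 * C * W ‖s‖ := by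
    have h5 : Real.sqrt (‖s‖ + 2) ≤ 2 * Real.sqrt (1 + ‖s‖) := by
      rw [Real.sqrt_le_left (by positivity), mul_pow, Real.sq_sqrt (by linarith)]; linarith
    have h6 := one_le_sqrt' hn
    calc _ ≤ (2 * (1 + ‖s‖)) * (C * (Real.sqrt (1 + ‖s‖) + 2 * Real.sqrt (1 + ‖s‖))) := by
          gcongr; linarith
      _ = _ := by unfold W; ring
  have e1 : ‖xi 2‖ = Real.exp l := (Real.exp_log h2).symm
  have hl1 : |l| ≤ |l| * W ‖s‖ := by nlinarith [abs_nonneg l]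
  constructor
  · refine (h 2 s (‖s‖ + 2) (by norm_num) hs (by norm_num) (by linarith)).trans ?_
    rw [e1, ← Real.exp_add, Real.exp_le_exp]
    nlinarith [le_abs_self l]
  · have := h s 2 (‖s‖ + 2) hs (by norm_num) (by linarith) (by norm_num)
    rw [norm_sub_rev, e1] at this
    have h7 : Real.exp (l - ‖s - 2‖ * (C * (1 + Real.sqrt (‖s‖ + 2)))) ≤ ‖xi s‖ := by
      rw [Real.exp_sub, div_le_iff₀ (Real.exp_pos _)]; exact this
    refine le_trans ?_ h7
    rw [Real.exp_le_exp]
    nlinarith [neg_abs_le l]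

lemma xi_up (hRH : RiemannHypothesis) : ∃ C : ℝ, 0 < C ∧ ∀ s : ℂ, -1 ≤ s.re →
    ‖xi s‖ ≤ Real.exp (C * W ‖s‖) := by
  obtain ⟨C, hC, h⟩ := xi_right hRH
  obtain ⟨D, hD, h'⟩ := xi_strip_bound
  refine ⟨C + D + 2, by positivity, fun s hs => ?_⟩
  have hn := norm_nonneg s
  have hW := le_W hn
  by_cases h2 : 2 ≤ s.re
  · refine (h s h2).1.trans ?_
    rw [Real.exp_le_exp]; nlinarith
  · refine (h' s hs (by linarith)).trans ?_
    have h3 : D ≤ Real.exp (D * W ‖s‖) := by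
      have := Real.add_one_le_exp (D * W ‖s‖); nlinarith
    have h4 : (1 + ‖s‖) ≤ Real.exp (W ‖s‖) := by
      have := Real.add_one_le_exp (W ‖s‖); linarith
    calc D * (1 + ‖s‖) ^ 2 ≤ Real.exp (D * W ‖s‖) * (Real.exp (W ‖s‖)) ^ 2 := by gcongr
      _ = Real.exp (D * W ‖s‖ + 2 * W ‖s‖) := by rw [Real.exp_add, ← Real.exp_nat_mul]; norm_num
      _ ≤ _ := by rw [Real.exp_le_exp]; nlinarith

lemma xi_low (hRH : RiemannHypothesis) {δ : ℝ} (hδ : 0 < δ) (hδ1 : δ ≤ 1 / 2) :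
    ∃ C : ℝ, 0 < C ∧ ∀ s : ℂ, 1 / 2 + δ ≤ s.re → Real.exp (-(C * W ‖s‖)) ≤ ‖xi s‖ := by
  obtain ⟨C, hC, h⟩ := xi_right hRH
  obtain ⟨D, hD, h'⟩ := xi_up hRH
  refine ⟨21 * C + 5 * (21 * D + 21 * C) / δ, by positivity, fun s hs => ?_⟩
  have hn := norm_nonneg s
  have hW := le_W hn
  by_cases h2 : 2 ≤ s.re
  · refine le_trans ?_ (h s h2).2
    rw [Real.exp_le_exp, neg_le_neg_iff]
    have : 0 ≤ 5 * (21 * D + 21 * C) / δ := by positivity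
    nlinarith
  push Not at h2
  set z : ℂ := ((s.re - 3 : ℝ) : ℂ) with hz
  set c : ℂ := s - z with hc
  have hzn : ‖z‖ = 3 - s.re := by
    rw [hz, Complex.norm_real, Real.norm_eq_abs, abs_of_neg (by linarith)]; ring
  have hcre : c.re = 3 := by simp [hc, hz]
  have hcn : ‖c‖ ≤ ‖s‖ + 3 := by
    refine (norm_sub_le _ _).trans ?_; rw [hzn]; linarith
  have hWc : W ‖c‖ ≤ 21 * W ‖s‖ :=
    (W_mono (norm_nonneg _) (by linarith)).trans (W_add hn)
  have hball : ∀ w ∈ Metric.ball (0:ℂ) (5/2), 1 / 2 < (c + w).re := by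
    intro w hw
    have : ‖w‖ < 5 / 2 := by simpa using hw
    have h3 := abs_re_le_norm w
    have h4 := neg_abs_le w.re
    rw [add_re, hcre]; linarith
  have hdiff : DifferentiableOn ℂ (fun w => xf (c + w)) (Metric.ball 0 (5/2)) := by
    intro w hw
    have := xf_differentiableAt hRH (hball w hw)
    exact (DifferentiableAt.comp w this (by fun_prop)).differentiableWithinAt
  obtain ⟨g, hg0, hg⟩ := hdiff.isExactOn_ball.with_val_at 0 0
  have hxi : ∀ w ∈ Metric.ball (0:ℂ) (5/2), xi (c + w) = xi c * Complex.exp (g w) := by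
    have hd : ∀ w ∈ Metric.ball (0:ℂ) (5/2),
        HasDerivAt (fun w => xi (c + w) * Complex.exp (-g w)) 0 w := by
      intro w hw
      have h1 : HasDerivAt (fun w => xi (c + w)) (xf (c + w) * xi (c + w)) w := by
        have := (deriv_xi hRH (hball w hw)).comp w ((hasDerivAt_id w).const_add c)
        simpa [Function.comp_def] using this
      have h2 := (hg w hw).neg.cexp
      refine (h1.mul h2).congr_deriv ?_
      simp only [Pi.neg_apply]
      ring
    intro w hw
    have hconst := (convex_ball (0:ℂ) (5/2)).is_const_of_fderivWithin_eq_zero (𝕜 := ℂ)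
      (f := fun w => xi (c + w) * Complex.exp (-g w))
      (fun w hw => (hd w hw).differentiableAt.differentiableWithinAt)
      (fun w hw => by
        rw [fderivWithin_of_isOpen Metric.isOpen_ball hw]
        have := (hd w hw).hasFDerivAt.fderiv
        rw [this]; ext; simp) hw (by simp : (0:ℂ) ∈ Metric.ball (0:ℂ) (5/2))
    simp only [add_zero, hg0, neg_zero, Complex.exp_zero, mul_one] at hconst
    rw [← hconst, mul_assoc, ← Complex.exp_add]; simp
  have hlowc := (h c (by rw [hcre]; norm_num)).2
  set Mb := (21 * D + 21 * C) * W ‖s‖ with hMb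
  have hW0 : 0 < W ‖s‖ := by linarith
  have hMb0 : 0 < Mb := by positivity
  have hre : Set.MapsTo g (Metric.ball 0 (5/2)) {z | z.re ≤ Mb} := by
    intro w hw
    have h1 := hxi w hw
    have h3 : ‖w‖ < 5 / 2 := by simpa using hw
    have h4 : ‖xi (c + w)‖ ≤ Real.exp (21 * D * W ‖s‖) := by
      refine (h' (c + w) (by linarith [hball w hw])).trans ?_
      rw [Real.exp_le_exp]
      have : W ‖c + w‖ ≤ 21 * W ‖s‖ :=
        (W_mono (norm_nonneg _) (by linarith [norm_add_le c w])).trans (W_add hn)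
      nlinarith
    have h5 : Real.exp (-(21 * C * W ‖s‖)) ≤ ‖xi c‖ := by
      refine le_trans ?_ hlowc
      rw [Real.exp_le_exp]; nlinarith
    rw [h1, norm_mul, Complex.norm_exp] at h4
    have h6 : Real.exp (-(21 * C * W ‖s‖)) * Real.exp (g w).re ≤ Real.exp (21 * D * W ‖s‖) :=
      le_trans (by gcongr) h4
    rw [← Real.exp_add, Real.exp_le_exp] at h6
    show (g w).re ≤ Mb
    rw [hMb]; linarith
  have hzb : z ∈ Metric.ball (0:ℂ) (5/2) := by simp [hzn]; linarith
  have hBC := Complex.borelCaratheodory_zero hMb0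
    (fun w hw => (hg w hw).differentiableAt.differentiableWithinAt) hre (by norm_num) hzb hg0
  have hgz : ‖g z‖ ≤ 5 * Mb / δ := by
    refine hBC.trans ?_
    rw [hzn]
    have h1 : δ ≤ 5 / 2 - (3 - s.re) := by linarith
    have : 2 * Mb * (3 - s.re) ≤ 5 * Mb := by nlinarith
    gcongr
  have hs' : s = c + z := by rw [hc]; ring
  have hfin := hxi z hzb
  rw [← hs'] at hfin
  rw [hfin, norm_mul, Complex.norm_exp]
  have h7 : -(5 * Mb / δ) ≤ (g z).re := by
    have := abs_re_le_norm (g z)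
    have := neg_abs_le (g z).re
    linarith
  have h5 : Real.exp (-(21 * C * W ‖s‖)) ≤ ‖xi c‖ := by
    refine le_trans ?_ hlowc
    rw [Real.exp_le_exp]; nlinarith
  calc _ = Real.exp (-(21 * C * W ‖s‖)) * Real.exp (-(5 * Mb / δ)) := by
        rw [← Real.exp_add, hMb]; congr 1; ring
    _ ≤ _ := by gcongr

end PsiRH


namespace PsiRH
open Complex Filter Topology MeasureTheory

local notation "conj" => starRingEnd ℂ

lemma xf_real_ge : ∃ c : ℝ, 0 < c ∧ ∀ x : ℝ, 2 ≤ x → -c ≤ (xf x).re := by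
  set B := ∑' n, ‖LSeries.term Lam 2 n‖
  have hB : 0 ≤ B := tsum_nonneg fun n => norm_nonneg _
  refine ⟨|Real.log π| + B + 1, by positivity, fun x hx => ?_⟩
  rw [xf_formula (by simp; linarith)]
  have h1 : ((1:ℂ) / ((x:ℂ) - 1)).re = 1 / (x - 1) := by
    have : ((1:ℂ) / ((x:ℂ) - 1)) = ((1 / (x - 1) : ℝ) : ℂ) := by push_cast; rfl
    rw [this, ofReal_re]
  have h3 : (((Real.log π : ℝ) : ℂ) / 2).re = Real.log π / 2 := by
    have : (((Real.log π : ℝ) : ℂ) / 2) = ((Real.log π / 2 : ℝ) : ℂ) := by push_cast; rfl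
    rw [this, ofReal_re]
  have h4 : (dgS ((x:ℂ) / 2) / 2).re = dg (x / 2 + 1) / 2 := by
    have := dgS_ofReal (x := x / 2) (by linarith)
    push_cast at this
    rw [← this, ← Complex.ofReal_ofNat, ← Complex.ofReal_div, ofReal_re]
  rw [sub_re, add_re, sub_re, h1, h3, h4]
  have h5 := le_dg (x := x / 2) (by linarith)
  have h6 : 0 ≤ Real.log (x / 2) := Real.log_nonneg (by linarith)
  have h7 : (LSeries Lam x).re ≤ B := (re_le_norm _).trans (lseries_bound (by simpa using hx))
  have h8 : 0 ≤ 1 / (x - 1) := by apply div_nonneg <;> linarith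
  linarith [le_abs_self (Real.log π), abs_nonneg (Real.log π)]

/-- along the real axis `xi` satisfies a lower growth bound. -/
lemma xi_real_grow (hRH : RiemannHypothesis) : ∃ c : ℝ, 0 < c ∧ ∀ x h : ℝ, 2 ≤ x → 0 ≤ h →
    ‖xi x‖ ≤ ‖xi ((x + h : ℝ) : ℂ)‖ * Real.exp (c * h) := by
  obtain ⟨c, hc, hx⟩ := xf_real_ge
  refine ⟨c, hc, fun x h h2 hh => ?_⟩
  -- monotone: exp(2 c t) * normSq (xi t)
  have hd : ∀ t : ℝ, 2 ≤ t → HasDerivAt (fun t : ℝ => Real.exp (2 * c * t) * ‖xi t‖ ^ 2)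
      (Real.exp (2 * c * t) * ‖xi t‖ ^ 2 * (2 * (c + (xf t).re))) t := by
    intro t ht
    have h1 : HasDerivAt (fun t : ℝ => xi t) (xf t * xi t) t :=
      (deriv_xi hRH (s := t) (by simp; linarith)).comp_ofReal
    have h3 := h1.norm_sq
    have h4 : HasDerivAt (fun t : ℝ => Real.exp (2 * c * t)) (Real.exp (2 * c * t) * (2 * c)) t := by
      simpa using ((hasDerivAt_id t).const_mul (2 * c)).exp
    refine (h4.mul h3).congr_deriv ?_
    have e : inner ℝ (xi t) (xf t * xi t) = (xf t).re * ‖xi t‖ ^ 2 := by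
      rw [Complex.inner, mul_assoc, Complex.mul_conj, Complex.re_mul_ofReal, Complex.normSq_eq_norm_sq]
    rw [e]; ring
  have hmono : MonotoneOn (fun t : ℝ => Real.exp (2 * c * t) * ‖xi t‖ ^ 2) (Set.Ici 2) := by
    apply monotoneOn_of_deriv_nonneg (convex_Ici 2)
    · exact fun t ht => (hd t ht).continuousAt.continuousWithinAt
    · intro t ht
      rw [interior_Ici] at ht
      exact (hd t ht.le).differentiableAt.differentiableWithinAt
    · intro t ht
      rw [interior_Ici] at ht
      rw [(hd t ht.le).deriv]
      have := hx t ht.le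
      have : 0 ≤ c + (xf t).re := by linarith
      positivity
  have h5 := hmono (show x ∈ Set.Ici 2 from h2) (show x + h ∈ Set.Ici 2 from by
    show 2 ≤ x + h; linarith) (by linarith)
  simp only at h5
  have h6 : Real.exp (2 * c * (x + h)) = Real.exp (2 * c * x) * Real.exp (c * h) ^ 2 := by
    rw [← Real.exp_nat_mul, ← Real.exp_add]; congr 1; push_cast; ring
  rw [h6, mul_assoc (Real.exp (2 * c * x))] at h5
  have h7 := le_of_mul_le_mul_left h5 (Real.exp_pos _)
  rw [← mul_pow] at h7
  have h8 := abs_le_of_sq_le_sq' h7 (by positivity)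
  linarith [h8.2, mul_comm (Real.exp (c * h)) ‖xi ((x + h : ℝ) : ℂ)‖]

lemma xi_shift_le (hRH : RiemannHypothesis) {δ : ℝ} (hδ : 0 < δ) (hδ1 : δ ≤ 1 / 2) {s : ℂ}
    (hs : 1 / 2 ≤ s.re) : ‖xi (s - δ)‖ ≤ ‖xi (s + δ)‖ := by
  set Q : ℂ → ℂ := fun z => xi (1 / 2 + z - δ) / xi (1 / 2 + z + δ) with hQ
  have hne : ∀ z : ℂ, 0 ≤ z.re → xi (1 / 2 + z + δ) ≠ 0 := by
    intro z hz
    apply xi_ne_zero hRH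
    simp; linarith
  have hcl : closure {z : ℂ | 0 < z.re} = {z : ℂ | 0 ≤ z.re} := Complex.closure_setOfPred_lt_re 0
  have hQd : ∀ z : ℂ, 0 ≤ z.re → DifferentiableAt ℂ Q z := by
    intro z hz
    have h1 : DifferentiableAt ℂ (fun z : ℂ => xi (1 / 2 + z - δ)) z :=
      (xi_differentiable _).comp z (f := fun z : ℂ => 1 / 2 + z - δ) (by fun_prop)
    have h2 : DifferentiableAt ℂ (fun z : ℂ => xi (1 / 2 + z + δ)) z :=
      (xi_differentiable _).comp z (f := fun z : ℂ => 1 / 2 + z + δ) (by fun_prop)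
    exact h1.div h2 (hne z hz)
  have hd : DiffContOnCl ℂ Q {z | 0 < z.re} := by
    apply DifferentiableOn.diffContOnCl
    rw [hcl]
    exact fun z hz => (hQd z hz).differentiableWithinAt
  have hexp : ∃ c < (2 : ℝ), ∃ B,
      Q =O[Bornology.cobounded ℂ ⊓ 𝓟 {z | 0 < z.re}] fun z => Real.exp (B * ‖z‖ ^ c) := by
    obtain ⟨C, hC, hlow⟩ := xi_low hRH hδ hδ1
    obtain ⟨D, hD, hup⟩ := xi_up hRH
    refine ⟨3 / 2, by norm_num, (C + D) * 21 * 3, ?_⟩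
    apply Asymptotics.IsBigO.of_bound 1
    rw [eventually_inf_principal]
    have hlarge : ∀ᶠ z : ℂ in Bornology.cobounded ℂ, 1 ≤ ‖z‖ :=
      tendsto_norm_cobounded_atTop.eventually_ge_atTop 1
    filter_upwards [hlarge] with z hz1 hz0
    have hz0' : 0 < z.re := hz0
    have hδn : ‖(δ:ℂ)‖ ≤ 1 / 2 := by
      rw [Complex.norm_real, Real.norm_eq_abs, abs_of_pos hδ]; exact hδ1
    have hhalf : ‖(1 / 2 : ℂ)‖ = 1 / 2 := by norm_num
    have h1 : ‖1 / 2 + z - δ‖ ≤ ‖z‖ + 6 := by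
      refine (norm_sub_le _ _).trans ?_
      linarith [norm_add_le (1 / 2 : ℂ) z]
    have h2 : ‖1 / 2 + z + δ‖ ≤ ‖z‖ + 6 := by
      refine (norm_add_le _ _).trans ?_
      linarith [norm_add_le (1 / 2 : ℂ) z]
    have hn := norm_nonneg z
    have h3 := (W_mono (norm_nonneg _) h1).trans (W_add hn)
    have h4 := (W_mono (norm_nonneg _) h2).trans (W_add hn)
    have h5 := hup (1 / 2 + z - δ) (by simp; linarith)
    have h6 := hlow (1 / 2 + z + δ) (by simp; linarith)
    have hWz : W ‖z‖ ≤ 3 * ‖z‖ ^ (3 / 2 : ℝ) := by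
      have e : ‖z‖ ^ (3 / 2 : ℝ) = ‖z‖ * Real.sqrt ‖z‖ := by
        rw [show (3 / 2 : ℝ) = 1 + 1 / 2 by norm_num, Real.rpow_add (by linarith), Real.rpow_one,
          Real.sqrt_eq_rpow]
      rw [e]
      unfold W
      have h7 : Real.sqrt (1 + ‖z‖) ≤ 3 / 2 * Real.sqrt ‖z‖ := by
        rw [Real.sqrt_le_left (by positivity), mul_pow, Real.sq_sqrt (by linarith)]; linarith
      calc _ ≤ (2 * ‖z‖) * (3 / 2 * Real.sqrt ‖z‖) := by gcongr; linarith
        _ = _ := by ring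
    rw [hQ, norm_div, one_mul, Real.norm_eq_abs, Real.abs_exp,
      div_le_iff₀ (norm_pos_iff.mpr (hne z hz0'.le))]
    calc _ ≤ Real.exp (D * W ‖1 / 2 + z - δ‖) := h5
      _ ≤ Real.exp ((C + D) * 21 * 3 * ‖z‖ ^ (3 / 2 : ℝ)) * Real.exp (-(C * W ‖1 / 2 + z + δ‖)) := by
        rw [← Real.exp_add, Real.exp_le_exp]
        nlinarith
      _ ≤ _ := by gcongr
  have hre : IsBoundedUnder (· ≤ ·) atTop fun x : ℝ => ‖Q x‖ := by
    obtain ⟨c, hc, hg⟩ := xi_real_grow hRH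
    refine ⟨Real.exp (c * (2 * δ)), ?_⟩
    rw [eventually_map]
    filter_upwards [eventually_ge_atTop (2:ℝ)] with x hx
    rw [hQ, norm_div, div_le_iff₀ (norm_pos_iff.mpr (hne x (by simp; linarith)))]
    have := hg (1 / 2 + x - δ) (2 * δ) (by linarith) (by linarith)
    have e1 : ((1 / 2 + x - δ : ℝ) : ℂ) = 1 / 2 + x - δ := by push_cast; rfl
    have e2 : ((1 / 2 + x - δ + 2 * δ : ℝ) : ℂ) = 1 / 2 + x + δ := by push_cast; ring
    rw [e1, e2] at this
    linarith
  have him : ∀ x : ℝ, ‖Q (x * I)‖ ≤ 1 := by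
    intro x
    have e : (1 / 2 + x * I + δ : ℂ) = 1 - conj (1 / 2 + x * I - δ) := by
      have : conj (1 / 2 : ℂ) = 1 / 2 := by
        rw [map_div₀, map_one, map_ofNat]
      simp only [map_add, map_sub, map_mul, conj_ofReal, conj_I, this]
      ring
    have h2 : ‖xi (1 / 2 + x * I + δ)‖ = ‖xi (1 / 2 + x * I - δ)‖ := by
      rw [e, xi_one_sub, xi_conj, RCLike.norm_conj]
    rw [hQ, norm_div, h2]
    exact div_self_le_one _
  have := PhragmenLindelof.right_half_plane_of_bounded_on_real hd hexp hre him
    (z := s - 1 / 2) (by simp; linarith)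
  rw [hQ, norm_div] at this
  have hne' := hne (s - 1/2) (by simp; linarith)
  rw [div_le_one (norm_pos_iff.mpr hne')] at this
  have e : (1 / 2 + (s - 1 / 2) : ℂ) = s := by ring
  rwa [e] at this

lemma xf_re_nonneg (hRH : RiemannHypothesis) {s : ℂ} (hs : 1 / 2 < s.re) : 0 ≤ (xf s).re := by
  have hd : HasDerivAt (fun h : ℝ => ‖xi (s + h)‖ ^ 2) (2 * ((xf s).re * ‖xi s‖ ^ 2)) 0 := by
    have h1 : HasDerivAt (fun h : ℝ => xi (s + h)) (xf s * xi s) 0 := by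
      have h0 : HasDerivAt xi (xf s * xi s) (s + (0:ℝ)) := by simpa using deriv_xi hRH hs
      have h2 : HasDerivAt (fun h : ℝ => s + (h:ℂ)) 1 0 := by
        simpa using ((hasDerivAt_id (0:ℝ)).ofReal_comp).const_add s
      simpa [Function.comp_def] using h0.comp (0:ℝ) h2
    refine h1.norm_sq.congr_deriv ?_
    have e : inner ℝ (xi s) (xf s * xi s) = (xf s).re * ‖xi s‖ ^ 2 := by
      rw [Complex.inner, mul_assoc, Complex.mul_conj, Complex.re_mul_ofReal, Complex.normSq_eq_norm_sq]
    simp only [ofReal_zero, add_zero]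
    rw [e]
  have hd2 : HasDerivAt (fun h : ℝ => ‖xi (s + (-h : ℝ))‖ ^ 2) (-(2 * ((xf s).re * ‖xi s‖ ^ 2))) 0 := by
    have h0 : HasDerivAt (fun h : ℝ => ‖xi (s + h)‖ ^ 2) (2 * ((xf s).re * ‖xi s‖ ^ 2)) (-0 : ℝ) := by
      simpa using hd
    have := h0.comp (0:ℝ) (hasDerivAt_neg (0:ℝ))
    simpa [Function.comp_def] using this
  have hd3 := hd.sub hd2
  have hge : 0 ≤ 2 * ((xf s).re * ‖xi s‖ ^ 2) - -(2 * ((xf s).re * ‖xi s‖ ^ 2)) := by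
    refine ge_of_tendsto hd3.tendsto_slope_zero_right ?_
    have hpos : ∀ᶠ t : ℝ in 𝓝[>] 0, t ∈ Set.Ioc (0:ℝ) (1/2) :=
      Ioc_mem_nhdsGT (by norm_num)
    filter_upwards [hpos] with t ht
    have h1 := xi_shift_le hRH ht.1 ht.2 hs.le
    have h2 : ‖xi (s - t)‖ ^ 2 ≤ ‖xi (s + t)‖ ^ 2 := by gcongr
    have h3 := ht.1
    simp only [Pi.sub_apply, zero_add, ofReal_neg, ofReal_zero, neg_zero, add_zero, sub_self, sub_zero,
      smul_eq_mul]
    rw [← sub_eq_add_neg]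
    apply mul_nonneg (by positivity); linarith
  have hpos : 0 < ‖xi s‖ ^ 2 := by
    have := norm_pos_iff.mpr (xi_ne_zero hRH hs); positivity
  by_contra hneg
  push Not at hneg
  nlinarith [mul_pos_of_neg_of_neg hneg hneg, mul_neg_of_neg_of_pos hneg hpos]

lemma xf_growth (hRH : RiemannHypothesis) {ε : ℝ} (hε : 0 < ε) :
    ∃ C : ℝ, 0 < C ∧ ∀ s : ℂ, 1 / 2 + ε ≤ s.re → ‖xf s‖ ≤ C * Real.sqrt (1 + ‖s‖) := by
  obtain ⟨C, hC, h⟩ := xf_bound_right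
  have hb : ∀ s c : ℂ, 2 ≤ c.re → ‖c‖ ≤ ‖s‖ + 3 → ‖xf c‖ ≤ 3 * C * Real.sqrt (1 + ‖s‖) := by
    intro s c hc hcs
    refine (h c hc).trans ?_
    have hn := norm_nonneg s
    have h1 := one_le_sqrt' hn
    have h2 : Real.sqrt ‖c‖ ≤ 2 * Real.sqrt (1 + ‖s‖) := by
      rw [Real.sqrt_le_left (by positivity), mul_pow, Real.sq_sqrt (by linarith)]; linarith
    nlinarith
  refine ⟨3 * C + 5 * (3 * C) / ε, by positivity, fun s hs => ?_⟩
  have hn := norm_nonneg s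
  have hS := one_le_sqrt' hn
  by_cases h2 : 2 ≤ s.re
  · refine (hb s s h2 (by linarith)).trans ?_
    have : 0 ≤ 5 * (3 * C) / ε := by positivity
    nlinarith
  push Not at h2
  set z : ℂ := ((s.re - 3 : ℝ) : ℂ) with hz
  set c : ℂ := s - z with hc
  have hzn : ‖z‖ = 3 - s.re := by
    rw [hz, Complex.norm_real, Real.norm_eq_abs, abs_of_neg (by linarith)]; ring
  have hcre : c.re = 3 := by simp [hc, hz]
  have hcn : ‖c‖ ≤ ‖s‖ + 3 := by
    refine (norm_sub_le _ _).trans ?_; rw [hzn]; linarith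
  have hball : ∀ w ∈ Metric.ball (0:ℂ) (5/2), 1 / 2 < (c + w).re := by
    intro w hw
    have : ‖w‖ < 5 / 2 := by simpa using hw
    have h3 := abs_re_le_norm w
    have h4 := neg_abs_le w.re
    rw [add_re, hcre]; linarith
  have hdiff : DifferentiableOn ℂ (fun w => xf c - xf (c + w)) (Metric.ball 0 (5/2)) := by
    intro w hw
    have := xf_differentiableAt hRH (hball w hw)
    have h3 : DifferentiableAt ℂ (fun w => xf (c + w)) w := DifferentiableAt.comp w this (by fun_prop)
    exact ((differentiableAt_const _).sub h3).differentiableWithinAt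
  have hbc := hb s c (by rw [hcre]; norm_num) hcn
  set Mb := 3 * C * Real.sqrt (1 + ‖s‖) with hMb
  have hMb0 : 0 < Mb := by positivity
  have hre : Set.MapsTo (fun w => xf c - xf (c + w)) (Metric.ball 0 (5/2)) {z | z.re ≤ Mb} := by
    intro w hw
    have h1 := xf_re_nonneg hRH (hball w hw)
    have h3 := re_le_norm (xf c)
    show (xf c - xf (c + w)).re ≤ Mb
    rw [sub_re]; linarith
  have hzb : z ∈ Metric.ball (0:ℂ) (5/2) := by simp [hzn]; linarith
  have hBC := Complex.borelCaratheodory_zero hMb0 hdiff hre (by norm_num) hzb (by simp)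
  have hgz : ‖xf c - xf (c + z)‖ ≤ 5 * Mb / ε := by
    refine hBC.trans ?_
    rw [hzn]
    have h1 : ε ≤ 5 / 2 - (3 - s.re) := by linarith
    have : 2 * Mb * (3 - s.re) ≤ 5 * Mb := by nlinarith
    gcongr
  have hs' : c + z = s := by rw [hc]; ring
  rw [hs'] at hgz
  have h5 : ‖xf s‖ ≤ ‖xf c‖ + ‖xf c - xf s‖ := by
    have := norm_sub_le (xf c) (xf c - xf s)
    simpa using this
  calc _ ≤ Mb + 5 * Mb / ε := by linarith
    _ = _ := by rw [hMb]; ring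

end PsiRH


namespace PsiRH
open Complex Filter Topology MeasureTheory

local notation "conj" => starRingEnd ℂ

/-- decay function -/
noncomputable def Dc (n : ℝ) : ℝ := (1 + n) ^ (-(3 / 2) : ℝ)

lemma Dc_pos {n : ℝ} (hn : 0 ≤ n) : 0 < Dc n := Real.rpow_pos_of_pos (by linarith) _

lemma Dc_anti {a b : ℝ} (ha : 0 ≤ a) (h : a ≤ b) : Dc b ≤ Dc a :=
  Real.rpow_le_rpow_of_nonpos (by linarith) (by linarith) (by norm_num)

lemma Dc_eq {n : ℝ} (hn : 0 ≤ n) : Dc n = Real.sqrt (1 + n) / (1 + n) ^ 2 := by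
  unfold Dc
  rw [show (-(3 / 2) : ℝ) = 1 / 2 - 2 by norm_num, Real.rpow_sub (by linarith), Real.sqrt_eq_rpow,
    Real.rpow_two]

lemma Dc_integrable : Integrable (fun t : ℝ => Dc |t|) := by
  have := integrable_one_add_norm (E := ℝ) (μ := volume) (r := 3 / 2) (by norm_num)
  simpa [Dc, Real.norm_eq_abs] using this

lemma Dc_tendsto : Tendsto Dc atTop (𝓝 0) := by
  have h1 := tendsto_rpow_neg_atTop (y := 3 / 2) (by norm_num)
  exact h1.comp (tendsto_atTop_add_const_left atTop 1 tendsto_id)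

lemma Dc_line {s : ℂ} : Dc ‖s‖ ≤ Dc |s.im| := Dc_anti (abs_nonneg _) (abs_im_le_norm s)

/-- point on vertical line -/
noncomputable abbrev vl (a t : ℝ) : ℂ := (a : ℂ) + t * I

@[simp] lemma vl_re (a t : ℝ) : (vl a t).re = a := by simp [vl]
@[simp] lemma vl_im (a t : ℝ) : (vl a t).im = t := by simp [vl]
lemma vl_continuous (a : ℝ) : Continuous (vl a) := by unfold vl; fun_prop

lemma vline_integrable {H : ℂ → ℂ} {a C : ℝ}
    (hd : ∀ s : ℂ, s.re = a → ContinuousAt H s)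
    (hb : ∀ s : ℂ, s.re = a → ‖H s‖ ≤ C * Dc ‖s‖) (hC : 0 ≤ C) :
    Integrable (fun t : ℝ => H (vl a t)) := by
  refine (Dc_integrable.const_mul C).mono' ?_ (Eventually.of_forall fun t => ?_)
  · apply Continuous.aestronglyMeasurable
    rw [continuous_iff_continuousAt]
    intro t
    exact ContinuousAt.comp (f := vl a) (hd _ (vl_re a t)) (vl_continuous a).continuousAt
  · refine (hb _ (vl_re a t)).trans ?_
    have := Dc_line (s := vl a t)
    rw [vl_im] at this
    gcongr

lemma vline_shift {H : ℂ → ℂ} {a b C : ℝ} (hab : a ≤ b)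
    (hd : ∀ s : ℂ, a ≤ s.re → s.re ≤ b → DifferentiableAt ℂ H s)
    (hb : ∀ s : ℂ, a ≤ s.re → s.re ≤ b → ‖H s‖ ≤ C * Dc ‖s‖) (hC : 0 ≤ C) :
    ∫ t : ℝ, H (vl a t) = ∫ t : ℝ, H (vl b t) := by
  have ia : Integrable (fun t : ℝ => H (vl a t)) :=
    vline_integrable (fun s hs => (hd s hs.ge (hs.le.trans hab)).continuousAt)
      (fun s hs => hb s hs.ge (hs.le.trans hab)) hC
  have ib : Integrable (fun t : ℝ => H (vl b t)) :=
    vline_integrable (fun s hs => (hd s (hab.trans hs.ge) hs.le).continuousAt)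
      (fun s hs => hb s (hab.trans hs.ge) hs.le) hC
  have ta := intervalIntegral_tendsto_integral ia tendsto_neg_atTop_atBot tendsto_id
  have tb := intervalIntegral_tendsto_integral ib tendsto_neg_atTop_atBot tendsto_id
  have hrect : ∀ T : ℝ, 0 ≤ T → ‖(∫ t in (-T)..T, H (vl b t)) - ∫ t in (-T)..T, H (vl a t)‖
      ≤ 2 * (C * (b - a)) * Dc T := by
    intro T hT
    have h := Complex.integral_boundary_rect_eq_zero_of_differentiableOn H (vl a (-T)) (vl b T)
      (fun s hs => by
        rw [Complex.mem_reProdIm, vl_re, vl_re, Set.uIcc_of_le hab] at hs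
        exact (hd s hs.1.1 hs.1.2).differentiableWithinAt)
    simp only [vl_re, vl_im] at h
    have hh : ∀ T' : ℝ, |T'| = T → ‖∫ x in a..b, H (x + T' * I)‖ ≤ C * Dc T * (b - a) := by
      intro T' hT'
      have := intervalIntegral.norm_integral_le_of_norm_le_const (a := a) (b := b)
        (f := fun x : ℝ => H (x + T' * I)) (C := C * Dc T) (fun x hx => by
          rw [Set.uIoc_of_le hab] at hx
          refine (hb _ (by simp; exact hx.1.le) (by simpa using hx.2)).trans ?_
          have := Dc_line (s := (x + T' * I : ℂ))
          simp only [add_im, ofReal_im, mul_im, ofReal_re, I_im, mul_one, I_re, mul_zero, add_zero,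
            zero_add, hT'] at this
          gcongr)
      rwa [abs_of_nonneg (by linarith)] at this
    have h1 := hh (-T) (by rw [abs_neg, abs_of_nonneg hT])
    have h2 := hh T (abs_of_nonneg hT)
    have e : I • ((∫ t in (-T)..T, H (vl b t)) - ∫ t in (-T)..T, H (vl a t)) =
        (∫ x in a..b, H (x + T * I)) - ∫ x in a..b, H (x + (-T : ℝ) * I) := by
      rw [smul_sub]
      linear_combination h
    have e2 : ‖I • ((∫ t in (-T)..T, H (vl b t)) - ∫ t in (-T)..T, H (vl a t))‖ =
      ‖(∫ t in (-T)..T, H (vl b t)) - ∫ t in (-T)..T, H (vl a t)‖ := by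
      rw [norm_smul, norm_I, one_mul]
    rw [← e2, e]
    refine (norm_sub_le _ _).trans ?_
    linarith
  have hz : Tendsto (fun T : ℝ => (∫ t in (-T)..T, H (vl b t)) - ∫ t in (-T)..T, H (vl a t))
      atTop (𝓝 0) := by
    apply squeeze_zero_norm' (a := fun T => 2 * (C * (b - a)) * Dc T)
    · filter_upwards [eventually_ge_atTop 0] with T hT using hrect T hT
    · simpa using Dc_tendsto.const_mul (2 * (C * (b - a)))
  have := tendsto_nhds_unique hz (tb.sub ta)
  exact (sub_eq_zero.mp this.symm).symm

lemma vline_zero {H : ℂ → ℂ} {a C : ℝ} (ha : 0 ≤ a)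
    (hd : ∀ s : ℂ, a ≤ s.re → DifferentiableAt ℂ H s)
    (hb : ∀ s : ℂ, a ≤ s.re → ‖H s‖ ≤ C * Dc ‖s‖) (hC : 0 ≤ C) :
    ∫ t : ℝ, H (vl a t) = 0 := by
  have hsh : ∀ᶠ b : ℝ in atTop, ∫ t : ℝ, H (vl b t) = ∫ t : ℝ, H (vl a t) := by
    filter_upwards [eventually_ge_atTop a] with b hab
    exact (vline_shift hab (fun s h1 _ => hd s h1) (fun s h1 _ => hb s h1) hC).symm
  have hlim : Tendsto (fun b : ℝ => ∫ t : ℝ, H (vl b t)) atTop (𝓝 (∫ _ : ℝ, (0:ℂ))) := by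
    apply tendsto_integral_filter_of_dominated_convergence (fun t => C * Dc |t|)
    · filter_upwards [eventually_ge_atTop a] with b hab
      exact (vline_integrable (fun s hs => (hd s (hab.trans hs.ge)).continuousAt)
        (fun s hs => hb s (hab.trans hs.ge)) hC).aestronglyMeasurable
    · filter_upwards [eventually_ge_atTop a] with b hab
      filter_upwards with t
      refine (hb _ (by simpa using hab)).trans ?_
      have := Dc_line (s := vl b t)
      rw [vl_im] at this
      gcongr
    · exact Dc_integrable.const_mul C
    · filter_upwards with t
      apply squeeze_zero_norm' (a := fun b => C * Dc b)
      · filter_upwards [eventually_ge_atTop a] with b hab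
        refine (hb _ (by simpa using hab)).trans ?_
        have h2 : b ≤ ‖vl b t‖ := by
          have := re_le_norm (vl b t)
          rwa [vl_re] at this
        have := Dc_anti (ha.trans hab) h2
        gcongr
      · simpa using Dc_tendsto.const_mul C
  rw [integral_zero] at hlim
  exact tendsto_nhds_unique (tendsto_const_nhds.congr' (hsh.mono fun b hb => hb.symm)) hlim

lemma dslope_bound {g : ℂ → ℂ} {U S : Set ℂ} {p : ℂ} {B : ℂ → ℝ} (hU : IsOpen U) (hp : p ∈ U)
    (hg : DifferentiableOn ℂ g U) (hB1 : ∀ s ∈ S, 1 ≤ B s) (hB : ∀ s ∈ S, ‖g s‖ ≤ B s) :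
    ∃ C : ℝ, 0 < C ∧ ∀ s ∈ S, ‖dslope g p s‖ ≤ C * (B s / (1 + ‖s‖)) := by
  have hds : DifferentiableOn ℂ (dslope g p) U :=
    (differentiableOn_dslope (hU.mem_nhds hp)).mpr hg
  obtain ⟨r, hr, hball⟩ := Metric.nhds_basis_closedBall.mem_iff.mp (hU.mem_nhds hp)
  obtain ⟨K, hK⟩ := (isCompact_closedBall p r).exists_bound_of_continuousOn
    (hds.continuousOn.mono hball)
  have hK0 : 0 ≤ K := (norm_nonneg _).trans (hK p (Metric.mem_closedBall_self hr.le))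
  have hpn := norm_nonneg p
  have hgp := norm_nonneg (g p)
  refine ⟨K * (1 + ‖p‖ + r) + (1 + ‖g p‖) * ((1 + ‖p‖) / r + 1), by positivity, fun s hs => ?_⟩
  have hn := norm_nonneg s
  have h1 : ‖s‖ ≤ ‖p‖ + ‖s - p‖ := by
    have := norm_add_le p (s - p); simpa using this
  have hBs := hB1 s hs
  rw [add_mul]
  by_cases hsr : ‖s - p‖ ≤ r
  · have h2 := hK s (by rw [Metric.mem_closedBall, dist_eq_norm]; exact hsr)
    have h3 : 1 ≤ (1 + ‖p‖ + r) * (B s / (1 + ‖s‖)) := by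
      rw [← mul_div_assoc, le_div_iff₀ (by positivity)]; nlinarith
    have h4 : 0 ≤ (1 + ‖g p‖) * ((1 + ‖p‖) / r + 1) * (B s / (1 + ‖s‖)) := by positivity
    calc ‖dslope g p s‖ ≤ K * 1 := by linarith
      _ ≤ K * ((1 + ‖p‖ + r) * (B s / (1 + ‖s‖))) := by gcongr
      _ ≤ _ := by linarith
  · push Not at hsr
    have hsp : s ≠ p := by
      rintro rfl; simp at hsr; linarith
    have hpos : 0 < ‖s - p‖ := by linarith
    rw [dslope_of_ne _ hsp, slope_def_field, norm_div]
    have h3 : 1 + ‖s‖ ≤ ((1 + ‖p‖) / r + 1) * ‖s - p‖ := by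
      have : 1 + ‖p‖ ≤ (1 + ‖p‖) / r * ‖s - p‖ := by
        rw [div_mul_eq_mul_div, le_div_iff₀ hr]; gcongr
      linarith
    have h5 : ‖g s - g p‖ ≤ (1 + ‖g p‖) * B s := by
      refine (norm_sub_le _ _).trans ?_
      have := hB s hs; nlinarith
    have h4 : 0 ≤ K * (1 + ‖p‖ + r) * (B s / (1 + ‖s‖)) := by positivity
    have h6 : ‖g s - g p‖ / ‖s - p‖ ≤ (1 + ‖g p‖) * ((1 + ‖p‖) / r + 1) * (B s / (1 + ‖s‖)) := by
      rw [div_le_iff₀ hpos]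
      calc _ ≤ (1 + ‖g p‖) * B s := h5
        _ = (1 + ‖g p‖) * (B s / (1 + ‖s‖)) * (1 + ‖s‖) := by field_simp
        _ ≤ (1 + ‖g p‖) * (B s / (1 + ‖s‖)) * (((1 + ‖p‖) / r + 1) * ‖s - p‖) := by gcongr
        _ = _ := by ring
    linarith

/-- the key vanishing: `(f(s)-f(p))/(s-p) * N(s)` integrates to zero. -/
lemma dslope_vanish (hRH : RiemannHypothesis) {ε C : ℝ} (hε : 0 < ε) {p : ℂ} (hp : 1 / 2 < p.re)
    {N : ℂ → ℂ} (hN : ∀ s : ℂ, 1 / 2 + ε ≤ s.re → DifferentiableAt ℂ N s)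
    (hNb : ∀ s : ℂ, 1 / 2 + ε ≤ s.re → ‖N s‖ ≤ C / (1 + ‖s‖)) (hC : 0 ≤ C) :
    ∫ t : ℝ, dslope xf p (vl (1 / 2 + ε) t) * N (vl (1 / 2 + ε) t) = 0 := by
  obtain ⟨D, hD, hf⟩ := xf_growth hRH hε
  have hdf : DifferentiableOn ℂ xf {s : ℂ | 1 / 2 < s.re} := fun s hs =>
    (xf_differentiableAt hRH hs).differentiableWithinAt
  obtain ⟨E, hE, hds⟩ := dslope_bound (S := {s : ℂ | 1 / 2 + ε ≤ s.re})
    (B := fun s => (D + 1) * Real.sqrt (1 + ‖s‖)) xi_half_open hp hdf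
    (fun s hs => by
      have := one_le_sqrt' (norm_nonneg s); nlinarith)
    (fun s hs => (hf s hs).trans (by
      have := one_le_sqrt' (norm_nonneg s); nlinarith))
  have hdsd : DifferentiableOn ℂ (dslope xf p) {s : ℂ | 1 / 2 < s.re} :=
    (differentiableOn_dslope (xi_half_open.mem_nhds hp)).mpr hdf
  refine vline_zero (H := fun s => dslope xf p s * N s) (C := E * (D + 1) * C) (by linarith)
    (fun s hs => ?_) (fun s hs => ?_) (by positivity)
  · exact (hdsd.differentiableAt (xi_half_open.mem_nhds (by
      show 1 / 2 < s.re; linarith))).mul (hN s hs)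
  · rw [norm_mul, Dc_eq (norm_nonneg s)]
    have h1 := hds s hs
    have h2 := hNb s hs
    have hn := norm_nonneg s
    calc _ ≤ (E * ((D + 1) * Real.sqrt (1 + ‖s‖) / (1 + ‖s‖))) * (C / (1 + ‖s‖)) := by gcongr
      _ = _ := by field_simp

end PsiRH


namespace PsiRH
open Complex Filter Topology MeasureTheory

local notation "conj" => starRingEnd ℂ

lemma xf_vl_continuous (hRH : RiemannHypothesis) {σ : ℝ} (hσ : 1 / 2 < σ) :
    Continuous fun t : ℝ => xf (vl σ t) := by
  rw [continuous_iff_continuousAt]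
  intro t
  exact ContinuousAt.comp (f := vl σ)
    (xf_differentiableAt hRH (by rw [vl_re]; exact hσ)).continuousAt (vl_continuous σ).continuousAt

lemma norm_vl_le {σ t : ℝ} (hσ : 0 ≤ σ) : ‖vl σ t‖ ≤ σ + |t| := by
  refine (norm_add_le _ _).trans ?_
  simp [abs_of_nonneg hσ]

lemma xf_mul_bound (hRH : RiemannHypothesis) {ε : ℝ} (hε : 0 < ε) : ∃ D : ℝ, 0 < D ∧
    ∀ t : ℝ, ‖xf (vl (1 / 2 + ε) t)‖ / (1 + |t|) ^ 2 ≤ D * Dc |t| := by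
  obtain ⟨D, hD, hf⟩ := xf_growth hRH hε
  refine ⟨D * Real.sqrt (2 + ε), by positivity, fun t => ?_⟩
  rw [Dc_eq (abs_nonneg t)]
  have h1 := hf (vl (1 / 2 + ε) t) (by rw [vl_re])
  have h2 : Real.sqrt (1 + ‖vl (1 / 2 + ε) t‖) ≤ Real.sqrt (2 + ε) * Real.sqrt (1 + |t|) := by
    rw [← Real.sqrt_mul (by linarith)]
    apply Real.sqrt_le_sqrt
    have := norm_vl_le (σ := 1 / 2 + ε) (t := t) (by linarith)
    nlinarith [abs_nonneg t]
  have h3 : ‖xf (vl (1 / 2 + ε) t)‖ ≤ D * (Real.sqrt (2 + ε) * Real.sqrt (1 + |t|)) :=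
    h1.trans (by gcongr)
  calc _ ≤ D * (Real.sqrt (2 + ε) * Real.sqrt (1 + |t|)) / (1 + |t|) ^ 2 := by gcongr
    _ = _ := by ring

lemma xf_mul_integrable (hRH : RiemannHypothesis) {ε C : ℝ} (hε : 0 < ε) {k : ℝ → ℂ}
    (hk : Continuous k) (hkb : ∀ t, ‖k t‖ ≤ C / (1 + |t|) ^ 2) :
    Integrable (fun t : ℝ => xf (vl (1 / 2 + ε) t) * k t) := by
  obtain ⟨D, hD, hb⟩ := xf_mul_bound hRH hε
  refine (Dc_integrable.const_mul (C * D)).mono'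
    ((xf_vl_continuous hRH (by linarith)).mul hk).aestronglyMeasurable
    (Eventually.of_forall fun t => ?_)
  have hC : 0 ≤ C := by
    have := (norm_nonneg _).trans (hkb 0)
    simpa using this
  rw [norm_mul]
  calc _ ≤ ‖xf (vl (1 / 2 + ε) t)‖ * (C / (1 + |t|) ^ 2) := by gcongr; exact hkb t
    _ = C * (‖xf (vl (1 / 2 + ε) t)‖ / (1 + |t|) ^ 2) := by ring
    _ ≤ C * (D * Dc |t|) := by gcongr; exact hb t
    _ = _ := by ring

lemma k_integrable {C : ℝ} {k : ℝ → ℂ}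
    (hk : Continuous k) (hkb : ∀ t, ‖k t‖ ≤ C / (1 + |t|) ^ 2) : Integrable k := by
  have := (integrable_one_add_norm (E := ℝ) (μ := volume) (r := 2) (by norm_num)).const_mul C
  refine this.mono' hk.aestronglyMeasurable (Eventually.of_forall fun t => (hkb t).trans ?_)
  rw [Real.norm_eq_abs, Real.rpow_neg (by positivity), Real.rpow_two, div_eq_mul_inv]

lemma pk_bound {v : ℝ} (hv : 0 < v) (t : ℝ) :
    1 / (v ^ 2 + t ^ 2) ≤ (2 * (1 + 1 / v ^ 2)) / (1 + |t|) ^ 2 := by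
  rw [div_le_div_iff₀ (by positivity) (by positivity), one_mul]
  have h1 : (1 + |t|) ^ 2 ≤ 2 * (1 + t ^ 2) := by
    nlinarith [sq_nonneg (1 - |t|), sq_abs t]
  have h2 : 2 * (1 + 1 / v ^ 2) * (v ^ 2 + t ^ 2) = 2 * (1 + t ^ 2 + v ^ 2 + t ^ 2 / v ^ 2) := by
    field_simp; ring
  rw [h2]
  have : 0 ≤ t ^ 2 / v ^ 2 := by positivity
  nlinarith [sq_nonneg v]

lemma integral_pk {v : ℝ} (hv : 0 < v) : ∫ t : ℝ, 1 / (v ^ 2 + t ^ 2) = π / v := by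
  have h := integral_univ_inv_one_add_sq
  have h2 := Measure.integral_comp_div (fun x : ℝ => (1 + x ^ 2)⁻¹) v
  rw [h, abs_of_pos hv, smul_eq_mul] at h2
  have e : ∀ t : ℝ, 1 / (v ^ 2 + t ^ 2) = (1 / v ^ 2) * (1 + (t / v) ^ 2)⁻¹ := by
    intro t; field_simp
  simp_rw [e]
  rw [integral_const_mul, h2]; field_simp

lemma pk_continuous {v : ℝ} (hv : 0 < v) : Continuous fun t : ℝ => 1 / (v ^ 2 + t ^ 2) := by
  have : ∀ t : ℝ, v ^ 2 + t ^ 2 ≠ 0 := fun t => by positivity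
  fun_prop (disch := assumption)

lemma pk_norm {v : ℝ} (hv : 0 < v) (t : ℝ) :
    ‖((1 / (v ^ 2 + t ^ 2) : ℝ) : ℂ)‖ ≤ (2 * (1 + 1 / v ^ 2)) / (1 + |t|) ^ 2 := by
  rw [Complex.norm_real, Real.norm_eq_abs, abs_of_nonneg (by positivity)]
  exact pk_bound hv t

lemma poisson_complex (hRH : RiemannHypothesis) {ε v : ℝ} (hε : 0 < ε) (hv : 0 < v) :
    ∫ t : ℝ, xf (vl (1 / 2 + ε) t) * ((1 / (v ^ 2 + t ^ 2) : ℝ) : ℂ)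
      = xf ((1 / 2 + ε + v : ℝ) : ℂ) * ((π / v : ℝ) : ℂ) := by
  set σ : ℝ := 1 / 2 + ε with hσ
  set p : ℂ := ((σ + v : ℝ) : ℂ) with hp
  have hden : ∀ s : ℂ, σ ≤ s.re → v ≤ ‖s - σ + v‖ := by
    intro s hs
    have := re_le_norm (s - σ + v)
    simp at this; linarith
  have h := dslope_vanish hRH hε (p := p) (N := fun s => 1 / (s - σ + v))
    (C := 1 + (1 + |σ - v|) / v) (by rw [hp, ofReal_re]; linarith)
    (fun s hs => by
      have : s - σ + v ≠ 0 := by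
        rw [← norm_pos_iff]; linarith [hden s hs]
      fun_prop (disch := assumption))
    (fun s hs => by
      have h1 := hden s hs
      rw [norm_div, norm_one, div_le_div_iff₀ (by linarith) (by positivity), one_mul]
      have h2 : ‖s‖ ≤ ‖s - σ + v‖ + |σ - v| := by
        have := norm_add_le (s - σ + v) ((σ - v : ℝ) : ℂ)
        rw [Complex.norm_real, Real.norm_eq_abs] at this
        have e : (s - σ + v) + ((σ - v : ℝ) : ℂ) = s := by push_cast; ring
        rwa [e] at this
      have h3 : 1 + |σ - v| ≤ (1 + |σ - v|) / v * ‖s - σ + v‖ := by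
        rw [div_mul_eq_mul_div, le_div_iff₀ hv]; gcongr
      linarith) (by positivity)
  have e : ∀ t : ℝ, dslope xf p (vl σ t) * (1 / (vl σ t - σ + v)) =
      -(xf (vl σ t) * ((1 / (v ^ 2 + t ^ 2) : ℝ) : ℂ)
        - xf p * ((1 / (v ^ 2 + t ^ 2) : ℝ) : ℂ)) := by
    intro t
    have hne : vl σ t ≠ p := by
      intro h; have := congrArg re h
      rw [vl_re, hp, ofReal_re] at this; linarith
    rw [dslope_of_ne _ hne, slope_def_field]
    have h1 : vl σ t - p ≠ 0 := sub_ne_zero.mpr hne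
    have h2 : vl σ t - σ + v ≠ 0 := by
      rw [← norm_pos_iff]; linarith [hden (vl σ t) (by rw [vl_re])]
    have h3 : (vl σ t - p) * (vl σ t - σ + v) = -((v ^ 2 + t ^ 2 : ℝ) : ℂ) := by
      rw [hp]; push_cast; unfold vl; linear_combination (t:ℂ) ^ 2 * I_sq
    have h4 : ((v ^ 2 + t ^ 2 : ℝ) : ℂ) ≠ 0 := by
      intro h; have := congrArg re h; rw [ofReal_re, zero_re] at this
      have : 0 < v ^ 2 + t ^ 2 := by positivity
      linarith
    rw [ofReal_div, ofReal_one, div_mul_div_comm, h3, mul_one]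
    field_simp
  rw [← hσ] at h
  simp_rw [e] at h
  have hkc : Continuous fun t : ℝ => ((1 / (v ^ 2 + t ^ 2) : ℝ) : ℂ) :=
    continuous_ofReal.comp (pk_continuous hv)
  have i1 := xf_mul_integrable hRH hε hkc (pk_norm hv)
  have i2 := (k_integrable hkc (pk_norm hv)).const_mul (xf p)
  rw [integral_neg, integral_sub i1 i2, neg_eq_zero, sub_eq_zero] at h
  rw [h, integral_const_mul, integral_complex_ofReal, integral_pk hv]

lemma poisson_integrable (hRH : RiemannHypothesis) {ε v : ℝ} (hε : 0 < ε) (hv : 0 < v) :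
    Integrable (fun t : ℝ => (xf (vl (1 / 2 + ε) t)).re * (1 / (v ^ 2 + t ^ 2))) := by
  have hkc : Continuous fun t : ℝ => ((1 / (v ^ 2 + t ^ 2) : ℝ) : ℂ) :=
    continuous_ofReal.comp (pk_continuous hv)
  have i1 := (xf_mul_integrable hRH hε hkc (pk_norm hv)).re
  refine i1.congr (Eventually.of_forall fun t => ?_)
  exact Complex.re_mul_ofReal _ _

/-- `xF ε v = f(1/2+ε+v)/v` -/
noncomputable def xF (ε v : ℝ) : ℝ := (xf ((1 / 2 + ε + v : ℝ) : ℂ)).re / v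

lemma poisson (hRH : RiemannHypothesis) {ε v : ℝ} (hε : 0 < ε) (hv : 0 < v) :
    ∫ t : ℝ, (xf (vl (1 / 2 + ε) t)).re * (1 / (v ^ 2 + t ^ 2)) = π * xF ε v := by
  have hkc : Continuous fun t : ℝ => ((1 / (v ^ 2 + t ^ 2) : ℝ) : ℂ) :=
    continuous_ofReal.comp (pk_continuous hv)
  have i1 := (xf_mul_integrable hRH hε hkc (pk_norm hv))
  have h := congrArg re (poisson_complex hRH hε hv)
  have h2 := integral_re i1
  simp only [RCLike.re_to_complex] at h2
  rw [← h2] at h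
  simp only [Complex.re_mul_ofReal] at h
  rw [h, xF]; ring

lemma xF_anti (hRH : RiemannHypothesis) {ε v w : ℝ} (hε : 0 < ε) (hv : 0 < v) (hvw : v ≤ w) :
    xF ε w ≤ xF ε v := by
  have h1 := poisson hRH hε hv
  have h2 := poisson hRH hε (hv.trans_le hvw)
  have h3 : ∫ t : ℝ, (xf (vl (1 / 2 + ε) t)).re * (1 / (w ^ 2 + t ^ 2)) ≤
      ∫ t : ℝ, (xf (vl (1 / 2 + ε) t)).re * (1 / (v ^ 2 + t ^ 2)) := by
    refine integral_mono (poisson_integrable hRH hε (hv.trans_le hvw)) (poisson_integrable hRH hε hv)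
      (fun t => ?_)
    have := xf_re_nonneg hRH (s := vl (1 / 2 + ε) t) (by rw [vl_re]; linarith)
    simp only
    gcongr
  rw [h1, h2] at h3
  exact le_of_mul_le_mul_left h3 Real.pi_pos

lemma xF_nonneg (hRH : RiemannHypothesis) {ε v : ℝ} (hε : 0 < ε) (hv : 0 < v) : 0 ≤ xF ε v :=
  div_nonneg (xf_re_nonneg hRH (by rw [ofReal_re]; linarith)) hv.le

/-- The kernel. -/
noncomputable def Gk (y η : ℝ) (s : ℂ) : ℂ :=
  (y : ℂ) ^ s * (((1 + η : ℝ) : ℂ) ^ (s + 1) - 1) / (η * s * (s + 1))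

lemma Gk_differentiableAt {y η : ℝ} (hy : 1 ≤ y) (hη : 0 < η) {s : ℂ} (hs : 0 < s.re) :
    DifferentiableAt ℂ (Gk y η) s := by
  have h1 : (y : ℂ) ≠ 0 := by exact_mod_cast (by linarith : y ≠ 0)
  have h2 : ((1 + η : ℝ) : ℂ) ≠ 0 := by exact_mod_cast (by linarith : 1 + η ≠ 0)
  have h3 : (η : ℂ) * s * (s + 1) ≠ 0 := by
    have a1 : (η : ℂ) ≠ 0 := by exact_mod_cast hη.ne'
    have a2 : s ≠ 0 := by rintro rfl; simp at hs
    have a3 : s + 1 ≠ 0 := by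
      intro h; have := congrArg re h; simp at this; linarith
    exact mul_ne_zero (mul_ne_zero a1 a2) a3
  have d1 : DifferentiableAt ℂ (fun s : ℂ => (y : ℂ) ^ s) s :=
    DifferentiableAt.const_cpow (by fun_prop) (Or.inl h1)
  have d2 : DifferentiableAt ℂ (fun s : ℂ => ((1 + η : ℝ) : ℂ) ^ (s + 1)) s :=
    DifferentiableAt.const_cpow (by fun_prop) (Or.inl h2)
  unfold Gk
  exact (d1.mul (d2.sub_const 1)).div (by fun_prop) h3

lemma Gk_bound {y η : ℝ} (hy : 1 ≤ y) (hη : 0 < η) : ∃ C : ℝ, 0 < C ∧ ∀ s : ℂ, 1 / 2 ≤ s.re →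
    s.re ≤ 2 → ‖Gk y η s‖ ≤ C / (1 + ‖s‖) ^ 2 := by
  refine ⟨y ^ (2:ℝ) * ((1 + η) ^ (3:ℝ) + 1) * 9 / η, by positivity, fun s h1 h2 => ?_⟩
  have hn : 1 / 2 ≤ ‖s‖ := h1.trans (re_le_norm s)
  have hn1 : ‖s‖ ≤ ‖s + 1‖ := by
    rw [Complex.norm_def, Complex.norm_def]
    apply Real.sqrt_le_sqrt
    rw [normSq_apply, normSq_apply]
    simp; nlinarith
  have hyn : ‖(y:ℂ) ^ s‖ ≤ y ^ (2:ℝ) := by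
    rw [Complex.norm_cpow_eq_rpow_re_of_pos (by linarith)]
    exact Real.rpow_le_rpow_of_exponent_le hy h2
  have hen : ‖((1 + η : ℝ) : ℂ) ^ (s + 1) - 1‖ ≤ (1 + η) ^ (3:ℝ) + 1 := by
    refine (norm_sub_le _ _).trans ?_
    rw [Complex.norm_cpow_eq_rpow_re_of_pos (by linarith), norm_one]
    have : (1 + η) ^ (s + 1).re ≤ (1 + η) ^ (3:ℝ) :=
      Real.rpow_le_rpow_of_exponent_le (by linarith) (by simp; linarith)
    linarith
  have hd : η * ((1 + ‖s‖) / 3) ^ 2 ≤ ‖(η : ℂ) * s * (s + 1)‖ := by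
    rw [norm_mul, norm_mul, Complex.norm_real, Real.norm_eq_abs, abs_of_pos hη, mul_assoc]
    have : (1 + ‖s‖) / 3 ≤ ‖s‖ := by linarith
    have h4 : ((1 + ‖s‖) / 3) ^ 2 ≤ ‖s‖ * ‖s + 1‖ := by
      rw [sq]; apply mul_le_mul this (by linarith) (by positivity) (by positivity)
    gcongr
  unfold Gk
  rw [norm_div, norm_mul]
  calc _ ≤ y ^ (2:ℝ) * ((1 + η) ^ (3:ℝ) + 1) / (η * ((1 + ‖s‖) / 3) ^ 2) := by gcongr
    _ = _ := by field_simp; norm_num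

/-- entire part of the kernel -/
noncomputable def Ek (η : ℝ) (w : ℂ) : ℂ := dslope (fun w : ℂ => ((1 + η : ℝ) : ℂ) ^ (w + 1)) (-1) w / η

lemma Ek_eq {η : ℝ} (y : ℝ) (hη : 0 < η) {w : ℂ} (hw : w ≠ -1) :
    (y:ℂ) ^ w * Ek η w / w = Gk y η w := by
  have h : w + 1 ≠ 0 := by
    intro h; exact hw (eq_neg_of_add_eq_zero_left h)
  unfold Ek Gk
  rw [dslope_of_ne _ hw, slope_def_field]
  simp only [neg_add_cancel, cpow_zero, sub_neg_eq_add]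
  rw [mul_div_assoc, mul_div_assoc, div_div, div_div]
  congr 2
  ring

lemma Ek_differentiable {η : ℝ} (hη : 0 < η) : Differentiable ℂ (Ek η) := by
  have h2 : ((1 + η : ℝ) : ℂ) ≠ 0 := by exact_mod_cast (by linarith : 1 + η ≠ 0)
  have d : Differentiable ℂ (fun w : ℂ => ((1 + η : ℝ) : ℂ) ^ (w + 1)) := fun s =>
    DifferentiableAt.const_cpow (by fun_prop) (Or.inl h2)
  have d2 : DifferentiableOn ℂ (dslope (fun w : ℂ => ((1 + η : ℝ) : ℂ) ^ (w + 1)) (-1)) Set.univ :=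
    (differentiableOn_dslope Filter.univ_mem).mpr d.differentiableOn
  unfold Ek
  exact (differentiableOn_univ.mp d2).div_const _

lemma Ek_bound {η σ : ℝ} (hη : 0 < η) (hσ : 0 < σ) : ∃ C : ℝ, 0 < C ∧ ∀ w : ℂ, w.re ≤ σ →
    ‖Ek η w‖ ≤ C / (1 + ‖w‖) := by
  have h2 : ((1 + η : ℝ) : ℂ) ≠ 0 := by exact_mod_cast (by linarith : 1 + η ≠ 0)
  have d : Differentiable ℂ (fun w : ℂ => ((1 + η : ℝ) : ℂ) ^ (w + 1)) := fun s =>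
    DifferentiableAt.const_cpow (by fun_prop) (Or.inl h2)
  obtain ⟨C, hC, h⟩ := dslope_bound (g := fun w : ℂ => ((1 + η : ℝ) : ℂ) ^ (w + 1)) (U := Set.univ)
    (S := {w : ℂ | w.re ≤ σ}) (p := -1) (B := fun _ => (1 + η) ^ (σ + 1)) isOpen_univ (Set.mem_univ _)
    d.differentiableOn (fun s _ => Real.one_le_rpow (by linarith) (by linarith))
    (fun s hs => by
      rw [Complex.norm_cpow_eq_rpow_re_of_pos (by linarith)]
      have hs' : s.re ≤ σ := hs
      exact Real.rpow_le_rpow_of_exponent_le (by linarith) (by simp; linarith))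
  refine ⟨C * (1 + η) ^ (σ + 1) / η, by positivity, fun w hw => ?_⟩
  unfold Ek
  rw [norm_div, Complex.norm_real, Real.norm_eq_abs, abs_of_pos hη, div_le_iff₀ hη]
  refine (h w hw).trans (le_of_eq ?_)
  field_simp

lemma Gk_line {y η σ : ℝ} (hy : 1 ≤ y) (hη : 0 < η) (h1 : 1 / 2 ≤ σ) (h2 : σ ≤ 2) :
    Continuous (fun t : ℝ => Gk y η (vl σ t)) ∧
    ∃ C : ℝ, 0 < C ∧ ∀ t : ℝ, ‖Gk y η (vl σ t)‖ ≤ C / (1 + |t|) ^ 2 := by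
  constructor
  · rw [continuous_iff_continuousAt]
    intro t
    exact ContinuousAt.comp (f := vl σ)
      (Gk_differentiableAt hy hη (by rw [vl_re]; linarith)).continuousAt (vl_continuous σ).continuousAt
  · obtain ⟨C, hC, h⟩ := Gk_bound hy hη
    refine ⟨C, hC, fun t => (h _ (by rwa [vl_re]) (by rwa [vl_re])).trans ?_⟩
    have := abs_im_le_norm (vl σ t)
    rw [vl_im] at this
    gcongr

lemma vl_neg_conj (σ t : ℝ) : vl σ (-t) = conj (vl σ t) := by
  simp [vl]

lemma conj_piece (hRH : RiemannHypothesis) {ε y η : ℝ} (hε : 0 < ε) (hε2 : ε ≤ 1 / 2) (hy : 1 ≤ y)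
    (hη : 0 < η) :
    ∫ t : ℝ, conj (xf (vl (1 / 2 + ε) t)) * Gk y η (vl (1 / 2 + ε) t) =
      xf ((2 * (1 / 2 + ε) : ℝ) : ℂ) * ∫ t : ℝ, Gk y η (vl (1 / 2 + ε) t) := by
  set σ : ℝ := 1 / 2 + ε with hσ
  set p : ℂ := ((2 * σ : ℝ) : ℂ) with hp
  obtain ⟨C, hC, hE⟩ := Ek_bound (σ := σ) hη (by linarith)
  have h1 : (y : ℂ) ≠ 0 := by exact_mod_cast (by linarith : y ≠ 0)
  have hpn : ‖p‖ = 2 * σ := by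
    rw [hp, Complex.norm_real, Real.norm_eq_abs, abs_of_pos (by linarith)]
  have h := dslope_vanish hRH hε (p := p) (N := fun s => (y:ℂ) ^ (p - s) * Ek η (p - s))
    (C := y ^ σ * (C * (1 + 2 * σ))) (by rw [hp, ofReal_re]; linarith)
    (fun s hs => by
      have d1 : DifferentiableAt ℂ (fun s : ℂ => (y : ℂ) ^ (p - s)) s :=
        DifferentiableAt.const_cpow (by fun_prop) (Or.inl h1)
      have d2 : DifferentiableAt ℂ (fun s : ℂ => Ek η (p - s)) s :=
        ((Ek_differentiable hη) _).comp s (f := fun s : ℂ => p - s) (by fun_prop)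
      exact d1.mul d2)
    (fun s hs => by
      have hre : (p - s).re ≤ σ := by rw [sub_re, hp, ofReal_re]; linarith
      have a1 := hE (p - s) hre
      have a2 : ‖(y:ℂ) ^ (p - s)‖ ≤ y ^ σ := by
        rw [Complex.norm_cpow_eq_rpow_re_of_pos (by linarith)]
        exact Real.rpow_le_rpow_of_exponent_le hy hre
      have a3 : C / (1 + ‖p - s‖) ≤ C * (1 + 2 * σ) / (1 + ‖s‖) := by
        rw [div_le_div_iff₀ (by positivity) (by positivity), mul_assoc]
        have a4 : ‖s‖ ≤ 2 * σ + ‖p - s‖ := by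
          have := norm_sub_le p (p - s)
          rw [hpn] at this; simpa using this
        have := norm_nonneg (p - s)
        gcongr
        nlinarith
      rw [norm_mul, mul_div_assoc]
      have : 0 ≤ C / (1 + ‖p - s‖) := by positivity
      exact mul_le_mul a2 (a1.trans a3) (norm_nonneg _) (by positivity)) (by positivity)
  rw [← hσ] at h
  have e : ∀ t : ℝ, dslope xf p (vl σ t) * ((y:ℂ) ^ (p - vl σ t) * Ek η (p - vl σ t)) =
      -(xf (vl σ t) * Gk y η (vl σ (-t)) - xf p * Gk y η (vl σ (-t))) := by
    intro t
    have hw : p - vl σ t = vl σ (-t) := by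
      rw [hp]; unfold vl; push_cast; ring
    have hne : vl σ t ≠ p := by
      intro h; have := congrArg re h
      rw [vl_re, hp, ofReal_re] at this; linarith
    have hw0 : vl σ (-t) ≠ 0 := by
      intro h; have := congrArg re h
      rw [vl_re, zero_re] at this; linarith
    have hw1 : vl σ (-t) ≠ -1 := by
      intro h; have := congrArg re h
      rw [vl_re, neg_re, one_re] at this; linarith
    rw [dslope_of_ne _ hne, slope_def_field, ← Ek_eq y hη hw1, ← neg_sub p, hw]
    field_simp
  simp_rw [e] at h
  obtain ⟨hc, C', hC', hb⟩ := Gk_line hy hη (σ := σ) (by linarith) (by linarith)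
  have hc' : Continuous fun t : ℝ => Gk y η (vl σ (-t)) := hc.comp continuous_neg
  have hb' : ∀ t : ℝ, ‖Gk y η (vl σ (-t))‖ ≤ C' / (1 + |t|) ^ 2 := fun t => by
    simpa using hb (-t)
  have i1 := xf_mul_integrable hRH hε hc' hb'
  have i2 := (k_integrable hc' hb').const_mul (xf p)
  rw [integral_neg, integral_sub i1 i2, neg_eq_zero, sub_eq_zero, integral_const_mul] at h
  rw [integral_neg_eq_self (fun t => Gk y η (vl σ t)) volume] at h
  rw [← h, ← integral_neg_eq_self _ volume]
  congr 1
  ext t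
  rw [vl_neg_conj, xf_conj, conj_conj]

end PsiRH

namespace PsiRH
open Complex Filter Topology MeasureTheory
local notation "conj" => starRingEnd ℂ

lemma ss_line {σ : ℝ} (hσ : 0 < σ) :
    Continuous (fun t : ℝ => 1 / (vl σ t * (vl σ t + 1))) ∧
    ∀ t : ℝ, ‖1 / (vl σ t * (vl σ t + 1))‖ ≤ ((1 + σ) / σ) ^ 2 / (1 + |t|) ^ 2 := by
  have h0 : ∀ t : ℝ, vl σ t ≠ 0 := fun t h => by
    have := congrArg re h; rw [vl_re, zero_re] at this; linarith
  have h1 : ∀ t : ℝ, vl σ t + 1 ≠ 0 := fun t h => by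
    have := congrArg re h; rw [add_re, one_re, vl_re, zero_re] at this; linarith
  constructor
  · have hc := vl_continuous σ
    exact continuous_const.div (hc.mul (hc.add continuous_const))
      (fun t => mul_ne_zero (h0 t) (h1 t))
  · intro t
    have a1 : σ ≤ ‖vl σ t‖ := by
      have := Complex.abs_re_le_norm (vl σ t); rw [vl_re, abs_of_pos hσ] at this; exact this
    have a2 : |t| ≤ ‖vl σ t‖ := by
      have := Complex.abs_im_le_norm (vl σ t); rw [vl_im] at this; exact this
    have a3 : σ ≤ ‖vl σ t + 1‖ := by
      have := Complex.abs_re_le_norm (vl σ t + 1)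
      rw [add_re, one_re, vl_re, abs_of_pos (by linarith)] at this; linarith
    have a4 : |t| ≤ ‖vl σ t + 1‖ := by
      have := Complex.abs_im_le_norm (vl σ t + 1)
      rw [add_im, one_im, vl_im, add_zero] at this; exact this
    have k1 : ∀ r : ℝ, σ ≤ r → |t| ≤ r → σ / (1 + σ) * (1 + |t|) ≤ r := by
      intro r hr1 hr2
      rw [div_mul_eq_mul_div, div_le_iff₀ (by linarith)]
      nlinarith
    rw [norm_div, norm_one, norm_mul, ← div_pow, div_le_iff₀ (by
      have := norm_pos_iff.2 (h0 t); have := norm_pos_iff.2 (h1 t); positivity)]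
    have b1 := k1 _ a1 a2
    have b2 := k1 _ a3 a4
    have b3 := mul_le_mul b1 b2 (by positivity) (norm_nonneg _)
    have e : ((1 + σ) / σ / (1 + |t|)) ^ 2 * (σ / (1 + σ) * (1 + |t|) * (σ / (1 + σ) * (1 + |t|))) = 1 := by
      have : (1 + |t|) ≠ 0 := by positivity
      field_simp
    calc (1:ℝ) = _ := e.symm
      _ ≤ _ := by gcongr

noncomputable def hg (x : ℝ) : ℝ := max (1 - x) 0

lemma hg_continuous : Continuous hg := by unfold hg; fun_prop

lemma hg_mellin {s : ℂ} (hs : 0 < s.re) : HasMellin (fun x => (hg x : ℂ)) s (1 / (s * (s + 1))) := by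
  have h1 := hasMellin_one_Ioc hs
  have h2 := hasMellin_cpow_Ioc 1 (s := s) (by rw [one_re]; linarith)
  have h3 := hasMellin_sub h1.1 h2.1
  rw [h1.2, h2.2] at h3
  have e : Set.EqOn (fun x : ℝ => (x:ℂ) ^ (s - 1) • (hg x : ℂ)) (fun x : ℝ => (x:ℂ) ^ (s - 1) •
    ((Set.Ioc (0:ℝ) 1).indicator (fun _ => (1:ℂ)) x - (Set.Ioc (0:ℝ) 1).indicator (fun t : ℝ => (t:ℂ) ^ (1:ℂ)) x)) (Set.Ioi 0) := by
    intro x hx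
    simp only [smul_eq_mul]
    congr 1
    unfold hg
    by_cases h : x ≤ 1
    · have : x ∈ Set.Ioc (0:ℝ) 1 := ⟨hx, h⟩
      rw [Set.indicator_of_mem this, Set.indicator_of_mem this, max_eq_left (by linarith), cpow_one]
      push_cast; rfl
    · have : x ∉ Set.Ioc (0:ℝ) 1 := fun h' => h h'.2
      rw [Set.indicator_of_notMem this, Set.indicator_of_notMem this, max_eq_right (by linarith)]
      simp
  have hs0 : s ≠ 0 := by rintro rfl; simp at hs
  have hs1 : s + 1 ≠ 0 := fun h => by
    have := congrArg re h; rw [add_re, one_re, zero_re] at this; linarith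
  refine ⟨?_, ?_⟩
  · unfold MellinConvergent
    rw [integrableOn_congr_fun e measurableSet_Ioi]
    exact h3.1
  · unfold mellin
    rw [setIntegral_congr_fun measurableSet_Ioi e]
    refine h3.2.trans ?_
    field_simp
    ring

lemma perron_h {σ x : ℝ} (hσ : 0 < σ) (hx : 0 < x) :
    ∫ t : ℝ, (x:ℂ) ^ (-(vl σ t)) * (1 / (vl σ t * (vl σ t + 1))) = 2 * π * hg x := by
  have hm : ∀ t : ℝ, mellin (fun x => (hg x : ℂ)) (vl σ t) = 1 / (vl σ t * (vl σ t + 1)) :=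
    fun t => (hg_mellin (by rw [vl_re]; exact hσ)).2
  have h := mellinInv_mellin_eq σ (fun x => (hg x : ℂ)) hx (hg_mellin (by rw [ofReal_re]; exact hσ)).1
    (by
      unfold VerticalIntegrable
      have := k_integrable (ss_line hσ).1 (ss_line hσ).2
      refine this.congr (Eventually.of_forall fun t => (hm t).symm))
    (by have := hg_continuous; fun_prop)
  unfold mellinInv at h
  rw [← h]
  have : ∀ t : ℝ, (x : ℂ) ^ (-((σ:ℂ) + t * I)) • mellin (fun x => (hg x : ℂ)) ((σ:ℂ) + t * I) =
    (x:ℂ) ^ (-(vl σ t)) * (1 / (vl σ t * (vl σ t + 1))) := fun t => by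
    rw [← hm t]; rfl
  simp_rw [this]
  have hp : (π : ℂ) ≠ 0 := by exact_mod_cast pi_ne_zero
  have e2 : (2 * π : ℂ) * ((1 / (2 * π) : ℝ) : ℂ) = 1 := by
    push_cast; field_simp
  rw [real_smul, ← mul_assoc, e2, one_mul]

noncomputable def ph (η v : ℝ) : ℝ := ((1 + η) * hg (v / (1 + η)) - hg v) / η

lemma ph_continuous (η : ℝ) : Continuous (ph η) := by
  unfold ph; have := hg_continuous; fun_prop

lemma ph_one {η v : ℝ} (hη : 0 < η) (hv : v ≤ 1) : ph η v = 1 := by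
  unfold ph hg
  have : v / (1 + η) ≤ 1 := by rw [div_le_one (by linarith)]; linarith
  rw [max_eq_left (by linarith), max_eq_left (by linarith)]
  field_simp
  ring

lemma ph_zero {η v : ℝ} (hη : 0 < η) (hv : 1 + η ≤ v) : ph η v = 0 := by
  unfold ph hg
  have : 1 ≤ v / (1 + η) := by rw [le_div_iff₀ (by linarith)]; linarith
  rw [max_eq_right (by linarith), max_eq_right (by linarith)]
  simp

lemma ph_mem {η v : ℝ} (hη : 0 < η) : 0 ≤ ph η v ∧ ph η v ≤ 1 := by
  by_cases h1 : v ≤ 1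
  · rw [ph_one hη h1]; norm_num
  by_cases h2 : 1 + η ≤ v
  · rw [ph_zero hη h2]; norm_num
  unfold ph hg
  push Not at h1 h2
  have : v / (1 + η) ≤ 1 := by rw [div_le_one (by linarith)]; linarith
  rw [max_eq_left (by linarith), max_eq_right (by linarith)]
  have e : (1 + η) * (1 - v / (1 + η)) = 1 + η - v := by field_simp
  rw [e, sub_zero]
  exact ⟨div_nonneg (by linarith) hη.le, by rw [div_le_one hη]; linarith⟩

lemma perron_int {σ x : ℝ} (hσ : 0 < σ) (hx : 0 < x) :
    Integrable fun t : ℝ => (x:ℂ) ^ (-(vl σ t)) * (1 / (vl σ t * (vl σ t + 1))) := by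
  have hx0 : (x:ℂ) ≠ 0 := by exact_mod_cast hx.ne'
  have hc := (ss_line hσ).1
  refine k_integrable (C := x ^ (-σ) * ((1 + σ) / σ) ^ 2) ?_ ?_
  · refine Continuous.mul ?_ hc
    exact (vl_continuous σ).neg.const_cpow (Or.inl hx0)
  · intro t
    rw [norm_mul, Complex.norm_cpow_eq_rpow_re_of_pos hx, neg_re, vl_re, mul_div_assoc]
    gcongr
    exact (ss_line hσ).2 t

lemma Gk_split {y η q : ℝ} (hy : 0 < y) (hη : 0 < η) (hq : 0 < q) (s : ℂ) :
    (q:ℂ) ^ (-s) * Gk y η s = ((1 + η) / η : ℂ) * (((q / y / (1 + η) : ℝ):ℂ) ^ (-s) * (1 / (s * (s + 1))))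
      - (1 / η : ℂ) * (((q / y : ℝ):ℂ) ^ (-s) * (1 / (s * (s + 1)))) := by
  unfold Gk
  have e1 : ((q / y : ℝ):ℂ) ^ (-s) = (q:ℂ) ^ (-s) * (y:ℂ) ^ s := by
    rw [ofReal_div, Complex.div_cpow_ofReal_nonneg hq.le hy.le, cpow_neg (y:ℂ), div_inv_eq_mul]
  have e2 : ((q / y / (1 + η) : ℝ):ℂ) ^ (-s) = (q:ℂ) ^ (-s) * (y:ℂ) ^ s * ((1 + η : ℝ):ℂ) ^ s := by
    rw [ofReal_div, Complex.div_cpow_ofReal_nonneg (by positivity) (by positivity), e1, cpow_neg ((1 + η : ℝ):ℂ), div_inv_eq_mul]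
  have h0 : ((1 + η : ℝ):ℂ) ≠ 0 := by exact_mod_cast (by positivity)
  rw [e1, e2, cpow_add _ _ h0, cpow_one]
  have hη0 : (η:ℂ) ≠ 0 := by exact_mod_cast hη.ne'
  rw [mul_assoc (η:ℂ)]
  by_cases hs : s * (s + 1) = 0
  · rw [hs]; simp
  · push_cast
    field_simp

lemma perron_G {σ y η q : ℝ} (hσ : 0 < σ) (hy : 0 < y) (hη : 0 < η) (hq : 0 < q) :
    Integrable (fun t : ℝ => (q:ℂ) ^ (-(vl σ t)) * Gk y η (vl σ t)) ∧
    ∫ t : ℝ, (q:ℂ) ^ (-(vl σ t)) * Gk y η (vl σ t) = 2 * π * ph η (q / y) := by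
  simp_rw [Gk_split hy hη hq]
  have i1 := (perron_int hσ (x := q / y / (1 + η)) (by positivity)).const_mul ((1 + η) / η : ℂ)
  have i2 := (perron_int hσ (x := q / y) (by positivity)).const_mul (1 / η : ℂ)
  refine ⟨i1.sub i2, ?_⟩
  rw [integral_sub i1 i2, integral_const_mul, integral_const_mul, perron_h hσ (by positivity),
    perron_h hσ (by positivity)]
  unfold ph
  push_cast
  ring

end PsiRH

namespace PsiRH
open Complex Filter Topology MeasureTheory
local notation "conj" => starRingEnd ℂ

lemma vla_ne {σ a : ℝ} (h : 0 < σ + a) (t : ℝ) : vl σ t + a ≠ 0 := fun h' => by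
  have := congrArg re h'; rw [add_re, vl_re, zero_re, ofReal_re] at this; linarith

lemma vla_bound {σ a : ℝ} (h : 0 < σ + a) (t : ℝ) : ‖1 / (vl σ t + a)‖ ≤ 1 / (σ + a) := by
  rw [norm_div, norm_one]
  gcongr
  have := Complex.abs_re_le_norm (vl σ t + a)
  rw [add_re, vl_re, ofReal_re, abs_of_pos h] at this; exact this

lemma inv_int {y η a : ℝ} (hy : 1 ≤ y) (hη : 0 < η) (ha : 0 < 2 + a) :
    Integrable fun t : ℝ => 1 / (vl 2 t + a) * Gk y η (vl 2 t) := by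
  obtain ⟨hc, C, hC, hb⟩ := Gk_line hy hη (σ := 2) (by norm_num) le_rfl
  refine k_integrable (C := 1 / (2 + a) * C) ?_ ?_
  · exact (continuous_const.div ((vl_continuous 2).add continuous_const) (vla_ne ha)).mul hc
  · intro t
    rw [norm_mul, mul_div_assoc]
    exact mul_le_mul (vla_bound ha t) (hb t) (norm_nonneg _) (by positivity)

lemma Gk_int {y η : ℝ} (hy : 1 ≤ y) (hη : 0 < η) : Integrable fun t : ℝ => Gk y η (vl 2 t) := by
  obtain ⟨hc, C, hC, hb⟩ := Gk_line hy hη (σ := 2) (by norm_num) le_rfl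
  exact k_integrable hc hb

lemma Gk_total {σ y η : ℝ} (hσ : 0 < σ) (hy : 1 ≤ y) (hη : 0 < η) :
    ∫ t : ℝ, Gk y η (vl σ t) = 2 * π := by
  have h := (perron_G hσ (y := y) (by linarith) hη one_pos).2
  rw [ph_one hη (by rw [div_le_one (by linarith)]; exact hy)] at h
  simpa using h

noncomputable def JJ (y η a : ℝ) : ℝ := ∫ v in Set.Ioi (1:ℝ), ph η (v / y) * v ^ (-(a + 1))

lemma fub {y η a : ℝ} (hy : 1 ≤ y) (hη : 0 < η) (ha : 0 < 2 + a) :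
    ∫ t : ℝ, 1 / (vl 2 t + a) * Gk y η (vl 2 t) = 2 * π * (JJ y η a : ℂ) := by
  have e1 : ∀ t : ℝ, 1 / (vl 2 t + a) * Gk y η (vl 2 t) =
      ∫ v in Set.Ioi (1:ℝ), ((v ^ (-(a + 1)) : ℝ) : ℂ) * ((v:ℂ) ^ (-(vl 2 t)) * Gk y η (vl 2 t)) := by
    intro t
    have h1 := integral_Ioi_cpow_of_lt (a := -(vl 2 t) - (a + 1)) (by
      rw [sub_re, neg_re, vl_re, add_re, one_re, ofReal_re]; linarith) (c := 1) one_pos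
    rw [ofReal_one, one_cpow] at h1
    have h2 : ∫ v in Set.Ioi (1:ℝ), ((v ^ (-(a + 1)) : ℝ) : ℂ) * ((v:ℂ) ^ (-(vl 2 t)) * Gk y η (vl 2 t))
       = ∫ v in Set.Ioi (1:ℝ), (v:ℂ) ^ (-(vl 2 t) - (a + 1)) * Gk y η (vl 2 t) := by
      refine setIntegral_congr_fun measurableSet_Ioi fun v hv => ?_
      have hv0 : (0:ℝ) < v := lt_trans one_pos hv
      have hv1 : (v:ℂ) ≠ 0 := by exact_mod_cast hv0.ne'
      rw [sub_eq_add_neg, cpow_add _ _ hv1, ofReal_cpow hv0.le]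
      push_cast
      ring
    rw [h2, integral_mul_const, h1]
    congr 1
    have := vla_ne ha t
    rw [show -(vl 2 t) - ((a:ℂ) + 1) + 1 = -(vl 2 t + a) by ring, neg_div_neg_eq]
  simp_rw [e1]
  rw [integral_integral_swap]
  · have e2 : ∫ v in Set.Ioi (1:ℝ), ∫ t : ℝ, ((v ^ (-(a + 1)) : ℝ) : ℂ) * ((v:ℂ) ^ (-(vl 2 t)) * Gk y η (vl 2 t)) =
       ∫ v in Set.Ioi (1:ℝ), (2 * π : ℂ) * ((ph η (v / y) * v ^ (-(a + 1)) : ℝ) : ℂ) := by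
      refine setIntegral_congr_fun measurableSet_Ioi fun v hv => ?_
      have hv0 : (0:ℝ) < v := lt_trans one_pos hv
      rw [integral_const_mul, (perron_G (σ := 2) two_pos (by linarith) hη hv0).2]
      push_cast
      ring
    rw [e2, integral_const_mul, integral_complex_ofReal]
    rfl
  · have hg : IntegrableOn (fun v : ℝ => v ^ (-(2 + a + 1))) (Set.Ioi 1) :=
      integrableOn_Ioi_rpow_of_lt (by linarith) one_pos
    have hp := (Gk_int hy hη).norm.mul_prod hg
    refine hp.mono' ?_ ?_
    · refine Measurable.aestronglyMeasurable ?_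
      have m1 : Measurable fun p : ℝ × ℝ => Gk y η (vl 2 p.1) := by
        have := (Gk_line hy hη (σ := 2) (by norm_num) le_rfl).1
        exact this.measurable.comp measurable_fst
      have m2 : Measurable fun p : ℝ × ℝ => (p.2 : ℂ) ^ (-(vl 2 p.1)) := by
        have : Measurable fun p : ℝ × ℝ => vl 2 p.1 :=
          (vl_continuous 2).measurable.comp measurable_fst
        exact (Complex.measurable_ofReal.comp measurable_snd).pow this.neg
      have m3 : Measurable fun p : ℝ × ℝ => ((p.2 ^ (-(a + 1)) : ℝ) : ℂ) :=
        Complex.measurable_ofReal.comp (measurable_snd.pow_const _)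
      exact m3.mul (m2.mul m1)
    · have h1 : ∀ᵐ v ∂(volume.restrict (Set.Ioi (1:ℝ))), v ∈ Set.Ioi (1:ℝ) :=
        ae_restrict_mem measurableSet_Ioi
      have h2 := (Measure.quasiMeasurePreserving_snd (μ := (volume : Measure ℝ))
        (ν := volume.restrict (Set.Ioi (1:ℝ)))).ae h1
      filter_upwards [h2] with p hp
      have hv0 : (0:ℝ) < p.2 := lt_trans one_pos hp
      simp only [Function.uncurry]
      rw [norm_mul, norm_mul, Complex.norm_cpow_eq_rpow_re_of_pos hv0, neg_re, vl_re,
        Complex.norm_real, Real.norm_eq_abs, abs_of_nonneg (by positivity), ← mul_assoc,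
        ← Real.rpow_add hv0, mul_comm]
      apply le_of_eq
      ring_nf

lemma ph_rpow_int {y η a : ℝ} (hη : 0 < η) (ha : 0 < a) :
    IntegrableOn (fun v : ℝ => ph η (v / y) * v ^ (-(a + 1))) (Set.Ioi 1) := by
  have h := integrableOn_Ioi_rpow_of_lt (a := -(a + 1)) (c := 1) (by linarith) one_pos
  refine Integrable.bdd_mul (c := 1) h ?_ ?_
  · exact ((ph_continuous η).comp (continuous_id.div_const y)).aestronglyMeasurable
  · refine Eventually.of_forall fun v => ?_
    have := ph_mem (v := v / y) hη
    rw [Real.norm_eq_abs, abs_of_nonneg this.1]; exact this.2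

lemma JJ_bound {y η a : ℝ} (hy : 1 ≤ y) (hη : 0 < η) (ha : 0 < a) :
    0 ≤ 1 / a - JJ y η a ∧ 1 / a - JJ y η a ≤ y ^ (-a) / a := by
  have h := integrableOn_Ioi_rpow_of_lt (a := -(a + 1)) (c := 1) (by linarith) one_pos
  have h1 : ∫ v in Set.Ioi (1:ℝ), v ^ (-(a + 1)) = 1 / a := by
    rw [integral_Ioi_rpow_of_lt (by linarith) one_pos, Real.one_rpow]
    rw [show -(a + 1) + 1 = -a by ring, neg_div_neg_eq]
  have h2 : ∫ v in Set.Ioi y, v ^ (-(a + 1)) = y ^ (-a) / a := by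
    rw [integral_Ioi_rpow_of_lt (by linarith) (by linarith)]
    rw [show -(a + 1) + 1 = -a by ring, neg_div_neg_eq]
  have e : 1 / a - JJ y η a = ∫ v in Set.Ioi (1:ℝ), (v ^ (-(a + 1)) - ph η (v / y) * v ^ (-(a + 1))) := by
    rw [integral_sub h (ph_rpow_int hη ha), h1]; rfl
  rw [e]
  constructor
  · refine setIntegral_nonneg measurableSet_Ioi fun v hv => ?_
    have hv0 : (0:ℝ) < v := lt_trans one_pos hv
    have := ph_mem (v := v / y) hη
    have h3 : 0 ≤ v ^ (-(a + 1)) := by positivity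
    nlinarith
  · rw [← h2]
    have e2 : ∫ v in Set.Ioi y, v ^ (-(a + 1)) =
        ∫ v in Set.Ioi (1:ℝ), (Set.Ioi y).indicator (fun v => v ^ (-(a + 1))) v := by
      rw [integral_indicator measurableSet_Ioi, Measure.restrict_restrict measurableSet_Ioi,
        Set.inter_eq_left.2 (Set.Ioi_subset_Ioi hy)]
    rw [e2]
    refine setIntegral_mono_on (h.sub (ph_rpow_int hη ha)) ?_ measurableSet_Ioi fun v hv => ?_
    · exact Integrable.indicator h measurableSet_Ioi
    have hv0 : (0:ℝ) < v := lt_trans one_pos hv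
    have hm := ph_mem (v := v / y) hη
    have h3 : 0 ≤ v ^ (-(a + 1)) := by positivity
    by_cases hvy : y < v
    · rw [Set.indicator_of_mem (show v ∈ Set.Ioi y from hvy)]
      nlinarith
    · rw [Set.indicator_of_notMem (show v ∉ Set.Ioi y from hvy), ph_one hη (by rw [div_le_one (by linarith)]; linarith)]
      linarith

lemma hg_tail {X : ℝ} (hX : 1 ≤ X) :
    IntegrableOn (fun v => hg (v / X)) (Set.Ioi 1) ∧
    ∫ v in Set.Ioi (1:ℝ), hg (v / X) = X / 2 - 1 + 1 / (2 * X) := by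
  have hX0 : 0 < X := by linarith
  have e : ∀ v ∈ Set.Ioi (1:ℝ), hg (v / X) = (Set.Ioc 1 X).indicator (fun v => 1 - v / X) v := by
    intro v hv
    unfold hg
    by_cases h : v ≤ X
    · rw [Set.indicator_of_mem (show v ∈ Set.Ioc 1 X from ⟨hv, h⟩), max_eq_left]
      have : v / X ≤ 1 := by rw [div_le_one hX0]; exact h
      linarith
    · rw [Set.indicator_of_notMem (fun h' => h h'.2), max_eq_right]
      have : 1 ≤ v / X := by rw [one_le_div hX0]; linarith
      linarith
  have hc : Continuous fun v : ℝ => 1 - v / X := by fun_prop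
  constructor
  · rw [integrableOn_congr_fun e measurableSet_Ioi]
    refine Integrable.integrableOn ?_
    rw [integrable_indicator_iff measurableSet_Ioc]
    exact (hc.integrableOn_Icc).mono_set Set.Ioc_subset_Icc_self
  · rw [setIntegral_congr_fun measurableSet_Ioi e, integral_indicator measurableSet_Ioc,
      Measure.restrict_restrict measurableSet_Ioc, Set.inter_eq_left.2 Set.Ioc_subset_Ioi_self,
      ← intervalIntegral.integral_of_le hX]
    rw [intervalIntegral.integral_sub (by simp) (Continuous.intervalIntegrable (by fun_prop) _ _),
      intervalIntegral.integral_div]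
    simp
    field_simp
    ring

lemma JJ_neg_one {y η : ℝ} (hy : 1 ≤ y) (hη : 0 < η) : JJ y η (-1) = y * (1 + η / 2) - 1 := by
  unfold JJ
  have hX : 1 ≤ y * (1 + η) := by nlinarith
  obtain ⟨i1, h1⟩ := hg_tail hX
  obtain ⟨i2, h2⟩ := hg_tail hy
  have e : ∀ v : ℝ, ph η (v / y) * v ^ (-((-1:ℝ) + 1)) =
      (1 + η) / η * hg (v / (y * (1 + η))) - 1 / η * hg (v / y) := by
    intro v
    unfold ph
    rw [div_div]
    simp
    ring
  simp_rw [e]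
  rw [integral_sub (i1.const_mul _) (i2.const_mul _), integral_const_mul, integral_const_mul, h1, h2]
  field_simp
  ring

end PsiRH

namespace PsiRH
open Complex Filter Topology MeasureTheory
local notation "conj" => starRingEnd ℂ

lemma ls_int (hRH : RiemannHypothesis) {y η : ℝ} (hy : 1 ≤ y) (hη : 0 < η) :
    Integrable fun t : ℝ => LSeries Lam (vl 2 t) * Gk y η (vl 2 t) := by
  obtain ⟨hc, C, hC, hb⟩ := Gk_line hy hη (σ := 2) (by norm_num) le_rfl
  set B := ∑' n, ‖LSeries.term Lam 2 n‖
  have hB : 0 ≤ B := tsum_nonneg fun n => norm_nonneg _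
  have hcL : Continuous fun t : ℝ => LSeries Lam (vl 2 t) := by
    have e : ∀ t : ℝ, LSeries Lam (vl 2 t) = 1 / (vl 2 t + (-1:ℝ)) - Real.log π / 2
        + dgS (vl 2 t / 2) / 2 - xf (vl 2 t) := by
      intro t
      rw [xf_formula (s := vl 2 t) (by rw [vl_re]; norm_num)]
      push_cast
      ring
    simp_rw [e]
    have c1 : Continuous fun t : ℝ => 1 / (vl 2 t + (-1:ℝ)) :=
      continuous_const.div ((vl_continuous 2).add continuous_const) (vla_ne (by norm_num))
    have c2 : Continuous fun t : ℝ => dgS (vl 2 t / 2) := by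
      rw [continuous_iff_continuousAt]
      intro t
      have h1 : 0 < (vl 2 t / 2).re := by simp
      exact ContinuousAt.comp (f := fun t : ℝ => vl 2 t / 2) (dgS_differentiableAt h1).continuousAt
        ((vl_continuous 2).div_const 2).continuousAt
    exact ((c1.sub continuous_const).add (c2.div_const 2)).sub (xf_vl_continuous hRH (by norm_num))
  refine k_integrable (C := B * C) (hcL.mul hc) fun t => ?_
  rw [norm_mul, mul_div_assoc]
  exact mul_le_mul (lseries_bound (by rw [vl_re])) (hb t) (norm_nonneg _) hB

lemma ls_sum {y η : ℝ} (hy : 1 ≤ y) (hη : 0 < η) :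
    ∃ S : ℝ, HasSum (fun n : ℕ => ArithmeticFunction.vonMangoldt n * ph η (n / y)) S ∧
    ∫ t : ℝ, LSeries Lam (vl 2 t) * Gk y η (vl 2 t) = 2 * π * (S : ℂ) := by
  have hG := Gk_int hy hη
  have hF : ∀ n : ℕ, ∀ t : ℝ, LSeries.term Lam (vl 2 t) n * Gk y η (vl 2 t) =
      (ArithmeticFunction.vonMangoldt n : ℂ) * ((((n:ℝ):ℂ) ^ (-(vl 2 t))) * Gk y η (vl 2 t)) := by
    intro n t
    rw [LSeries.term_def]
    by_cases hn : n = 0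
    · simp [hn]
    · rw [if_neg hn, cpow_neg, ofReal_natCast]
      ring
  have hI : ∀ n : ℕ, Integrable (fun t : ℝ => LSeries.term Lam (vl 2 t) n * Gk y η (vl 2 t)) ∧
     ∫ t : ℝ, LSeries.term Lam (vl 2 t) n * Gk y η (vl 2 t) =
      2 * π * ((ArithmeticFunction.vonMangoldt n * ph η (n / y) : ℝ) : ℂ) := by
    intro n
    by_cases hn : n = 0
    · subst hn; simp
    · have hn' : (0:ℝ) < n := by exact_mod_cast Nat.pos_of_ne_zero hn
      obtain ⟨a, b⟩ := perron_G (σ := 2) two_pos (y := y) (by linarith) hη hn'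
      simp_rw [hF]
      refine ⟨a.const_mul _, ?_⟩
      rw [integral_const_mul, b]
      push_cast
      ring
  have hs := hasSum_integral_of_summable_integral_norm (F := fun (n:ℕ) (t:ℝ) =>
      LSeries.term Lam (vl 2 t) n * Gk y η (vl 2 t)) (fun n => (hI n).1) (by
    have : ∀ n : ℕ, ∫ t : ℝ, ‖LSeries.term Lam (vl 2 t) n * Gk y η (vl 2 t)‖ =
        ‖LSeries.term Lam 2 n‖ * ∫ t : ℝ, ‖Gk y η (vl 2 t)‖ := by
      intro n
      rw [← integral_const_mul]
      congr 1
      ext t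
      rw [norm_mul, LSeries.norm_term_eq, LSeries.norm_term_eq, vl_re]
      simp
    simp_rw [this]
    exact ((ArithmeticFunction.LSeriesSummable_vonMangoldt (s := 2) (by norm_num)).norm).mul_right _)
  simp_rw [tsum_mul_right] at hs
  have hs2 : HasSum (fun n : ℕ => 2 * π * ((ArithmeticFunction.vonMangoldt n * ph η (n / y) : ℝ) : ℂ))
      (∫ t : ℝ, LSeries Lam (vl 2 t) * Gk y η (vl 2 t)) := by
    refine hs.congr_fun ?_ |> fun h => h
    intro n
    exact ((hI n).2).symm
  have hp : (2 * π : ℂ) ≠ 0 := by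
    have : (π : ℂ) ≠ 0 := by exact_mod_cast pi_ne_zero
    simp [this]
  have hs3 := hs2.mul_left ((2 * π : ℂ)⁻¹)
  simp_rw [inv_mul_cancel_left₀ hp] at hs3
  have hsum : Summable fun n : ℕ => ArithmeticFunction.vonMangoldt n * ph η (n / y) := by
    have := hs3.summable
    exact_mod_cast this
  refine ⟨_, hsum.hasSum, ?_⟩
  have hu := hs3.unique (Complex.hasSum_ofReal.2 hsum.hasSum)
  rw [← hu, mul_inv_cancel_left₀ hp]

lemma dg_sum {y η : ℝ} (hy : 2 ≤ y) (hη : 0 < η) :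
    ∃ T : ℝ, 0 ≤ T ∧ T ≤ 1 ∧
    ∫ t : ℝ, (∑' n, dgt (vl 2 t / 2) n) * Gk y η (vl 2 t) = 2 * π * (T : ℂ) := by
  have hy1 : 1 ≤ y := by linarith
  have hG := Gk_int hy1 hη
  obtain ⟨hc, C, hC, hb⟩ := Gk_line hy1 hη (σ := 2) (by norm_num) le_rfl
  have hF : ∀ n : ℕ, ∀ t : ℝ, dgt (vl 2 t / 2) n * Gk y η (vl 2 t) =
      (1 / ((n:ℂ) + 1)) * Gk y η (vl 2 t) - 2 * (1 / (vl 2 t + ((2 * (n + 1) : ℝ):ℂ)) * Gk y η (vl 2 t)) := by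
    intro n t
    unfold dgt
    have h1 := vla_ne (σ := 2) (a := 2 * (n + 1)) (by positivity) t
    have h2 : (n:ℂ) + 1 + vl 2 t / 2 ≠ 0 := by
      intro h; apply h1; push_cast; linear_combination 2 * h
    have : 1 / ((n:ℂ) + 1 + vl 2 t / 2) = 2 * (1 / (vl 2 t + ((2 * (n + 1) : ℝ):ℂ))) := by
      rw [eq_comm, mul_one_div, div_eq_div_iff h1 h2]; push_cast; ring
    rw [this]; ring
  have hI : ∀ n : ℕ, Integrable (fun t : ℝ => dgt (vl 2 t / 2) n * Gk y η (vl 2 t)) ∧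
     ∫ t : ℝ, dgt (vl 2 t / 2) n * Gk y η (vl 2 t) =
      2 * π * ((2 * (1 / (2 * ((n:ℝ) + 1)) - JJ y η (2 * (n + 1))) : ℝ) : ℂ) := by
    intro n
    simp_rw [hF]
    have i1 := hG.const_mul (1 / ((n:ℂ) + 1))
    have i2 := (inv_int hy1 hη (a := 2 * (n + 1)) (by positivity)).const_mul 2
    refine ⟨i1.sub i2, ?_⟩
    rw [integral_sub i1 i2, integral_const_mul, integral_const_mul, fub hy1 hη (by positivity),
      Gk_total two_pos hy1 hη]
    have : (n:ℂ) + 1 ≠ 0 := by exact_mod_cast (by positivity : (n:ℝ) + 1 ≠ 0)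
    push_cast
    field_simp
  have hs := hasSum_integral_of_summable_integral_norm (F := fun (n:ℕ) (t:ℝ) =>
      dgt (vl 2 t / 2) n * Gk y η (vl 2 t)) (fun n => (hI n).1) (by
    have hb2 : ∀ n : ℕ, ∫ t : ℝ, ‖dgt (vl 2 t / 2) n * Gk y η (vl 2 t)‖ ≤
        (((n : ℝ) + 1) ^ (3 / 2 : ℝ))⁻¹ * ∫ t : ℝ, C * Dc |t| := by
      intro n
      rw [← integral_const_mul]
      refine integral_mono (hI n).1.norm ((Dc_integrable.const_mul C).const_mul _) fun t => ?_
      simp only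
      rw [norm_mul, Dc_eq (abs_nonneg t)]
      have h1 := norm_dgt_le (s := vl 2 t / 2) (by simp) n
      have h2 : Real.sqrt ‖vl 2 t / 2‖ ≤ Real.sqrt (1 + |t|) := by
        apply Real.sqrt_le_sqrt
        rw [norm_div, Complex.norm_ofNat, div_le_iff₀ (by norm_num)]
        have := norm_vl_le (σ := 2) (t := t) (by norm_num)
        have := abs_nonneg t
        linarith
      calc _ ≤ (Real.sqrt (1 + |t|) * (((n : ℝ) + 1) ^ (3 / 2 : ℝ))⁻¹) * (C / (1 + |t|) ^ 2) := by
            refine mul_le_mul (h1.trans ?_) (hb t) (norm_nonneg _) (by positivity)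
            gcongr
        _ = _ := by ring
    exact Summable.of_nonneg_of_le (fun n => integral_nonneg fun t => norm_nonneg _) hb2
      (summable_dgb.mul_right _))
  simp_rw [tsum_mul_right] at hs
  have hp : (2 * π : ℂ) ≠ 0 := by
    have : (π : ℂ) ≠ 0 := by exact_mod_cast pi_ne_zero
    simp [this]
  have hs2 : HasSum (fun n : ℕ => 2 * π * ((2 * (1 / (2 * ((n:ℝ) + 1)) - JJ y η (2 * (n + 1))) : ℝ) : ℂ))
      (∫ t : ℝ, (∑' n, dgt (vl 2 t / 2) n) * Gk y η (vl 2 t)) := by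
    refine hs.congr_fun ?_ |> fun h => h
    intro n
    exact ((hI n).2).symm
  have hs3 := hs2.mul_left ((2 * π : ℂ)⁻¹)
  simp_rw [inv_mul_cancel_left₀ hp] at hs3
  have hsum : Summable fun n : ℕ => 2 * (1 / (2 * ((n:ℝ) + 1)) - JJ y η (2 * (n + 1))) :=
    Complex.summable_ofReal.1 hs3.summable
  have hbd : ∀ n : ℕ, 0 ≤ 2 * (1 / (2 * ((n:ℝ) + 1)) - JJ y η (2 * (n + 1))) ∧
      2 * (1 / (2 * ((n:ℝ) + 1)) - JJ y η (2 * (n + 1))) ≤ (1 / 2) ^ (n + 1) := by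
    intro n
    obtain ⟨a, b⟩ := JJ_bound hy1 hη (a := 2 * ((n:ℝ) + 1)) (by positivity)
    refine ⟨by linarith, ?_⟩
    have h1 : y ^ (-(2 * ((n:ℝ) + 1))) ≤ (1 / 2) ^ (n + 1) := by
      rw [Real.rpow_neg (by linarith), one_div, inv_pow]
      gcongr
      calc (2:ℝ) ^ (n + 1) ≤ y ^ (n + 1) := by gcongr
        _ = y ^ (((n + 1 : ℕ)) : ℝ) := (Real.rpow_natCast _ _).symm
        _ ≤ _ := by
          apply Real.rpow_le_rpow_of_exponent_le hy1
          push_cast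
          have : (0:ℝ) ≤ n := by positivity
          linarith
    have h2 : 2 * (y ^ (-(2 * ((n:ℝ) + 1))) / (2 * ((n:ℝ) + 1))) ≤ y ^ (-(2 * ((n:ℝ) + 1))) := by
      have h3 : 0 ≤ y ^ (-(2 * ((n:ℝ) + 1))) := by positivity
      have : 2 * (y ^ (-(2 * ((n:ℝ) + 1))) / (2 * ((n:ℝ) + 1))) = y ^ (-(2 * ((n:ℝ) + 1))) / ((n:ℝ) + 1) := by
        field_simp
      rw [this]
      apply div_le_self h3
      have : (0:ℝ) ≤ n := by positivity
      linarith
    linarith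
  refine ⟨∑' n : ℕ, 2 * (1 / (2 * ((n:ℝ) + 1)) - JJ y η (2 * (n + 1))), tsum_nonneg fun n => (hbd n).1, ?_, ?_⟩
  · have hg : HasSum (fun n : ℕ => (1 / 2 : ℝ) ^ (n + 1)) 1 := by
      have := (hasSum_geometric_of_lt_one (r := (1 / 2 : ℝ)) (by norm_num) (by norm_num)).mul_left (1 / 2)
      norm_num at this
      refine this.congr_fun ?_ |> fun h => h
      intro n
      ring
    exact hasSum_le (fun n => (hbd n).2) hsum.hasSum hg
  have hu := hs3.unique (Complex.hasSum_ofReal.2 hsum.hasSum)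
  rw [← hu, mul_inv_cancel_left₀ hp]

end PsiRH

namespace PsiRH
open Complex Filter Topology MeasureTheory
local notation "conj" => starRingEnd ℂ

lemma explicit2 (hRH : RiemannHypothesis) {y η : ℝ} (hy : 2 ≤ y) (hη : 0 < η) :
    ∃ S T : ℝ, HasSum (fun n : ℕ => ArithmeticFunction.vonMangoldt n * ph η (n / y)) S ∧
    0 ≤ T ∧ T ≤ 1 ∧ ∫ t : ℝ, xf (vl 2 t) * Gk y η (vl 2 t) =
      2 * π * ((y * (1 + η / 2) - 1 - Real.log π / 2 - Real.eulerMascheroniConstant / 2 + T / 2 - S : ℝ) : ℂ) := by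
  have hy1 : 1 ≤ y := by linarith
  obtain ⟨S, hS, hSi⟩ := ls_sum hy1 hη
  obtain ⟨T, hT0, hT1, hTi⟩ := dg_sum hy hη
  refine ⟨S, T, hS, hT0, hT1, ?_⟩
  obtain ⟨hc, C, hC, hb⟩ := Gk_line hy1 hη (σ := 2) (by norm_num) le_rfl
  have i0 : Integrable fun t : ℝ => xf (vl 2 t) * Gk y η (vl 2 t) := by
    have e : (1 / 2 + 3 / 2 : ℝ) = 2 := by norm_num
    have := xf_mul_integrable hRH (ε := 3 / 2) (by norm_num) hc hb
    rwa [e] at this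
  have i1 := inv_int hy1 hη (a := -1) (by norm_num)
  have h1 := fub hy1 hη (a := -1) (by norm_num)
  have i2 := (Gk_int hy1 hη).const_mul ((Real.log π : ℂ) / 2 + Real.eulerMascheroniConstant / 2)
  have i3 := ls_int hRH hy1 hη
  have e : ∀ t : ℝ, (∑' n, dgt (vl 2 t / 2) n) * Gk y η (vl 2 t) =
     2 * (xf (vl 2 t) * Gk y η (vl 2 t) - 1 / (vl 2 t + ((-1 : ℝ) : ℂ)) * Gk y η (vl 2 t)
      + ((Real.log π : ℂ) / 2 + Real.eulerMascheroniConstant / 2) * Gk y η (vl 2 t)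
      + LSeries Lam (vl 2 t) * Gk y η (vl 2 t)) := by
    intro t
    rw [xf_formula (s := vl 2 t) (by rw [vl_re]; norm_num), dgS]
    push_cast
    ring
  simp_rw [e] at hTi
  have i01 : Integrable fun t : ℝ => xf (vl 2 t) * Gk y η (vl 2 t)
      - 1 / (vl 2 t + ((-1 : ℝ) : ℂ)) * Gk y η (vl 2 t) := i0.sub i1
  have i012 : Integrable fun t : ℝ => xf (vl 2 t) * Gk y η (vl 2 t)
      - 1 / (vl 2 t + ((-1 : ℝ) : ℂ)) * Gk y η (vl 2 t)
      + ((Real.log π : ℂ) / 2 + Real.eulerMascheroniConstant / 2) * Gk y η (vl 2 t) := i01.add i2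
  rw [integral_const_mul, integral_add i012 i3, integral_add i01 i2,
    integral_sub i0 i1, h1, integral_const_mul, Gk_total two_pos hy1 hη, hSi, JJ_neg_one hy1 hη] at hTi
  push_cast at hTi ⊢
  linear_combination hTi / 2

lemma shift_xf (hRH : RiemannHypothesis) {ε y η : ℝ} (hε : 0 < ε) (hε2 : ε ≤ 1 / 2) (hy : 1 ≤ y)
    (hη : 0 < η) : ∫ t : ℝ, xf (vl (1 / 2 + ε) t) * Gk y η (vl (1 / 2 + ε) t) =
      ∫ t : ℝ, xf (vl 2 t) * Gk y η (vl 2 t) := by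
  obtain ⟨C1, hC1, h1⟩ := xf_growth hRH hε
  obtain ⟨C2, hC2, h2⟩ := Gk_bound hy hη
  refine vline_shift (H := fun s => xf s * Gk y η s) (C := C1 * C2) (by linarith) ?_ ?_ (by positivity)
  · intro s hs _
    exact (xf_differentiableAt hRH (by linarith)).mul (Gk_differentiableAt hy hη (by linarith))
  · intro s hs hs2
    rw [norm_mul, Dc_eq (norm_nonneg _)]
    calc _ ≤ (C1 * Real.sqrt (1 + ‖s‖)) * (C2 / (1 + ‖s‖) ^ 2) :=
          mul_le_mul (h1 s hs) (h2 s (by linarith) hs2) (norm_nonneg _) (by positivity)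
      _ = _ := by ring

lemma explicit_re (hRH : RiemannHypothesis) {y η : ℝ} (hy : 2 ≤ y) (hη : 0 < η) :
    ∃ S T : ℝ, HasSum (fun n : ℕ => ArithmeticFunction.vonMangoldt n * ph η (n / y)) S ∧
    0 ≤ T ∧ T ≤ 1 ∧ ∀ ε : ℝ, 0 < ε → ε ≤ 1 / 2 →
     ∫ t : ℝ, ((xf (vl (1 / 2 + ε) t)).re : ℂ) * Gk y η (vl (1 / 2 + ε) t) =
      π * (((xf ((2 * (1 / 2 + ε) : ℝ) : ℂ)).re + y * (1 + η / 2) - 1 - Real.log π / 2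
        - Real.eulerMascheroniConstant / 2 + T / 2 - S : ℝ) : ℂ) := by
  have hy1 : 1 ≤ y := by linarith
  obtain ⟨S, T, hS, hT0, hT1, hI⟩ := explicit2 hRH hy hη
  refine ⟨S, T, hS, hT0, hT1, fun ε hε hε2 => ?_⟩
  obtain ⟨hc, C, hC, hb⟩ := Gk_line hy1 hη (σ := 1 / 2 + ε) (by linarith) (by linarith)
  have i0 := xf_mul_integrable hRH hε hc hb
  have i1 : Integrable fun t : ℝ => conj (xf (vl (1 / 2 + ε) t)) * Gk y η (vl (1 / 2 + ε) t) := by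
    refine Integrable.mono i0 ?_ (Eventually.of_forall fun t => by simp)
    exact ((continuous_conj.comp (xf_vl_continuous hRH (by linarith))).mul hc).aestronglyMeasurable
  have e : ∀ t : ℝ, ((xf (vl (1 / 2 + ε) t)).re : ℂ) * Gk y η (vl (1 / 2 + ε) t) =
      (1 / 2) * (xf (vl (1 / 2 + ε) t) * Gk y η (vl (1 / 2 + ε) t)
        + conj (xf (vl (1 / 2 + ε) t)) * Gk y η (vl (1 / 2 + ε) t)) := by
    intro t
    rw [← add_mul, Complex.add_conj]
    push_cast
    ring
  simp_rw [e]
  rw [integral_const_mul, integral_add i0 i1, conj_piece hRH hε hε2 hy1 hη,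
    shift_xf hRH hε hε2 hy1 hη, hI, Gk_total (by linarith) hy1 hη, xf_ofReal]
  generalize (xf ((2 * (1 / 2 + ε) : ℝ) : ℂ)).re = f
  push_cast
  ring

end PsiRH

namespace PsiRH
open Complex Filter Topology MeasureTheory
local notation "conj" => starRingEnd ℂ

lemma cpow_diff_bound {η : ℝ} (hη : 0 < η) {w : ℂ} (hw : 1 ≤ w.re) :
    ‖((1 + η : ℝ) : ℂ) ^ w - 1‖ ≤ ‖w‖ * (1 + η) ^ (w.re - 1) * η := by
  have h := (convex_Icc (1:ℝ) (1 + η)).norm_image_sub_le_of_norm_hasDerivWithin_le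
    (f := fun v : ℝ => (v:ℂ) ^ w) (f' := fun v : ℝ => w * (v:ℂ) ^ (w - 1))
    (C := ‖w‖ * (1 + η) ^ (w.re - 1)) (x := 1) (y := 1 + η) (fun v hv => by
      have hv0 : (0:ℝ) < v := lt_of_lt_of_le one_pos hv.1
      have := (hasDerivAt_id (v:ℂ)).cpow_const (c := w) (Or.inl (by simpa using hv0))
      have h2 := this.comp_ofReal
      simp only [id] at h2
      rw [mul_one] at h2
      exact h2.hasDerivWithinAt) (fun v hv => by
      have hv0 : (0:ℝ) < v := lt_of_lt_of_le one_pos hv.1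
      rw [norm_mul, Complex.norm_cpow_eq_rpow_re_of_pos hv0, sub_re, one_re]
      gcongr
      exact hv.2) (by constructor <;> linarith) (by constructor <;> linarith)
  simp only [ofReal_one, one_cpow] at h
  refine h.trans (le_of_eq ?_)
  rw [add_sub_cancel_left, Real.norm_eq_abs, abs_of_pos hη]

lemma Gk_norm_bound {ε y η : ℝ} (hε : 0 < ε) (hε2 : ε ≤ 1 / 2) (hy : 0 < y) (hη : 0 < η) (t : ℝ)
    {r : ℝ} (hr : 0 < r) (hr2 : r ^ 2 = t ^ 2 + 1 / 4) :
    ‖Gk y η (vl (1 / 2 + ε) t)‖ ≤ y ^ (1 / 2 + ε) * (1 + η) ^ 2 * (1 / r) ∧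
    ‖Gk y η (vl (1 / 2 + ε) t)‖ ≤ y ^ (1 / 2 + ε) * (1 + η) ^ 2 * ((2 / η) / r ^ 2) := by
  set s := vl (1 / 2 + ε) t with hs
  have hsre : s.re = 1 / 2 + ε := by rw [hs, vl_re]
  have hn : r ≤ ‖s‖ := by
    apply le_of_sq_le_sq _ (norm_nonneg _)
    rw [← Complex.normSq_eq_norm_sq, Complex.normSq_apply, hsre, hs, vl_im, hr2]
    nlinarith
  have hn1 : r ≤ ‖s + 1‖ := by
    apply le_of_sq_le_sq _ (norm_nonneg _)
    rw [← Complex.normSq_eq_norm_sq, Complex.normSq_apply, add_re, hsre, hs, add_im, vl_im, hr2]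
    simp only [one_re, one_im]
    nlinarith
  have hs1 : 0 < ‖s + 1‖ := hr.trans_le hn1
  have hs0 : 0 < ‖s‖ := hr.trans_le hn
  have hy' : 0 < y ^ (1 / 2 + ε) := by positivity
  unfold Gk
  rw [norm_div, norm_mul, norm_mul, norm_mul, Complex.norm_cpow_eq_rpow_re_of_pos hy, hsre,
    Complex.norm_real, Real.norm_eq_abs, abs_of_pos hη]
  have hre : (s + 1).re = 1 / 2 + ε + 1 := by rw [add_re, hsre, one_re]
  have hle2 : (1 + η) ^ ((s + 1).re) ≤ (1 + η) ^ 2 := by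
    rw [← Real.rpow_two, hre]
    apply Real.rpow_le_rpow_of_exponent_le <;> linarith
  constructor
  · have h := cpow_diff_bound hη (w := s + 1) (by rw [hre]; linarith)
    have h2 : (1 + η) ^ ((s + 1).re - 1) ≤ (1 + η) ^ 2 := by
      refine le_trans ?_ hle2
      apply Real.rpow_le_rpow_of_exponent_le <;> linarith
    rw [div_le_iff₀ (by positivity)]
    calc _ ≤ y ^ (1 / 2 + ε) * (‖s + 1‖ * (1 + η) ^ ((s + 1).re - 1) * η) := by gcongr
      _ ≤ y ^ (1 / 2 + ε) * (‖s + 1‖ * (1 + η) ^ 2 * η) := by gcongr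
      _ = y ^ (1 / 2 + ε) * (1 + η) ^ 2 * (1 / r) * (η * r * ‖s + 1‖) := by field_simp
      _ ≤ _ := by gcongr
  · have h : ‖((1 + η : ℝ) : ℂ) ^ (s + 1) - 1‖ ≤ 2 * (1 + η) ^ 2 := by
      refine (norm_sub_le _ _).trans ?_
      rw [Complex.norm_cpow_eq_rpow_re_of_pos (by linarith), norm_one]
      have : (1:ℝ) ≤ (1 + η) ^ 2 := by nlinarith
      linarith
    rw [div_le_iff₀ (by positivity)]
    calc _ ≤ y ^ (1 / 2 + ε) * (2 * (1 + η) ^ 2) := by gcongr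
      _ = y ^ (1 / 2 + ε) * (1 + η) ^ 2 * ((2 / η) / r ^ 2) * (η * r * r) := by field_simp
      _ ≤ _ := by gcongr

lemma arctan_lower {z : ℝ} (h0 : 0 ≤ z) : z - z ^ 3 / 3 ≤ Real.arctan z := by
  have h : MonotoneOn (fun z : ℝ => Real.arctan z - (z - z ^ 3 / 3)) (Set.Ici 0) := by
    apply monotoneOn_of_deriv_nonneg (convex_Ici 0)
    · have := Real.continuous_arctan; fun_prop
    · have := Real.differentiable_arctan; fun_prop
    · intro x _
      have hd : HasDerivAt (fun z : ℝ => Real.arctan z - (z - z ^ 3 / 3))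
          (1 / (1 + x ^ 2) - (1 - 3 * x ^ 2 / 3)) x := by
        have := ((hasDerivAt_pow 3 x).div_const 3)
        convert! (Real.hasDerivAt_arctan x).sub ((hasDerivAt_id x).sub this) using 1
      rw [hd.deriv]
      have : 1 / (1 + x ^ 2) - (1 - 3 * x ^ 2 / 3) = x ^ 4 / (1 + x ^ 2) := by
        field_simp; ring
      rw [this]; positivity
  have := h (Set.mem_Ici.2 le_rfl) (Set.mem_Ici.2 h0) h0
  simp at this
  linarith

lemma arctan_upper {z : ℝ} (h0 : 0 ≤ z) : Real.arctan z ≤ z := by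
  have h := Real.le_tan (x := Real.arctan z) (Real.arctan_nonneg.2 h0) (Real.arctan_lt_pi_div_two z)
  rwa [Real.tan_arctan] at h

lemma ker_min {A r m : ℝ} (hA : 0 < A) (hr : 0 < r) (h1 : m ≤ 1 / r) (h2 : m ≤ A / r ^ 2) :
    m ≤ 2 / π * (Real.arctan (A / r) / r) + 4 / π * (A / (A ^ 2 + r ^ 2)) := by
  have hpi := Real.pi_gt_three
  have hpi2 := Real.pi_lt_d2
  rcases le_total r A with h | h
  · refine h1.trans ?_
    have e : Real.arctan (A / r) = π / 2 - Real.arctan (r / A) := by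
      rw [← Real.arctan_inv_of_pos (by positivity), inv_div]
    have h3 : Real.arctan (r / A) ≤ r / A := arctan_upper (by positivity)
    have h4 : r / (2 * A) ≤ A * r / (A ^ 2 + r ^ 2) := by
      rw [div_le_div_iff₀ (by positivity) (by positivity)]
      nlinarith [mul_pos hA hr, mul_nonneg hr.le (mul_nonneg (sub_nonneg.2 h) (add_pos hA hr).le)]
    have e2 : 2 / π * (Real.arctan (A / r) / r) + 4 / π * (A / (A ^ 2 + r ^ 2)) - 1 / r =
      (1 / r) * (2 / π) * (2 * (A * r / (A ^ 2 + r ^ 2)) - Real.arctan (r / A)) := by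
      rw [e]; field_simp; ring
    have h5 : r / (2 * A) = (r / A) / 2 := by field_simp
    have : 0 ≤ (1 / r) * (2 / π) * (2 * (A * r / (A ^ 2 + r ^ 2)) - Real.arctan (r / A)) := by
      apply mul_nonneg (by positivity)
      linarith
    linarith
  · refine h2.trans ?_
    have hz : A / r ≤ 1 := by rw [div_le_one hr]; exact h
    have hz0 : 0 < A / r := by positivity
    have h3 := arctan_lower hz0.le
    have h3' : 2 / 3 * (A / r) ≤ Real.arctan (A / r) := by
      have : (A / r) ^ 3 ≤ A / r := by
        calc (A / r) ^ 3 = (A / r) * ((A / r) * (A / r)) := by ring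
          _ ≤ (A / r) * (1 * 1) := by gcongr
          _ = _ := by ring
      linarith
    have h4 : A / (2 * r ^ 2) ≤ A / (A ^ 2 + r ^ 2) := by
      apply div_le_div_of_nonneg_left hA.le (by positivity)
      nlinarith
    have e1 : 2 / 3 * (A / r) / r = 2 / 3 * (A / r ^ 2) := by field_simp
    have e2 : A / (2 * r ^ 2) = 1 / 2 * (A / r ^ 2) := by field_simp
    have h5 : 2 / 3 * (A / r ^ 2) ≤ Real.arctan (A / r) / r := by
      rw [← e1]; gcongr
    rw [e2] at h4
    have hq : 0 < A / r ^ 2 := by positivity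
    calc A / r ^ 2 ≤ (10 / (3 * π)) * (A / r ^ 2) := by
          have : 1 ≤ 10 / (3 * π) := by
            rw [le_div_iff₀ (by positivity)]; linarith
          nlinarith
      _ = 2 / π * (2 / 3 * (A / r ^ 2)) + 4 / π * (1 / 2 * (A / r ^ 2)) := by
          field_simp; norm_num
      _ ≤ _ := by gcongr

lemma int_arctan {A r : ℝ} (hA : 0 ≤ A) (hr : 0 < r) :
    ∫ a in Set.Ioc 0 A, 1 / (a ^ 2 + r ^ 2) = Real.arctan (A / r) / r := by
  rw [← intervalIntegral.integral_of_le hA]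
  rw [intervalIntegral.integral_eq_sub_of_hasDerivAt (f := fun a => Real.arctan (a / r) / r)]
  · simp
  · intro x _
    have h1 : HasDerivAt (fun a : ℝ => a / r) (1 / r) x := (hasDerivAt_id x).div_const r
    have := (h1.arctan).div_const r
    convert! this using 1
    field_simp
    ring
  · apply Continuous.intervalIntegrable
    have : ∀ a : ℝ, a ^ 2 + r ^ 2 ≠ 0 := fun a => by positivity
    fun_prop (disch := assumption)

noncomputable def va (a : ℝ) : ℝ := Real.sqrt (a ^ 2 + 1 / 4)

lemma va_sq (a : ℝ) : va a ^ 2 = a ^ 2 + 1 / 4 := Real.sq_sqrt (by positivity)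
lemma va_pos (a : ℝ) : 0 < va a := Real.sqrt_pos.2 (by positivity)

lemma tonelli (hRH : RiemannHypothesis) {ε A : ℝ} (hε : 0 < ε) (hA : 0 ≤ A) :
    Integrable (fun t : ℝ => (xf (vl (1 / 2 + ε) t)).re * (Real.arctan (A / va t) / va t)) ∧
    IntegrableOn (fun a => xF ε (va a)) (Set.Ioc 0 A) ∧
    ∫ t : ℝ, (xf (vl (1 / 2 + ε) t)).re * (Real.arctan (A / va t) / va t) =
      π * ∫ a in Set.Ioc 0 A, xF ε (va a) := by
  have hp := (poisson_integrable hRH hε (v := 1 / 2) (by norm_num)).mul_prod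
    (ν := volume.restrict (Set.Ioc 0 A)) (integrable_const (1:ℝ))
  have hu := xf_vl_continuous hRH (σ := 1 / 2 + ε) (by linarith)
  have hF : Integrable (Function.uncurry fun t a : ℝ => (xf (vl (1 / 2 + ε) t)).re * (1 / (a ^ 2 + va t ^ 2)))
      (volume.prod (volume.restrict (Set.Ioc 0 A))) := by
    refine hp.mono' ?_ (Eventually.of_forall fun p => ?_)
    · apply Continuous.aestronglyMeasurable
      have hv : Continuous va := by unfold va; fun_prop
      have hne : ∀ p : ℝ × ℝ, p.2 ^ 2 + va p.1 ^ 2 ≠ 0 := fun p => by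
        have := va_pos p.1; positivity
      have c1 : Continuous fun p : ℝ × ℝ => (xf (vl (1 / 2 + ε) p.1)).re :=
        continuous_re.comp (hu.comp continuous_fst)
      have c2 : Continuous fun p : ℝ × ℝ => p.2 ^ 2 + va p.1 ^ 2 := by fun_prop
      exact c1.mul (continuous_const.div c2 hne)
    · have h0 := xf_re_nonneg hRH (s := vl (1 / 2 + ε) p.1) (by rw [vl_re]; linarith)
      simp only [Function.uncurry]
      rw [va_sq, Real.norm_eq_abs, abs_of_nonneg (by positivity), mul_one]
      apply mul_le_mul_of_nonneg_left _ h0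
      apply div_le_div_of_nonneg_left (by norm_num) (by positivity)
      nlinarith [sq_nonneg p.2]
  have e1 : ∀ t : ℝ, (xf (vl (1 / 2 + ε) t)).re * (Real.arctan (A / va t) / va t) =
      ∫ a in Set.Ioc 0 A, (xf (vl (1 / 2 + ε) t)).re * (1 / (a ^ 2 + va t ^ 2)) := by
    intro t
    rw [integral_const_mul, int_arctan hA (va_pos t)]
  have e2 : ∀ a : ℝ, ∫ t : ℝ, (xf (vl (1 / 2 + ε) t)).re * (1 / (a ^ 2 + va t ^ 2)) =
      π * xF ε (va a) := by
    intro a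
    rw [← poisson hRH hε (va_pos a)]
    congr 1
    ext t
    rw [va_sq, va_sq]
    ring_nf
  simp_rw [e1]
  refine ⟨hF.integral_prod_left, ?_, ?_⟩
  · have := hF.integral_prod_right
    simp only [Function.uncurry, e2] at this
    have h2 := this.const_mul (1 / π)
    refine h2.congr (Eventually.of_forall fun a => ?_)
    have := pi_ne_zero
    simp only
    field_simp
  · rw [integral_integral_swap hF]
    simp_rw [e2]
    rw [integral_const_mul]

lemma L1 (hRH : RiemannHypothesis) {ε y η : ℝ} (hε : 0 < ε) (hε2 : ε ≤ 1 / 2) (hy : 1 ≤ y) (hη : 0 < η) :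
    ‖∫ t : ℝ, ((xf (vl (1 / 2 + ε) t)).re : ℂ) * Gk y η (vl (1 / 2 + ε) t)‖ ≤
      y ^ (1 / 2 + ε) * (1 + η) ^ 2 * (2 * (∫ a in Set.Ioc 0 (2 / η), xF ε (va a))
        + 4 * (2 / η) * xF ε (va (2 / η))) := by
  set A := 2 / η with hA
  have hA0 : 0 < A := by positivity
  obtain ⟨i1, -, h1⟩ := tonelli hRH hε hA0.le
  have i2 := poisson_integrable hRH hε (va_pos A)
  have h2 := poisson hRH hε (va_pos A)
  set Y := y ^ (1 / 2 + ε) * (1 + η) ^ 2 with hY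
  have hY0 : 0 ≤ Y := by positivity
  have ib : Integrable fun t : ℝ => Y * (2 / π * ((xf (vl (1 / 2 + ε) t)).re * (Real.arctan (A / va t) / va t))
      + 4 * A / π * ((xf (vl (1 / 2 + ε) t)).re * (1 / (va A ^ 2 + t ^ 2)))) :=
    ((i1.const_mul _).add (i2.const_mul _)).const_mul _
  refine (norm_integral_le_of_norm_le ib (Eventually.of_forall fun t => ?_)).trans (le_of_eq ?_)
  · have h0 := xf_re_nonneg hRH (s := vl (1 / 2 + ε) t) (by rw [vl_re]; linarith)
    obtain ⟨b1, b2⟩ := Gk_norm_bound hε hε2 (y := y) (by linarith) hη t (va_pos t) (va_sq t)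
    rw [norm_mul, Complex.norm_real, Real.norm_eq_abs, abs_of_nonneg h0]
    have hm := ker_min hA0 (va_pos t) (min_le_left (1 / va t) (A / va t ^ 2)) (min_le_right _ _)
    have hg : ‖Gk y η (vl (1 / 2 + ε) t)‖ ≤ Y * min (1 / va t) (A / va t ^ 2) := by
      rw [mul_min_of_nonneg _ _ hY0]
      exact le_min b1 b2
    have e : va A ^ 2 + t ^ 2 = A ^ 2 + va t ^ 2 := by rw [va_sq, va_sq]; ring
    calc _ ≤ (xf (vl (1 / 2 + ε) t)).re * (Y * min (1 / va t) (A / va t ^ 2)) := by gcongr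
      _ ≤ (xf (vl (1 / 2 + ε) t)).re * (Y * (2 / π * (Real.arctan (A / va t) / va t) + 4 / π * (A / (A ^ 2 + va t ^ 2)))) := by gcongr
      _ = _ := by rw [e]; ring
  · rw [integral_const_mul, integral_add (i1.const_mul _) (i2.const_mul _), integral_const_mul,
      integral_const_mul, h1, h2]
    field_simp

end PsiRH

namespace PsiRH
open Complex Filter Topology MeasureTheory
local notation "conj" => starRingEnd ℂ

lemma va_ge_half (a : ℝ) : 1/2 ≤ va a := by
  have := va_sq a; have := va_pos a; nlinarith [sq_nonneg a]

lemma va_ge (a : ℝ) : a ≤ va a := by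
  have h1 := va_sq a; have h2 := va_pos a; nlinarith [sq_nonneg a]

lemma xF_large (hRH : RiemannHypothesis) {ε a : ℝ} (hε : 0 < ε) (hε1 : ε ≤ 0.1) (ha : 2 * π ≤ a) :
    xF ε (va a) ≤ (Real.log (a/(2*π))/2 + 2.5/a)/a := by
  have hpi := Real.pi_gt_three
  have ha6 : 6 < a := by linarith
  have ha0 : 0 < a := by linarith
  refine (xF_anti hRH hε ha0 (va_ge a)).trans ?_
  unfold xF
  refine div_le_div_of_nonneg_right ?_ ha0.le
  have h := xf_real_le (x := 1/2+ε+a) (by linarith)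
  refine h.trans ?_
  have h1 : Real.log ((1/2+ε+a)/(2*π)) ≤ Real.log (a/(2*π)) + 0.6/a := by
    have e : (1/2+ε+a)/(2*π) = (a/(2*π)) * (1 + (1/2+ε)/a) := by field_simp; ring
    rw [e, Real.log_mul (by positivity) (by positivity)]
    have := Real.log_le_sub_one_of_pos (show 0 < 1 + (1/2+ε)/a by positivity)
    have : (1/2+ε)/a ≤ 0.6/a := by gcongr; linarith
    linarith
  have h2 : 1/(1/2+ε+a) ≤ 1/a := by gcongr; linarith
  have h3 : 1/(1/2+ε+a-1) ≤ 1.1/a := by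
    rw [div_le_div_iff₀ (by linarith) ha0]; linarith
  have h4 : 2.5/a = (0.6/a)/2 + 1/a + 1.1/a + 0.1/a := by field_simp; norm_num
  have : 0 < 0.1/a := by positivity
  linarith

lemma int_g {A : ℝ} (hA : 2*π ≤ A) :
    IntervalIntegrable (fun a => (Real.log (a/(2*π))/2 + 2.5/a)/a) volume (2*π) A ∧
    ∫ a in (2*π)..A, (Real.log (a/(2*π))/2 + 2.5/a)/a
      = Real.log (A/(2*π))^2/4 - 2.5/A + 2.5/(2*π) := by
  have hpi := Real.pi_gt_three
  have pos : ∀ a ∈ Set.uIcc (2*π) A, 0 < a := by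
    intro a ha; rw [Set.uIcc_of_le hA] at ha; linarith [ha.1]
  have hc : ContinuousOn (fun a => (Real.log (a/(2*π))/2 + 2.5/a)/a) (Set.uIcc (2*π) A) := by
    intro a ha
    have := pos a ha
    apply ContinuousAt.continuousWithinAt
    have : a/(2*π) ≠ 0 := by positivity
    fun_prop (disch := first | assumption | positivity)
  refine ⟨hc.intervalIntegrable, ?_⟩
  rw [intervalIntegral.integral_eq_sub_of_hasDerivAt
    (f := fun a => Real.log (a/(2*π))^2/4 - 2.5/a) ?_ hc.intervalIntegrable]
  · rw [div_self (by positivity)]; simp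
  · intro a ha
    have h0 := pos a ha
    have h1 : HasDerivAt (fun a : ℝ => a/(2*π)) (1/(2*π)) a := (hasDerivAt_id a).div_const _
    have h2 := h1.log (by positivity)
    have h3 := (((h2.pow 2).div_const 4)).sub ((hasDerivAt_const a (2.5:ℝ)).div (hasDerivAt_id a) h0.ne')
    convert! h3 using 1
    simp
    field_simp
    ring

lemma L2 (hRH : RiemannHypothesis) {ε A : ℝ} (hε : 0 < ε) (hε1 : ε ≤ 0.1) (hA : 2*π ≤ A) :
    2*(∫ a in Set.Ioc 0 A, xF ε (va a)) + 4*A*xF ε (va A) ≤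
      8*π*(xf ((1+ε:ℝ):ℂ)).re + Real.log (A/(2*π))^2/2 + 2*Real.log (A/(2*π)) + 5/(2*π) + 5/A := by
  have hpi := Real.pi_gt_three
  have hA0 : 0 < A := by linarith
  have hint := (tonelli hRH hε hA0.le).2.1
  have hsplit : Set.Ioc 0 A = Set.Ioc 0 (2*π) ∪ Set.Ioc (2*π) A := by
    rw [Set.Ioc_union_Ioc_eq_Ioc (by linarith) hA]
  have i1 : IntegrableOn (fun a => xF ε (va a)) (Set.Ioc 0 (2*π)) := hint.mono_set (by rw [hsplit]; exact Set.subset_union_left)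
  have i2 : IntegrableOn (fun a => xF ε (va a)) (Set.Ioc (2*π) A) := hint.mono_set (by rw [hsplit]; exact Set.subset_union_right)
  rw [hsplit, setIntegral_union (Set.Ioc_disjoint_Ioc_of_le le_rfl) measurableSet_Ioc i1 i2]
  have b1 : ∫ a in Set.Ioc 0 (2*π), xF ε (va a) ≤ 4*π*(xf ((1+ε:ℝ):ℂ)).re := by
    have : ∫ a in Set.Ioc 0 (2*π), xF ε (va a) ≤ ∫ a in Set.Ioc 0 (2*π), xF ε (1/2) := by
      apply setIntegral_mono_on i1 continuous_const.integrableOn_Ioc measurableSet_Ioc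
      intro a _
      exact xF_anti hRH hε (by norm_num) (va_ge_half a)
    refine this.trans (le_of_eq ?_)
    rw [setIntegral_const]
    simp only [Measure.real, Real.volume_Ioc, smul_eq_mul]
    rw [ENNReal.toReal_ofReal (by linarith)]
    unfold xF
    rw [show (1/2+ε+1/2:ℝ) = 1+ε by ring]
    ring
  obtain ⟨gi, ge⟩ := int_g hA
  have b2 : ∫ a in Set.Ioc (2*π) A, xF ε (va a) ≤ Real.log (A/(2*π))^2/4 - 2.5/A + 2.5/(2*π) := by
    rw [← ge, intervalIntegral.integral_of_le hA]
    apply setIntegral_mono_on i2 ((intervalIntegrable_iff_integrableOn_Ioc_of_le hA).1 gi) measurableSet_Ioc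
    intro a ha
    exact xF_large hRH hε hε1 ha.1.le
  have b3 : 4*A*xF ε (va A) ≤ 2*Real.log (A/(2*π)) + 10/A := by
    have := mul_le_mul_of_nonneg_left (xF_large hRH hε hε1 hA) (show 0 ≤ 4*A by positivity)
    refine this.trans (le_of_eq ?_)
    field_simp
    ring
  have e1 : 2.5/A*2 = 5/A := by ring
  have e2 : 10/A = 2*(5/A) := by ring
  have e3 : 2.5/(2*π)*2 = 5/(2*π) := by ring
  linarith

end PsiRH

namespace PsiRH
open Complex Filter Topology MeasureTheory
local notation "conj" => starRingEnd ℂ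

lemma f_tendsto (hRH : RiemannHypothesis) (k : ℝ) :
    Tendsto (fun ε : ℝ => (xf ((1+k*ε:ℝ):ℂ)).re) (𝓝[>] 0) (𝓝 (xf 1).re) := by
  have h1 : ContinuousAt xf ((1+k*0:ℝ):ℂ) := (xf_differentiableAt hRH (by simp; norm_num)).continuousAt
  have h2 : ContinuousAt (fun ε : ℝ => ((1+k*ε:ℝ):ℂ)) 0 := by fun_prop
  have h3 : ContinuousAt (fun ε : ℝ => (xf ((1+k*ε:ℝ):ℂ)).re) 0 :=
    Complex.continuous_re.continuousAt.comp (ContinuousAt.comp (f := fun ε : ℝ => ((1+k*ε:ℝ):ℂ)) h1 h2)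
  have h4 := h3.tendsto
  simp only [mul_zero, add_zero, Complex.ofReal_one] at h4
  exact h4.mono_left nhdsWithin_le_nhds

noncomputable def M0 (η : ℝ) : ℝ :=
  Real.log (1/(π*η))^2/(2*π) + 2/π*Real.log (1/(π*η)) + 5/(2*π^2) + 0.552 + 5*η/(2*π)

lemma L3 (hRH : RiemannHypothesis) {y η : ℝ} (hy : 2 ≤ y) (hη : 0 < η) (hη1 : π*η ≤ 1) :
    ∃ S : ℝ, HasSum (fun n : ℕ => ArithmeticFunction.vonMangoldt n * ph η (n / y)) S ∧
      |S - y*(1+η/2)| ≤ Real.sqrt y*(1+η)^2*M0 η + 2 := by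
  have hpi := Real.pi_gt_three
  obtain ⟨S, T, hS, hT0, hT1, h⟩ := explicit_re hRH hy hη
  refine ⟨S, hS, ?_⟩
  have hA : 2*π ≤ 2/η := by rw [le_div_iff₀ hη]; linarith
  set B : ℝ := Real.log ((2/η)/(2*π))^2/2 + 2*Real.log ((2/η)/(2*π)) + 5/(2*π) + 5/(2/η) with hB
  set K : ℝ := y*(1+η/2) - 1 - Real.log π/2 - Real.eulerMascheroniConstant/2 + T/2 - S with hK
  have key : ∀ ε : ℝ, 0 < ε → ε ≤ 0.1 →
      π * |(xf ((1+2*ε:ℝ):ℂ)).re + K| ≤ y^(1/2+ε) * (1+η)^2 * (8*π*(xf ((1+1*ε:ℝ):ℂ)).re + B) := by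
    intro ε h0 h1
    have a1 := L1 hRH h0 (by norm_num at h1 ⊢; linarith) (show 1 ≤ y by linarith) hη
    rw [h ε h0 (by norm_num at h1 ⊢; linarith)] at a1
    have e : ‖(π:ℂ) * (((xf ((2*(1/2+ε):ℝ):ℂ)).re + y*(1+η/2) - 1 - Real.log π/2 - Real.eulerMascheroniConstant/2 + T/2 - S : ℝ) : ℂ)‖ = π * |(xf ((1+2*ε:ℝ):ℂ)).re + K| := by
      rw [norm_mul, Complex.norm_real, Complex.norm_real, Real.norm_eq_abs, Real.norm_eq_abs, abs_of_pos Real.pi_pos,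
        show 2*(1/2+ε) = 1+2*ε by ring]
      congr 2
      rw [hK]; ring
    rw [e] at a1
    refine a1.trans ?_
    have a2 := L2 hRH h0 h1 hA
    apply mul_le_mul_of_nonneg_left _ (by positivity)
    rw [one_mul]
    linarith
  have lim : π * |(xf 1).re + K| ≤ y^((1:ℝ)/2+0) * (1+η)^2 * (8*π*(xf 1).re + B) := by
    refine le_of_tendsto_of_tendsto (b := 𝓝[>] (0:ℝ)) (f := fun ε => π * |(xf ((1+2*ε:ℝ):ℂ)).re + K|)
      (g := fun ε => y^(1/2+ε) * (1+η)^2 * (8*π*(xf ((1+1*ε:ℝ):ℂ)).re + B)) ?_ ?_ ?_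
    · exact (((f_tendsto hRH 2).add_const K).abs).const_mul π
    · have hc : ContinuousAt (fun ε : ℝ => y^(1/2+ε)) 0 := by
        apply ContinuousAt.rpow (by fun_prop) (by fun_prop); left; linarith
      have hc2 := hc.tendsto.mono_left (nhdsWithin_le_nhds (s := Set.Ioi 0))
      exact (hc2.mul_const _).mul (((f_tendsto hRH 1).const_mul (8*π)).add_const B)
    · have : Set.Ioc (0:ℝ) 0.1 ∈ 𝓝[>] (0:ℝ) := Ioc_mem_nhdsGT (by norm_num)
      filter_upwards [this] with ε hε using key ε hε.1 hε.2
  rw [add_zero, ← Real.sqrt_eq_rpow] at lim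
  have f0 : 0 ≤ (xf 1).re := xf_re_nonneg hRH (by simp; norm_num)
  have f1 := xf_one_le
  set f := (xf 1).re
  have l1 : Real.log π ≤ 1.3 := by
    have : Real.log π ≤ Real.log 3.15 := Real.log_le_log Real.pi_pos Real.pi_lt_d2.le
    refine this.trans ?_
    rw [Real.log_le_iff_le_exp (by norm_num)]
    have := Real.sum_le_exp_of_nonneg (show (0:ℝ) ≤ 1.3 by norm_num) 5
    refine le_trans ?_ this
    norm_num [Finset.sum_range_succ, Nat.factorial]
  have l0 : 0 ≤ Real.log π := Real.log_nonneg (by linarith)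
  have g1 := Real.eulerMascheroniConstant_lt_two_thirds
  have g0 := Real.one_half_lt_eulerMascheroniConstant
  have e1 : (2/η)/(2*π) = 1/(π*η) := by field_simp
  have hM : 8*π*f + B ≤ π * M0 η := by
    rw [hB, e1]; unfold M0
    set l := Real.log (1/(π*η))
    have : π * (l^2/(2*π) + 2/π*l + 5/(2*π^2) + 0.552 + 5*η/(2*π)) = l^2/2+2*l+5/(2*π)+0.552*π + 5/(2/η) := by
      field_simp
    rw [this]
    nlinarith
  have lim2 : |f + K| ≤ Real.sqrt y*(1+η)^2*M0 η := by
    have h1 : π * |f+K| ≤ Real.sqrt y * (1+η)^2 * (π * M0 η) :=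
      lim.trans (mul_le_mul_of_nonneg_left hM (by positivity))
    have h2 : π * |f+K| ≤ π * (Real.sqrt y * (1+η)^2 * M0 η) := by linarith
    exact le_of_mul_le_mul_left h2 Real.pi_pos
  rw [abs_le] at lim2 ⊢
  constructor <;> linarith [lim2.1, lim2.2]

lemma psi_le_S {y η S : ℝ} (hy : 0 < y) (hη : 0 < η)
    (hS : HasSum (fun n : ℕ => ArithmeticFunction.vonMangoldt n * ph η (n / y)) S) :
    chebyshevPsi y ≤ S := by
  unfold chebyshevPsi
  refine le_trans (Finset.sum_le_sum ?_) (sum_le_hasSum (L := SummationFilter.unconditional ℕ) (Finset.range (⌊y⌋₊ + 1)) ?_ hS)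
  · intro n hn
    have : (n:ℝ) ≤ y := (Nat.le_floor_iff hy.le).1 (by simpa [Nat.lt_succ_iff] using hn)
    rw [ph_one hη ((div_le_one hy).2 this), mul_one]
  · intro n _
    exact mul_nonneg ArithmeticFunction.vonMangoldt_nonneg (ph_mem hη).1

lemma S_le_psi {y η S : ℝ} (hy : 0 < y) (hη : 0 < η)
    (hS : HasSum (fun n : ℕ => ArithmeticFunction.vonMangoldt n * ph η (n / y)) S) :
    S ≤ chebyshevPsi (y*(1+η)) := by
  unfold chebyshevPsi
  have h2 := hasSum_sum_of_ne_finset_zero (L := SummationFilter.unconditional ℕ) (f := fun n : ℕ => ArithmeticFunction.vonMangoldt n * ph η (n / y))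
    (s := Finset.range (⌊y*(1+η)⌋₊ + 1)) (by
      intro n hn
      have : ¬ n ≤ ⌊y*(1+η)⌋₊ := by simpa [Nat.lt_succ_iff] using hn
      rw [Nat.le_floor_iff (by positivity)] at this
      rw [ph_zero hη, mul_zero]
      rw [le_div_iff₀ hy]; linarith)
  rw [hS.unique h2]
  apply Finset.sum_le_sum
  intro n _
  exact mul_le_of_le_one_right ArithmeticFunction.vonMangoldt_nonneg (ph_mem hη).2

lemma M0_nonneg {η : ℝ} (hη : 0 < η) (hη1 : π*η ≤ 1) : 0 ≤ M0 η := by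
  have hpi := Real.pi_gt_three
  have : 0 ≤ Real.log (1/(π*η)) := Real.log_nonneg (by rw [le_div_iff₀ (by positivity)]; linarith)
  unfold M0; positivity

lemma psi_eta (hRH : RiemannHypothesis) {x η : ℝ} (hx : 4 ≤ x) (hη : 0 < η) (hη1 : π*η ≤ 1) :
    |chebyshevPsi x - x| ≤ x*η/2 + Real.sqrt x*(1+η)^2*M0 η + 2 := by
  have hpi := Real.pi_gt_three
  have hη2 : η ≤ 1 := by nlinarith
  rw [abs_le]
  constructor
  · have hy : 2 ≤ x/(1+η) := by rw [le_div_iff₀ (by linarith)]; linarith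
    obtain ⟨S, hS, hb⟩ := L3 hRH hy hη hη1
    have h1 := S_le_psi (by linarith) hη hS
    rw [div_mul_cancel₀ _ (by positivity)] at h1
    have hyx : x/(1+η) ≤ x := div_le_self (by linarith) (by linarith)
    have h2 : Real.sqrt (x/(1+η))*(1+η)^2*M0 η ≤ Real.sqrt x*(1+η)^2*M0 η := by
      have := M0_nonneg hη hη1
      gcongr
    have h3 : x/(1+η)*(1+η/2) = x - x/(1+η)*η/2 := by field_simp; ring
    have h4 : x/(1+η)*η ≤ x*η := by gcongr
    rw [h3] at hb
    linarith [(abs_le.1 hb).1]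
  · obtain ⟨S, hS, hb⟩ := L3 hRH (show 2 ≤ x by linarith) hη hη1
    have h1 := psi_le_S (by linarith) hη hS
    linarith [(abs_le.1 hb).2]

end PsiRH

namespace PsiRH
open Complex Filter Topology MeasureTheory
local notation "conj" => starRingEnd ℂ

lemma num_final {p q L w s l t : ℝ} (hp0 : 0.3182 ≤ p) (hp1 : p ≤ 0.31832) (hq : q ≤ 0.0822)
    (hL : L = 5*s^2) (hs : 1 ≤ s) (hw0 : 0 ≤ w) (hw : w ≤ 2*s-0.39) (hl : l = L/2 - w)
    (ht0 : 0 ≤ t) (ht : t ≤ 0.4107) (htl : t*l ≤ 0.368) (htl2 : t*l^2 ≤ 0.5415) :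
    L*p/2 + (1+t*p)^2*(l^2*p/2 + 2*p*l + 5*p^2/2 + 0.552 + 5*t*p^2/2) + 2*q ≤
      L^2*p/8 - L*w*p/2 - 1.465*w + 1.2325*L := by
  have hpp : p^2 ≤ 0.10133 := by nlinarith
  have hp00 : 0 ≤ p := by linarith
  have htp : t*p ≤ 0.1308 := by nlinarith
  have htp0 : 0 ≤ t*p := by positivity
  have htpp : t*p^2 ≤ 0.04162 := by
    have := mul_le_mul ht hpp (by positivity) (by norm_num); linarith
  have hc : 5*p^2/2 + 0.552 + 5*t*p^2/2 ≤ 0.9095 := by linarith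
  have htM : t*(l^2*p/2 + 2*p*l + 5*p^2/2 + 0.552 + 5*t*p^2/2) ≤ 0.6942 := by
    have a1 : t*l^2*p ≤ 0.5415*0.31832 := mul_le_mul htl2 hp1 hp00 (by norm_num)
    have a2 : t*l*p ≤ 0.368*0.31832 := mul_le_mul htl hp1 hp00 (by norm_num)
    have a3 : t*(5*p^2/2 + 0.552 + 5*t*p^2/2) ≤ 0.4107*0.9095 := mul_le_mul ht hc (by positivity) (by norm_num)
    linarith
  have hpM : p*(t*(l^2*p/2 + 2*p*l + 5*p^2/2 + 0.552 + 5*t*p^2/2)) ≤ 0.221 := by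
    have := mul_le_mul_of_nonneg_left htM hp00
    linarith
  have hpM2 : (2+t*p)*(p*(t*(l^2*p/2 + 2*p*l + 5*p^2/2 + 0.552 + 5*t*p^2/2))) ≤ 0.471 := by
    have := mul_le_mul_of_nonneg_left hpM (show 0 ≤ 2+t*p by linarith)
    linarith
  have e : (1+t*p)^2*(l^2*p/2 + 2*p*l + 5*p^2/2 + 0.552 + 5*t*p^2/2) =
    (2+t*p)*(p*(t*(l^2*p/2 + 2*p*l + 5*p^2/2 + 0.552 + 5*t*p^2/2))) + (l^2*p/2 + 2*p*l) + (5*p^2/2 + 0.552 + 5*t*p^2/2) := by ring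
  rw [e]
  have e2 : l^2*p/2+2*p*l = L^2*p/8 - L*w*p/2 + p*w^2/2 + p*L - 2*p*w := by rw [hl]; ring
  rw [e2]
  have b1 : p*L ≤ 0.31832*L := by
    apply mul_le_mul_of_nonneg_right hp1; rw [hL]; positivity
  have b2 : p*w^2 ≤ 0.31832*w^2 := mul_le_mul_of_nonneg_right hp1 (by positivity)
  have b3 : 0.3182*w ≤ p*w := mul_le_mul_of_nonneg_right hp0 hw0
  have b4 : w^2 ≤ (2*s-0.39)^2 := pow_le_pow_left₀ hw0 hw 2
  nlinarith

lemma le_exp_sub (l : ℝ) : l ≤ Real.exp (l-1) := by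
  have := Real.add_one_le_exp (l-1); linarith

lemma psi_large (hRH : RiemannHypothesis) {x : ℝ} (hx : 0 < x) (hL : 5 ≤ Real.log x) :
    |chebyshevPsi x - x| ≤ Real.sqrt x * Real.log x *
          (Real.log x / (8 * π) - (1 / (2 * π) + 1.465 / Real.log x) * Real.log (Real.log x) + 1.2325) := by
  have hpi := Real.pi_gt_three
  obtain ⟨L, hLd⟩ : ∃ L, L = Real.log x := ⟨_, rfl⟩
  rw [← hLd] at hL ⊢
  have hL0 : 0 < L := by linarith
  have hxe : x = Real.exp L := by rw [hLd, Real.exp_log hx]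
  have hR : Real.sqrt x = Real.exp (L/2) := by
    rw [Real.exp_half, ← hxe]
  obtain ⟨w, hwd⟩ : ∃ w, w = Real.log L := ⟨_, rfl⟩
  rw [← hwd]
  have hLw : Real.exp w = L := by rw [hwd, Real.exp_log hL0]
  obtain ⟨R, hRd⟩ : ∃ R, R = Real.sqrt x := ⟨_, rfl⟩
  rw [← hRd] at hR ⊢
  have hR0 : 0 < R := by rw [hR]; positivity
  have hxR : x = R^2 := by rw [hRd, Real.sq_sqrt hx.le]
  have e25 : (12.18:ℝ) ≤ Real.exp 2.5 := by
    refine le_trans ?_ (Real.sum_le_exp_of_nonneg (show (0:ℝ) ≤ 2.5 by norm_num) 11)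
    norm_num [Finset.sum_range_succ, Nat.factorial]
  have hR12 : 12.18 ≤ R := by
    rw [hR]; exact e25.trans (Real.exp_le_exp.2 (by norm_num; linarith))
  obtain ⟨p, hpd⟩ : ∃ p, p = 1/π := ⟨_, rfl⟩
  have hp0 : 0.3182 ≤ p := by
    rw [hpd, le_div_iff₀ Real.pi_pos]; have := Real.pi_lt_d4; norm_num at this ⊢; linarith
  have hp1 : p ≤ 0.31832 := by
    rw [hpd, div_le_iff₀ Real.pi_pos]; have := Real.pi_gt_d4; norm_num at this ⊢; linarith
  have hpp : 0 < p := by linarith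
  obtain ⟨t, htd⟩ : ∃ t, t = L/R := ⟨_, rfl⟩
  have ht0 : 0 < t := by rw [htd]; positivity
  have ht : t ≤ 0.4107 := by
    rw [htd, div_le_iff₀ hR0]
    have h1 : L/5 ≤ Real.exp ((L-5)/2) := (le_exp_sub (L/5)).trans (Real.exp_le_exp.2 (by linarith))
    have h2 : R = Real.exp ((L-5)/2) * Real.exp 2.5 := by rw [hR, ← Real.exp_add]; congr 1; ring
    have h3 : 0 < Real.exp ((L-5)/2) := Real.exp_pos _
    rw [h2]
    nlinarith
  obtain ⟨l, hl⟩ : ∃ l, l = L/2 - w := ⟨_, rfl⟩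
  have htl0 : t = Real.exp (-l) := by
    rw [htd, hl, neg_sub, Real.exp_sub, hLw, hR]
  have ee : Real.exp (-1) ≤ 0.368 := Real.exp_neg_one_lt_d9.le.trans (by norm_num)
  have htl : t*l ≤ 0.368 := by
    refine le_trans ?_ ee
    have h1 := mul_le_mul_of_nonneg_left (le_exp_sub l) ht0.le
    refine h1.trans (le_of_eq ?_)
    rw [htl0, ← Real.exp_add]; congr 1; ring
  have hl0 : 0 ≤ l := by
    by_contra h
    push Not at h
    have : 1 ≤ t := by rw [htl0]; exact Real.one_le_exp (by linarith)
    linarith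
  have htl2 : t*l^2 ≤ 0.5415 := by
    have h1 : (l/2)^2 ≤ Real.exp (l/2-1)^2 := pow_le_pow_left₀ (by positivity) (le_exp_sub _) 2
    have h2 : t * Real.exp (l/2-1)^2 = Real.exp (-1)^2 := by
      rw [htl0, ← Real.exp_nat_mul, ← Real.exp_nat_mul, ← Real.exp_add]; congr 1; push_cast; ring
    have h3 := mul_le_mul_of_nonneg_left h1 ht0.le
    rw [h2] at h3
    have h4 : Real.exp (-1) ≤ 0.36788 := Real.exp_neg_one_lt_d9.le.trans (by norm_num)
    have h5 := pow_le_pow_left₀ (Real.exp_pos _).le h4 2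
    norm_num at h5 ⊢
    linarith
  obtain ⟨s, hsd⟩ : ∃ s, s = Real.sqrt (L/5) := ⟨_, rfl⟩
  have hs2 : L = 5*s^2 := by rw [hsd, Real.sq_sqrt (by positivity)]; ring
  have hs1 : 1 ≤ s := by rw [hsd]; exact Real.one_le_sqrt.2 (by linarith)
  have hw0 : 0 ≤ w := by rw [hwd]; exact Real.log_nonneg (by linarith)
  have l5 : Real.log 5 ≤ 1.61 := by
    rw [Real.log_le_iff_le_exp (by norm_num)]
    refine le_trans ?_ (Real.sum_le_exp_of_nonneg (show (0:ℝ) ≤ 1.61 by norm_num) 10)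
    norm_num [Finset.sum_range_succ, Nat.factorial]
  have hw : w ≤ 2*s - 0.39 := by
    rw [hwd, hs2, Real.log_mul (by norm_num) (by positivity), Real.log_pow]
    have := Real.log_le_sub_one_of_pos (show 0 < s by linarith)
    push_cast
    linarith
  have hq : 1/R ≤ 0.0822 := by
    rw [div_le_iff₀ hR0]; linarith
  have main := num_final hp0 hp1 hq hs2 hs1 hw0 hw hl ht0.le ht htl htl2
  have hpt : π*(t*p) = t := by rw [hpd]; field_simp
  have h := psi_eta hRH (x := x) (η := t*p) (by rw [hxR]; nlinarith) (by positivity) (by rw [hpt]; linarith)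
  rw [← hRd] at h
  have hM : M0 (t*p) = l^2*p/2 + 2*p*l + 5*p^2/2 + 0.552 + 5*t*p^2/2 := by
    unfold M0
    rw [hpt, htl0, one_div, ← Real.exp_neg, neg_neg, Real.log_exp, hpd]
    field_simp
  rw [hM] at h
  refine h.trans ?_
  have m2 := mul_le_mul_of_nonneg_left main hR0.le
  have e1 : x*(t*p)/2 = R*(L*p/2) := by rw [hxR, htd]; field_simp
  have e2 : R*L*(L/(8*π) - (1/(2*π) + 1.465/L)*w + 1.2325) = R*(L^2*p/8 - L*w*p/2 - 1.465*w + 1.2325*L) := by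
    rw [hpd]; field_simp; ring
  have e3 : R*(2*(1/R)) = 2 := by field_simp
  rw [e2, e1]
  refine le_trans (le_of_eq ?_) m2
  linear_combination (-1)*e3

end PsiRH

namespace PsiRH
open Complex Filter Topology MeasureTheory
local notation "conj" => starRingEnd ℂ

noncomputable def cP (n : ℕ) : ℝ := ∑ k ∈ Finset.range (n+1), ArithmeticFunction.vonMangoldt k

lemma cP_mono {n m : ℕ} (h : n ≤ m) : cP n ≤ cP m := by
  unfold cP
  apply Finset.sum_le_sum_of_subset_of_nonneg
  · intro k; simp only [Finset.mem_range]; omega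
  · intro k _ _; exact ArithmeticFunction.vonMangoldt_nonneg

lemma cP_lo {n A : ℕ} (h : Real.log A ≤ cP n) (hA : 0 < A) (p k m : ℕ) (hp : p.Prime) (hk : k ≠ 0) (hm : p^k = m)
    (hnm : n < m) : Real.log ((A*p : ℕ):ℝ) ≤ cP m ∧ 0 < A*p := by
  refine ⟨?_, Nat.mul_pos hA hp.pos⟩
  obtain ⟨j, rfl⟩ : ∃ j, m = j+1 := ⟨m-1, by omega⟩
  have h1 : cP (j+1) = cP j + ArithmeticFunction.vonMangoldt (j+1) := by
    unfold cP; rw [Finset.sum_range_succ]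
  have h2 : ArithmeticFunction.vonMangoldt (j+1) = Real.log p := by
    rw [← hm, ArithmeticFunction.vonMangoldt_apply_pow hk, ArithmeticFunction.vonMangoldt_apply_prime hp]
  have h3 := cP_mono (show n ≤ j by omega)
  have hA' : (A:ℝ) ≠ 0 := by positivity
  have hp' : (p:ℝ) ≠ 0 := by have := hp.pos; positivity
  rw [Nat.cast_mul, Real.log_mul hA' hp', h1, h2]
  linarith

lemma cP_hi {n D : ℕ} (hD : D ≠ 0) (h : ∀ k ∈ Finset.Icc 1 n, D % k = 0) : cP n ≤ Real.log D := by
  rw [← ArithmeticFunction.vonMangoldt_sum (n := D)]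
  unfold cP
  rw [Finset.range_eq_Ico, Finset.sum_eq_sum_Ico_succ_bot (by omega)]
  simp only [ArithmeticFunction.map_zero, zero_add]
  apply Finset.sum_le_sum_of_subset_of_nonneg
  · intro k hk
    rw [Finset.mem_Ico] at hk
    rw [Nat.mem_divisors]
    exact ⟨Nat.dvd_of_mod_eq_zero (h k (Finset.mem_Icc.2 ⟨by omega, by omega⟩)), hD⟩
  · intro k _ _; exact ArithmeticFunction.vonMangoldt_nonneg

lemma log_ge {A a : ℕ} (hA : 0 < A) (h : (2.7182818286:ℝ)^a ≤ A) : (a:ℝ) ≤ Real.log A := by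
  rw [Real.le_log_iff_exp_le (by positivity), ← mul_one (a:ℝ), Real.exp_nat_mul]
  exact (pow_le_pow_left₀ (Real.exp_pos _).le Real.exp_one_lt_d9.le a).trans h

lemma log_le {A a : ℕ} (hA : 0 < A) (h : (A:ℝ) ≤ (2.7182818283:ℝ)^a) : Real.log A ≤ a := by
  rw [Real.log_le_iff_le_exp (by positivity), ← mul_one (a:ℝ), Real.exp_nat_mul]
  exact h.trans (pow_le_pow_left₀ (by norm_num) Real.exp_one_gt_d9.le a)

lemma h_lower {p L w : ℝ} (hp0 : 0.3182 ≤ p) (hp1 : p ≤ 0.31832) (hL0 : 2.39 ≤ L) (hL1 : L ≤ 5.01)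
    (hw : w ≤ 0.253 + L/3.5) : 0.73*L - 0.303 ≤ L^2*p/8 - L*w*p/2 - 1.465*w + 1.2325*L := by
  have hp00 : 0 < p := by linarith
  have h1 : L*p*w ≤ L*p*(0.253+L/3.5) := mul_le_mul_of_nonneg_left hw (by positivity)
  have h2 : L*p ≤ L*0.31832 := mul_le_mul_of_nonneg_left hp1 (by linarith)
  have h3 : L^2*p ≤ L^2*0.31832 := mul_le_mul_of_nonneg_left hp1 (by positivity)
  have h4 : 0 ≤ (L-2.39)*(5.01-L) := mul_nonneg (by linarith) (by linarith)
  have h4' : L^2 ≤ 7.4*L - 11.9739 := by nlinarith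
  have h5 : L*p*(0.253+L/3.5) = 0.253*(L*p) + 2/7*(L^2*p) := by ring
  have h6 : w ≤ 0.253 + 2/7*L := by refine hw.trans (le_of_eq ?_); ring
  have h7 : L*w*p = L*p*w := by ring
  rw [h7]
  rw [h5] at h1
  generalize L*p*w = X at *
  generalize L^2*p = Y at *
  generalize L*p = Z at *
  generalize L^2 = V at *
  linarith

lemma piece {x : ℝ} (n m a α β A D : ℕ) (r : ℝ) (hx : (n:ℝ) ≤ x) (hxm : x < m) (hn : 11 ≤ n) (hL1 : Real.log x ≤ 5)
    (hr : 0 ≤ r) (hr2 : r^2 ≤ n) (ha : 9 ≤ a) (hl : (2.7182818286:ℝ)^a ≤ (n^4:ℕ))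
    (hA0 : 0 < A) (hA : Real.log A ≤ cP n) (hA2 : (2.7182818286:ℝ)^α ≤ A)
    (hD0 : 0 < D) (hD : ∀ k ∈ Finset.Icc 1 (m-1), D % k = 0) (hD2 : (D:ℝ) ≤ (2.7182818283:ℝ)^β)
    (hb1 : (β:ℝ) - n ≤ r*(0.73*(a/4) - 0.303)) (hb2 : (m:ℝ) - α ≤ r*(0.73*(a/4) - 0.303)) :
    |chebyshevPsi x - x| ≤ Real.sqrt x * Real.log x *
          (Real.log x / (8 * π) - (1 / (2 * π) + 1.465 / Real.log x) * Real.log (Real.log x) + 1.2325) := by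
  have hn' : (11:ℝ) ≤ n := by exact_mod_cast hn
  have hx0 : 0 < x := by linarith
  have hfl : chebyshevPsi x = cP ⌊x⌋₊ := rfl
  have f1 : n ≤ ⌊x⌋₊ := Nat.le_floor hx
  have f2 : ⌊x⌋₊ ≤ m-1 := by have := (Nat.floor_lt hx0.le).2 hxm; omega
  have p1 : (α:ℝ) ≤ chebyshevPsi x := (log_ge hA0 hA2).trans (hA.trans (cP_mono f1))
  have p2 : chebyshevPsi x ≤ β := (cP_mono f2).trans ((cP_hi hD0.ne' hD).trans (log_le hD0 hD2))
  have q : |chebyshevPsi x - x| ≤ r*(0.73*(a/4) - 0.303) := by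
    rw [abs_le]; constructor <;> linarith
  refine q.trans ?_
  have hla : (a:ℝ)/4 ≤ Real.log x := by
    have h1 : (a:ℝ) ≤ Real.log (n^4:ℕ) := log_ge (by positivity) hl
    rw [Nat.cast_pow, Real.log_pow] at h1
    have h2 : Real.log n ≤ Real.log x := Real.log_le_log (by linarith) hx
    push_cast at h1
    linarith
  have l11 : 2.39 ≤ Real.log x := by
    have h2 : Real.log 11 ≤ Real.log x := Real.log_le_log (by norm_num) (by linarith)
    refine le_trans ?_ h2
    rw [Real.le_log_iff_exp_le (by norm_num)]
    have h3 : Real.exp 2.39 = Real.exp 1 ^ 2 * Real.exp 0.39 := by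
      rw [← Real.exp_nat_mul, ← Real.exp_add]; norm_num
    have h4 : Real.exp 0.39 ≤ 1.4771 := by
      refine (Real.exp_bound' (by norm_num) (by norm_num) (n := 7) (by norm_num)).trans ?_
      norm_num [Finset.sum_range_succ, Nat.factorial]
    have h5 : Real.exp 1 ^ 2 ≤ 2.7182818286^2 := pow_le_pow_left₀ (Real.exp_pos _).le Real.exp_one_lt_d9.le 2
    rw [h3]
    have h6 := mul_le_mul h5 h4 (Real.exp_pos _).le (by norm_num)
    refine h6.trans (by norm_num)
  obtain ⟨L, hLd⟩ : ∃ L, L = Real.log x := ⟨_, rfl⟩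
  rw [← hLd] at hla l11 hL1 ⊢
  have hL0 : 0 < L := by linarith
  have hw : Real.log L ≤ 0.253 + L/3.5 := by
    have h1 : L = 3.5*(L/3.5) := by ring
    have h2 : Real.log L = Real.log 3.5 + Real.log (L/3.5) := by
      conv_lhs => rw [h1]
      rw [Real.log_mul (by norm_num) (by positivity)]
    have h3 := Real.log_le_sub_one_of_pos (show 0 < L/3.5 by positivity)
    have h4 : Real.log 3.5 ≤ 1.253 := by
      rw [Real.log_le_iff_le_exp (by norm_num)]
      refine le_trans ?_ (Real.sum_le_exp_of_nonneg (show (0:ℝ) ≤ 1.253 by norm_num) 10)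
      norm_num [Finset.sum_range_succ, Nat.factorial]
    linarith
  have hp0 : 0.3182 ≤ 1/π := by
    rw [le_div_iff₀ Real.pi_pos]; have := Real.pi_lt_d4; norm_num at this ⊢; linarith
  have hp1 : 1/π ≤ 0.31832 := by
    rw [div_le_iff₀ Real.pi_pos]; have := Real.pi_gt_d4; norm_num at this ⊢; linarith
  have hh := h_lower hp0 hp1 l11 (by linarith) hw
  have hrx : r ≤ Real.sqrt x := Real.le_sqrt_of_sq_le (hr2.trans hx)
  have ha' : (9:ℝ) ≤ a := by exact_mod_cast ha
  have e2 : Real.sqrt x*L*(L/(8*π) - (1/(2*π) + 1.465/L)*Real.log L + 1.2325) =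
      Real.sqrt x*(L^2*(1/π)/8 - L*Real.log L*(1/π)/2 - 1.465*Real.log L + 1.2325*L) := by
    field_simp; ring
  rw [e2]
  exact mul_le_mul hrx (by linarith) (by linarith) (Real.sqrt_nonneg _)

lemma psi_small {x : ℝ} (hx : 11 ≤ x) (hL1 : Real.log x ≤ 5) (hx2 : x < 149) :
    |chebyshevPsi x - x| ≤ Real.sqrt x * Real.log x *
          (Real.log x / (8 * π) - (1 / (2 * π) + 1.465 / Real.log x) * Real.log (Real.log x) + 1.2325) := by
  have c : Real.log (1:ℕ) ≤ cP 0 ∧ 0 < 1 := ⟨by simp [cP], one_pos⟩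
  replace c := cP_lo c.1 c.2 2 1 2 (by norm_num) (by norm_num) (by norm_num) (by norm_num)
  replace c := cP_lo c.1 c.2 3 1 3 (by norm_num) (by norm_num) (by norm_num) (by norm_num)
  replace c := cP_lo c.1 c.2 2 2 4 (by norm_num) (by norm_num) (by norm_num) (by norm_num)
  replace c := cP_lo c.1 c.2 5 1 5 (by norm_num) (by norm_num) (by norm_num) (by norm_num)
  replace c := cP_lo c.1 c.2 7 1 7 (by norm_num) (by norm_num) (by norm_num) (by norm_num)
  replace c := cP_lo c.1 c.2 2 3 8 (by norm_num) (by norm_num) (by norm_num) (by norm_num)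
  replace c := cP_lo c.1 c.2 3 2 9 (by norm_num) (by norm_num) (by norm_num) (by norm_num)
  replace c := cP_lo c.1 c.2 11 1 11 (by norm_num) (by norm_num) (by norm_num) (by norm_num)
  by_cases h14 : x < 14
  · exact piece 11 14 9 10 13 _ 360360 (33/10) (by norm_num; linarith) (by norm_num; linarith) (by norm_num) hL1 (by norm_num) (by norm_num)
      (by norm_num) (by norm_num) c.2 (c.1.trans (cP_mono (by norm_num))) (by norm_num) (by norm_num) (by decide +kernel) (by norm_num)
      (by norm_num) (by norm_num)
  push Not at h14
  replace c := cP_lo c.1 c.2 13 1 13 (by norm_num) (by norm_num) (by norm_num) (by norm_num)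
  by_cases h17 : x < 17
  · exact piece 14 17 10 12 14 _ 720720 (37/10) (by norm_num; linarith) (by norm_num; linarith) (by norm_num) hL1 (by norm_num) (by norm_num)
      (by norm_num) (by norm_num) c.2 (c.1.trans (cP_mono (by norm_num))) (by norm_num) (by norm_num) (by decide +kernel) (by norm_num)
      (by norm_num) (by norm_num)
  push Not at h17
  replace c := cP_lo c.1 c.2 2 4 16 (by norm_num) (by norm_num) (by norm_num) (by norm_num)
  replace c := cP_lo c.1 c.2 17 1 17 (by norm_num) (by norm_num) (by norm_num) (by norm_num)
  by_cases h22 : x < 22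
  · exact piece 17 22 11 16 20 _ 232792560 (41/10) (by norm_num; linarith) (by norm_num; linarith) (by norm_num) hL1 (by norm_num) (by norm_num)
      (by norm_num) (by norm_num) c.2 (c.1.trans (cP_mono (by norm_num))) (by norm_num) (by norm_num) (by decide +kernel) (by norm_num)
      (by norm_num) (by norm_num)
  push Not at h22
  replace c := cP_lo c.1 c.2 19 1 19 (by norm_num) (by norm_num) (by norm_num) (by norm_num)
  by_cases h27 : x < 27
  · exact piece 22 27 12 19 25 _ 26771144400 (46/10) (by norm_num; linarith) (by norm_num; linarith) (by norm_num) hL1 (by norm_num) (by norm_num)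
      (by norm_num) (by norm_num) c.2 (c.1.trans (cP_mono (by norm_num))) (by norm_num) (by norm_num) (by decide +kernel) (by norm_num)
      (by norm_num) (by norm_num)
  push Not at h27
  replace c := cP_lo c.1 c.2 23 1 23 (by norm_num) (by norm_num) (by norm_num) (by norm_num)
  replace c := cP_lo c.1 c.2 5 2 25 (by norm_num) (by norm_num) (by norm_num) (by norm_num)
  replace c := cP_lo c.1 c.2 3 3 27 (by norm_num) (by norm_num) (by norm_num) (by norm_num)
  by_cases h35 : x < 35
  · exact piece 27 35 13 25 33 _ 144403552893600 (51/10) (by norm_num; linarith) (by norm_num; linarith) (by norm_num) hL1 (by norm_num) (by norm_num)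
      (by norm_num) (by norm_num) c.2 (c.1.trans (cP_mono (by norm_num))) (by norm_num) (by norm_num) (by decide +kernel) (by norm_num)
      (by norm_num) (by norm_num)
  push Not at h35
  replace c := cP_lo c.1 c.2 29 1 29 (by norm_num) (by norm_num) (by norm_num) (by norm_num)
  replace c := cP_lo c.1 c.2 31 1 31 (by norm_num) (by norm_num) (by norm_num) (by norm_num)
  replace c := cP_lo c.1 c.2 2 5 32 (by norm_num) (by norm_num) (by norm_num) (by norm_num)
  by_cases h45 : x < 45
  · exact piece 35 45 14 32 44 _ 9419588158802421600 (59/10) (by norm_num; linarith) (by norm_num; linarith) (by norm_num) hL1 (by norm_num) (by norm_num)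
      (by norm_num) (by norm_num) c.2 (c.1.trans (cP_mono (by norm_num))) (by norm_num) (by norm_num) (by decide +kernel) (by norm_num)
      (by norm_num) (by norm_num)
  push Not at h45
  replace c := cP_lo c.1 c.2 37 1 37 (by norm_num) (by norm_num) (by norm_num) (by norm_num)
  replace c := cP_lo c.1 c.2 41 1 41 (by norm_num) (by norm_num) (by norm_num) (by norm_num)
  replace c := cP_lo c.1 c.2 43 1 43 (by norm_num) (by norm_num) (by norm_num) (by norm_num)
  by_cases h59 : x < 59
  · exact piece 45 59 15 43 54 _ 164249358725037825439200 (67/10) (by norm_num; linarith) (by norm_num; linarith) (by norm_num) hL1 (by norm_num) (by norm_num)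
      (by norm_num) (by norm_num) c.2 (c.1.trans (cP_mono (by norm_num))) (by norm_num) (by norm_num) (by decide +kernel) (by norm_num)
      (by norm_num) (by norm_num)
  push Not at h59
  replace c := cP_lo c.1 c.2 47 1 47 (by norm_num) (by norm_num) (by norm_num) (by norm_num)
  replace c := cP_lo c.1 c.2 7 2 49 (by norm_num) (by norm_num) (by norm_num) (by norm_num)
  replace c := cP_lo c.1 c.2 53 1 53 (by norm_num) (by norm_num) (by norm_num) (by norm_num)
  replace c := cP_lo c.1 c.2 59 1 59 (by norm_num) (by norm_num) (by norm_num) (by norm_num)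
  by_cases h76 : x < 76
  · exact piece 59 76 16 57 76 _ 410555180440430163438262940577600 (76/10) (by norm_num; linarith) (by norm_num; linarith) (by norm_num) hL1 (by norm_num) (by norm_num)
      (by norm_num) (by norm_num) c.2 (c.1.trans (cP_mono (by norm_num))) (by norm_num) (by norm_num) (by decide +kernel) (by norm_num)
      (by norm_num) (by norm_num)
  push Not at h76
  replace c := cP_lo c.1 c.2 61 1 61 (by norm_num) (by norm_num) (by norm_num) (by norm_num)
  replace c := cP_lo c.1 c.2 2 6 64 (by norm_num) (by norm_num) (by norm_num) (by norm_num)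
  replace c := cP_lo c.1 c.2 67 1 67 (by norm_num) (by norm_num) (by norm_num) (by norm_num)
  replace c := cP_lo c.1 c.2 71 1 71 (by norm_num) (by norm_num) (by norm_num) (by norm_num)
  replace c := cP_lo c.1 c.2 73 1 73 (by norm_num) (by norm_num) (by norm_num) (by norm_num)
  by_cases h99 : x < 99
  · exact piece 76 99 17 75 95 _ 69720375229712477164533808935312303556800 (87/10) (by norm_num; linarith) (by norm_num; linarith) (by norm_num) hL1 (by norm_num) (by norm_num)
      (by norm_num) (by norm_num) c.2 (c.1.trans (cP_mono (by norm_num))) (by norm_num) (by norm_num) (by decide +kernel) (by norm_num)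
      (by norm_num) (by norm_num)
  push Not at h99
  replace c := cP_lo c.1 c.2 79 1 79 (by norm_num) (by norm_num) (by norm_num) (by norm_num)
  replace c := cP_lo c.1 c.2 3 4 81 (by norm_num) (by norm_num) (by norm_num) (by norm_num)
  replace c := cP_lo c.1 c.2 83 1 83 (by norm_num) (by norm_num) (by norm_num) (by norm_num)
  replace c := cP_lo c.1 c.2 89 1 89 (by norm_num) (by norm_num) (by norm_num) (by norm_num)
  replace c := cP_lo c.1 c.2 97 1 97 (by norm_num) (by norm_num) (by norm_num) (by norm_num)
  by_cases h123 : x < 123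
  · exact piece 99 123 18 94 120 _ 10514768575588513054648621420819083891762891880353600 (99/10) (by norm_num; linarith) (by norm_num; linarith) (by norm_num) hL1 (by norm_num) (by norm_num)
      (by norm_num) (by norm_num) c.2 (c.1.trans (cP_mono (by norm_num))) (by norm_num) (by norm_num) (by decide +kernel) (by norm_num)
      (by norm_num) (by norm_num)
  push Not at h123
  replace c := cP_lo c.1 c.2 101 1 101 (by norm_num) (by norm_num) (by norm_num) (by norm_num)
  replace c := cP_lo c.1 c.2 103 1 103 (by norm_num) (by norm_num) (by norm_num) (by norm_num)
  replace c := cP_lo c.1 c.2 107 1 107 (by norm_num) (by norm_num) (by norm_num) (by norm_num)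
  replace c := cP_lo c.1 c.2 109 1 109 (by norm_num) (by norm_num) (by norm_num) (by norm_num)
  replace c := cP_lo c.1 c.2 113 1 113 (by norm_num) (by norm_num) (by norm_num) (by norm_num)
  replace c := cP_lo c.1 c.2 11 2 121 (by norm_num) (by norm_num) (by norm_num) (by norm_num)
  by_cases h149 : x < 149
  · exact piece 123 149 19 119 142 _ 33312720618553145840562713089120360606823375590405920630576000 (110/10) (by norm_num; linarith) (by norm_num; linarith) (by norm_num) hL1 (by norm_num) (by norm_num)
      (by norm_num) (by norm_num) c.2 (c.1.trans (cP_mono (by norm_num))) (by norm_num) (by norm_num) (by decide +kernel) (by norm_num)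
      (by norm_num) (by norm_num)
  push Not at h149
  linarith

end PsiRH

theorem psi_bound_goldston_RH (hRH : RiemannHypothesis) :
    ∀ x : ℝ, 11 ≤ x → |chebyshevPsi x - x| ≤ Real.sqrt x * Real.log x *
          (Real.log x / (8 * π) - (1 / (2 * π) + 1.465 / Real.log x) * Real.log (Real.log x) + 1.2325) := by
  intro x hx
  rcases le_total 5 (Real.log x) with h | h
  · exact PsiRH.psi_large hRH (by linarith) h
  · refine PsiRH.psi_small hx h ?_
    have h1 := (Real.log_le_iff_le_exp (by linarith)).1 h
    have h2 : Real.exp 5 = Real.exp 1 ^ 5 := by rw [← Real.exp_nat_mul]; norm_num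
    have h3 : Real.exp 1 ^ 5 ≤ 2.7182818286 ^ 5 :=
      pow_le_pow_left₀ (Real.exp_pos _).le Real.exp_one_lt_d9.le 5
    have h4 : (2.7182818286:ℝ) ^ 5 < 149 := by norm_num
    linarith
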